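/- Let d ≥ 2, Ω = (−1,1)^d, p > 1, α ≥ 0, and q > p + α max{1, (p−1)/(d−1)}. Then there exist a nonnegative weight a ∈ C^α(Ω̄) and a function u ∈ W^{1,1}(Ω) with ∇u ∈ L^p(Ω) such that u is a local minimizer of the double phase functional F(w) = ∫_Ω (|∇w|^p/p + a(x)|∇w|^q/q) dx, and ∇u ∉ L^s(Ω) for every s > p. If moreover p < d, then there exists a closed set Σ ⊂ Ω consisting of non-Lebesgue points of u whose Hausdorff dimension equals d − p. -/

import Mathlib

open MeasureTheory Real Set Metric Filter Topology NNReal ENNReal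

noncomputable section

/-- `ℝ^n` with the Euclidean structure. -/
abbrev Euc (n : ℕ) := EuclideanSpace ℝ (Fin n)

/-- The open cube `(-1,1)^n`. -/
def Box (n : ℕ) : Set (Euc n) := {x | ∀ i, |x i| < 1}

/-- The last coordinate `x_d` of `x ∈ ℝ^{n+1}`. -/
def lastC {n : ℕ} (x : Euc (n + 1)) : ℝ := x (Fin.last n)

/-- The first `n` coordinates `x̄` of `x ∈ ℝ^{n+1}`. -/
def frontC {n : ℕ} (x : Euc (n + 1)) : Euc n := WithLp.toLp 2 fun i => x i.castSucc

/-- Assemble a point of `ℝ^{n+1}` from `x̄ ∈ ℝ^n` and a last coordinate. -/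
def snocC {n : ℕ} (xb : Euc n) (t : ℝ) : Euc (n + 1) :=
  WithLp.toLp 2 (Fin.snoc (α := fun _ => ℝ) xb.ofLp t)

/-- The first `m` coordinates of `x ∈ ℝ^{m+k}`. -/
def barPart {m k : ℕ} (x : Euc (m + k)) : Euc m := WithLp.toLp 2 fun i => x (Fin.castAdd k i)

/-- The last `k` coordinates of `x ∈ ℝ^{m+k}`. -/
def hatPart {m k : ℕ} (x : Euc (m + k)) : Euc k := WithLp.toLp 2 fun i => x (Fin.natAdd m i)

/-- Admissibility of a sequence of interval lengths for the generalized `(λ,γ)`-Cantor set: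
`l 0 = 1`, the lengths decrease fast enough (`l_{j-1} > 2 l_j`, removed gaps decreasing), and
`l j` is comparable to `λ^j j^γ`. -/
def IsCantorLengths (lam gam : ℝ) (l : ℕ → ℝ) : Prop :=
  l 0 = 1 ∧ (∀ j, 0 < l j) ∧ (∀ j, 2 * l (j + 1) < l j) ∧
    (∀ j, l (j + 1) - 2 * l (j + 2) < l j - 2 * l (j + 1)) ∧
    ∃ C : ℝ, 1 ≤ C ∧ ∀ j : ℕ, 1 ≤ j →
      C⁻¹ * lam ^ j * (j : ℝ) ^ gam ≤ l j ∧ l j ≤ C * lam ^ j * (j : ℝ) ^ gam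

/-- The point of the generalized Cantor set with address `ε` (left endpoints of the nested
intervals converge to this point). -/
def gCantorPoint (l : ℕ → ℝ) (ε : ℕ → Bool) : ℝ :=
  -(1 / 2 : ℝ) + ∑' j : ℕ, if ε j then l j - l (j + 1) else 0

/-- The generalized Cantor set determined by the lengths `l`. -/
def gCantorSet (l : ℕ → ℝ) : Set ℝ := Set.range (gCantorPoint l)

/-- The `m`-fold Cartesian power of the generalized Cantor set, inside `ℝ^m`. -/
def gCantorSetPi (l : ℕ → ℝ) (m : ℕ) : Set (Euc m) := {x | ∀ i, x i ∈ gCantorSet l}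

/-- The `j`-th binary digit of `t`. -/
def binDigit (t : ℝ) (j : ℕ) : Bool := ⌊t * 2 ^ (j + 1)⌋ % 2 = 1

/-- The Cantor measure attached to the lengths `l`: the image of the uniform distribution on
`[0,1)` under the map sending `t` to the Cantor point whose address is the binary digit
sequence of `t` (the digits being i.i.d. fair coins, this is the weak limit of the uniform
distributions on the pre-Cantor sets). -/
def gCantorMeasure (l : ℕ → ℝ) : Measure ℝ :=
  Measure.map (fun t => gCantorPoint l (binDigit t)) (volume.restrict (Set.Ico (0 : ℝ) 1))

/-- The `m`-fold product of the Cantor measure, as a measure on `ℝ^m`. -/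
def gCantorMeasurePi (l : ℕ → ℝ) (m : ℕ) : Measure (Euc m) :=
  Measure.map (⇑(MeasurableEquiv.toLp 2 (Fin m → ℝ)))
    (Measure.pi fun _ : Fin m => gCantorMeasure l)

/-- The fractal dimension `𝔇 = m log 2 / log(1/λ)`. -/
def frD (m : ℕ) (lam : ℝ) : ℝ := m * Real.log 2 / Real.log lam⁻¹

/-- `G` is the weak (distributional) differential of `u` on `Ω`:
integration by parts against smooth compactly supported test functions holds. -/
def HasWeakFDerivOn {n : ℕ} (Ω : Set (Euc n)) (u : Euc n → ℝ)
    (G : Euc n → Euc n →L[ℝ] ℝ) : Prop :=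
  ∀ φ : Euc n → ℝ, ContDiff ℝ (⊤ : ℕ∞) φ → HasCompactSupport φ → tsupport φ ⊆ Ω →
    ∫ x in Ω, u x • fderiv ℝ φ x = -∫ x in Ω, φ x • G x

/-- `u ∈ W^{1,1}(Ω)` with weak differential `G`. -/
def W11On {n : ℕ} (Ω : Set (Euc n)) (u : Euc n → ℝ) (G : Euc n → Euc n →L[ℝ] ℝ) : Prop :=
  IntegrableOn u Ω ∧ IntegrableOn G Ω ∧ HasWeakFDerivOn Ω u G

/-- `w ∈ W^{1,1}_0(Ω)` (with weak differential `G`): the extensions by zero form a Sobolev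
function on all of `ℝ^n`. -/
def ZeroBoundary {n : ℕ} (Ω : Set (Euc n)) (w : Euc n → ℝ)
    (G : Euc n → Euc n →L[ℝ] ℝ) : Prop :=
  Integrable (Set.indicator Ω w) ∧ Integrable (Set.indicator Ω G) ∧
    HasWeakFDerivOn Set.univ (Set.indicator Ω w) (Set.indicator Ω G)

/-- The energy `∫_Ω φ(x, g x) dx` for a scalar field `g` (typically `g = |∇w|`). -/
def energyOf {n : ℕ} (Ω : Set (Euc n)) (φ : Euc n → ℝ → ℝ) (g : Euc n → ℝ) : ℝ≥0∞ :=
  ∫⁻ x in Ω, ENNReal.ofReal (φ x (g x))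

/-- The Young (Legendre–Fenchel) conjugate `φ*(s) = sup_{t ≥ 0} (s t − φ(t))`. -/
def conjOrlicz (φ : ℝ → ℝ) (s : ℝ) : ℝ≥0∞ :=
  ⨆ t : ℝ≥0, ENNReal.ofReal (s * t - φ t)

/-- The conjugate energy `∫_Ω φ*(x, g x) dx`. -/
def energyConj {n : ℕ} (Ω : Set (Euc n)) (φ : Euc n → ℝ → ℝ) (g : Euc n → ℝ) : ℝ≥0∞ :=
  ∫⁻ x in Ω, conjOrlicz (φ x) (g x)

/-- `u` (with weak differential `G`, finite energy) is a local minimizer of the functional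
`w ↦ ∫_Ω φ(x,|∇w|) dx`: its energy does not exceed that of any Sobolev competitor that agrees
with `u` a.e. outside a compact subset of `Ω`. -/
def IsLocalMinimizer {n : ℕ} (Ω : Set (Euc n)) (φ : Euc n → ℝ → ℝ) (u : Euc n → ℝ)
    (G : Euc n → Euc n →L[ℝ] ℝ) : Prop :=
  W11On Ω u G ∧ energyOf Ω φ (fun x => ‖G x‖) < ⊤ ∧
    ∀ v Gv, W11On Ω v Gv →
      (∃ K : Set (Euc n), IsCompact K ∧ K ⊆ Ω ∧ ∀ᵐ x ∂(volume.restrict Ω), x ∉ K → v x = u x) →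
      energyOf Ω φ (fun x => ‖G x‖) ≤ energyOf Ω φ (fun x => ‖Gv x‖)

/-- `x` is a non-Lebesgue point of `u`: the averages of `|u − c|` on small balls around `x`
do not converge to `0` for any constant `c`. -/
def IsNonLebesguePoint {n : ℕ} (u : Euc n → ℝ) (x : Euc n) : Prop :=
  ¬ ∃ c : ℝ, Tendsto (fun r : ℝ => ⨍ y in Metric.ball x r, |u y - c| ∂volume)
      (𝓝[>] (0 : ℝ)) (𝓝 0)

/-- Membership in the Hölder class `C^α` on `s` (for `α ≥ 1` interpreted via
`C^{⌊α⌋, α − ⌊α⌋}`). -/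
def InHolderCls {n : ℕ} (α : ℝ) (s : Set (Euc n)) (a : Euc n → ℝ) : Prop :=
  ContDiffOn ℝ (⌊α⌋₊ : ℕ) a s ∧
    ∃ C : ℝ≥0, HolderOnWith C (Real.toNNReal (α - ⌊α⌋₊))
      (fun x => iteratedFDerivWithin ℝ ⌊α⌋₊ a s x) s

/-- The restricted Riesz potential `I₁^⋈(|f|)(x̄,0) = ∫_{C((x̄,0))} |f(y)| |x−y|^{1−d} dy`,
where `C(x)` is the double cone `{y : |ȳ − x̄| ≤ |y_d − x_d|/2}` (here `d = n+1`). -/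
def rieszBow {n : ℕ} (f : Euc (n + 1) → ℝ) (xb : Euc n) : ℝ≥0∞ :=
  ∫⁻ y : Euc (n + 1),
    ENNReal.ofReal ((if dist (frontC y) xb ≤ |lastC y| / 2 then (1 : ℝ) else 0) *
      |f y| * Real.sqrt (dist (frontC y) xb ^ 2 + lastC y ^ 2) ^ (-(n : ℝ)))

/-- The upper average `⟨f⟩⁺_{x̄,r} = ∫_{B_1} ω(y) f(x̄ + |r| ȳ, |r| y_d + |r|) dy`. -/
def avgPlus {n : ℕ} (ω : Euc (n + 1) → ℝ) (f : Euc (n + 1) → ℝ) (xb : Euc n) (r : ℝ) : ℝ :=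
  ∫ y in Metric.ball (0 : Euc (n + 1)) 1,
    ω y * f (snocC (xb + |r| • frontC y) (|r| * lastC y + |r|))

/-- The lower average `⟨f⟩⁻_{x̄,r} = ∫_{B_1} ω(y) f(x̄ + |r| ȳ, |r| y_d − |r|) dy`. -/
def avgMinus {n : ℕ} (ω : Euc (n + 1) → ℝ) (f : Euc (n + 1) → ℝ) (xb : Euc n) (r : ℝ) : ℝ :=
  ∫ y in Metric.ball (0 : Euc (n + 1)) 1,
    ω y * f (snocC (xb + |r| • frontC y) (|r| * lastC y - |r|))

open Classical in
/-- The function `u_d(x) = (1/2) sgn(x_d) θ(|x_d|/|x̄|)` (extended by its natural limit value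
`(1/2) sgn(x_d)` on the line `x̄ = 0`). -/
def uD {n : ℕ} (θ : ℝ → ℝ) (x : Euc (n + 1)) : ℝ :=
  if frontC x = 0 then (1 / 2) * Real.sign (lastC x)
  else (1 / 2) * Real.sign (lastC x) * θ (|lastC x| / ‖frontC x‖)

/-- Hypotheses on the profile function `θ`:
smooth on `(0,∞)`, `1_{(1/2,∞)} ≤ θ ≤ 1_{(1/4,∞)}` and `‖θ'‖_∞ ≤ 6`. -/
def IsProfile (θ : ℝ → ℝ) : Prop :=
  ContDiffOn ℝ (⊤ : ℕ∞) θ (Set.Ioi 0) ∧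
    (∀ t : ℝ, 0 < t → (if 1 / 2 < t then (1 : ℝ) else 0) ≤ θ t) ∧
    (∀ t : ℝ, 0 < t → θ t ≤ if 1 / 4 < t then 1 else 0) ∧
    (∀ t : ℝ, 0 < t → |deriv θ t| ≤ 6)

end

noncomputable section

lemma test_int1 {n : ℕ} {F : Type*} [NormedAddCommGroup F] [NormedSpace ℝ F] {μ : Measure (Euc n)}
    {w : Euc n → ℝ} (hw : Integrable w μ) {g : Euc n → F} (hg : Continuous g)
    (hc : HasCompactSupport g) : Integrable (fun x => w x • g x) μ := by
  obtain ⟨C, hC⟩ := hg.bounded_above_of_compact_support hc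
  exact hw.smul_bdd C (hg.aestronglyMeasurable) (Eventually.of_forall hC)

lemma test_int2 {n : ℕ} {F : Type*} [NormedAddCommGroup F] [NormedSpace ℝ F] {μ : Measure (Euc n)}
    {H : Euc n → F} (hH : Integrable H μ) {g : Euc n → ℝ} (hg : Continuous g)
    (hc : HasCompactSupport g) : Integrable (fun x => g x • H x) μ := by
  obtain ⟨C, hC⟩ := hg.bounded_above_of_compact_support hc
  exact hH.bdd_smul C hg.aestronglyMeasurable (Eventually.of_forall hC)

lemma W11On.lin {n : ℕ} {Ω : Set (Euc n)} {u v : Euc n → ℝ} {G H : Euc n → Euc n →L[ℝ] ℝ}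
    (hu : W11On Ω u G) (hv : W11On Ω v H) (s t : ℝ) :
    W11On Ω (fun x => s * u x + t * v x) (fun x => s • G x + t • H x) := by
  obtain ⟨a1, a2, a3⟩ := hu
  obtain ⟨b1, b2, b3⟩ := hv
  refine ⟨(a1.const_mul s).add (b1.const_mul t), (a2.smul s).add (b2.smul t), ?_⟩
  intro φ h1 h2 h3
  have hf : Continuous (fderiv ℝ φ) := h1.continuous_fderiv (by simp)
  have e1 := a3 φ h1 h2 h3
  have e2 := b3 φ h1 h2 h3
  have i1 := test_int1 a1 hf (h2.fderiv ℝ)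
  have i2 := test_int1 b1 hf (h2.fderiv ℝ)
  have i3 := test_int2 a2 h1.continuous h2
  have i4 := test_int2 b2 h1.continuous h2
  have : ∀ x, (s * u x + t * v x) • fderiv ℝ φ x = s • (u x • fderiv ℝ φ x) + t • (v x • fderiv ℝ φ x) := by
    intro x; module
  simp_rw [this]
  have h' : ∀ x, φ x • (s • G x + t • H x) = s • (φ x • G x) + t • (φ x • H x) := by
    intro x; module
  simp_rw [h']
  rw [integral_add (i1.fun_smul s) (i2.fun_smul t), integral_add (i3.fun_smul s) (i4.fun_smul t)]
  simp only [integral_smul]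
  rw [e1, e2]; module

lemma test_lim {n : ℕ} {F : Type*} [NormedAddCommGroup F] [NormedSpace ℝ F]
    {μ : Measure (Euc n)} {H : ℕ → Euc n → F}
    {K : Euc n → F} (hH : ∀ k, Integrable (H k) μ) (hK : Integrable K μ)
    (hl : Tendsto (fun k => ∫ x, ‖H k x - K x‖ ∂μ) atTop (𝓝 0))
    {F' : Type*} [NormedAddCommGroup F'] [NormedSpace ℝ F']
    {L : Euc n → F →L[ℝ] F'} (hL : Continuous L) (hc : HasCompactSupport L) :
    Tendsto (fun k => ∫ x, L x (H k x) ∂μ) atTop (𝓝 (∫ x, L x (K x) ∂μ)) := by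
  obtain ⟨C, hC⟩ := hL.bounded_above_of_compact_support hc
  have hm : AEStronglyMeasurable L μ := hL.aestronglyMeasurable
  have int : ∀ {M : Euc n → F}, Integrable M μ → Integrable (fun x => L x (M x)) μ := by
    intro M hM
    refine Integrable.mono' (hM.norm.const_mul C) ?_ ?_
    · exact (ContinuousLinearMap.id ℝ (F →L[ℝ] F')).aestronglyMeasurable_comp₂ hm hM.1
    · refine Eventually.of_forall fun x => ((L x).le_opNorm _).trans ?_
      gcongr; exact hC x
  rw [tendsto_iff_norm_sub_tendsto_zero]
  refine squeeze_zero (fun _ => norm_nonneg _) (g := fun k => C * ∫ x, ‖H k x - K x‖ ∂μ) ?_ ?_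
  · intro k
    rw [← integral_sub (int (hH k)) (int hK), ← integral_const_mul]
    refine norm_integral_le_of_norm_le (((hH k).sub hK).norm.const_mul C) (Eventually.of_forall fun x => ?_)
    rw [← map_sub]
    refine ((L x).le_opNorm _).trans ?_
    gcongr; exact hC x
  · simpa using hl.const_mul C

lemma W11On.lim {n : ℕ} {Ω : Set (Euc n)} {u : ℕ → Euc n → ℝ} {G : ℕ → Euc n → Euc n →L[ℝ] ℝ}
    {v : Euc n → ℝ} {H : Euc n → Euc n →L[ℝ] ℝ}
    (hu : ∀ k, W11On Ω (u k) (G k)) (hv : IntegrableOn v Ω) (hH : IntegrableOn H Ω)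
    (h1 : Tendsto (fun k => ∫ x in Ω, ‖u k x - v x‖) atTop (𝓝 0))
    (h2 : Tendsto (fun k => ∫ x in Ω, ‖G k x - H x‖) atTop (𝓝 0)) : W11On Ω v H := by
  refine ⟨hv, hH, ?_⟩
  intro φ p1 p2 p3
  have hf : Continuous (fderiv ℝ φ) := p1.continuous_fderiv (by simp)
  have A := test_lim (fun k => (hu k).1) hv h1
    (L := fun x => (ContinuousLinearMap.id ℝ ℝ).smulRight (fderiv ℝ φ x))
    (by fun_prop) (p2.fderiv ℝ |>.mono' (by
      intro x hx; apply subset_closure; intro h0; apply hx; simp [h0]))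
  have B := test_lim (fun k => (hu k).2.1) hH h2
    (L := fun x => φ x • (ContinuousLinearMap.id ℝ (Euc n →L[ℝ] ℝ)))
    (p1.continuous.smul continuous_const) (p2.mono' (by
      intro x hx; apply subset_closure; intro h0; apply hx; ext; simp [h0]))
  have C : ∀ k, ∫ x in Ω, ((ContinuousLinearMap.id ℝ ℝ).smulRight (fderiv ℝ φ x)) (u k x) =
    - ∫ x in Ω, (φ x • (ContinuousLinearMap.id ℝ (Euc n →L[ℝ] ℝ))) (G k x) := by
    intro k
    simpa using (hu k).2.2 φ p1 p2 p3
  simp_rw [C] at A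
  have := tendsto_nhds_unique A B.neg
  simpa using this

/-- admissible variations -/
def Adm {n : ℕ} (Ω : Set (Euc n)) (w : Euc n → ℝ) (H : Euc n → Euc n →L[ℝ] ℝ) : Prop :=
  W11On univ w H ∧ (∀ x ∉ Ω, w x = 0) ∧ (∀ x ∉ Ω, H x = 0)

lemma Adm.lin {n : ℕ} {Ω : Set (Euc n)} {u v : Euc n → ℝ} {G H : Euc n → Euc n →L[ℝ] ℝ}
    (hu : Adm Ω u G) (hv : Adm Ω v H) (s t : ℝ) :
    Adm Ω (fun x => s * u x + t * v x) (fun x => s • G x + t • H x) :=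
  ⟨hu.1.lin hv.1 s t, fun x hx => by simp [hu.2.1 x hx, hv.2.1 x hx],
    fun x hx => by simp [hu.2.2 x hx, hv.2.2 x hx]⟩

lemma Adm.w11 {n : ℕ} {Ω : Set (Euc n)} {u : Euc n → ℝ} {G : Euc n → Euc n →L[ℝ] ℝ}
    (hu : Adm Ω u G) : W11On Ω u G := by
  refine ⟨hu.1.1.mono_set (subset_univ _), hu.1.2.1.mono_set (subset_univ _), ?_⟩
  intro φ h1 h2 h3
  have := hu.1.2.2 φ h1 h2 (subset_univ _)
  rw [setIntegral_univ, setIntegral_univ] at this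
  rw [setIntegral_eq_integral_of_forall_compl_eq_zero, setIntegral_eq_integral_of_forall_compl_eq_zero]
  · exact this
  · intro x hx; simp [hu.2.2 x hx]
  · intro x hx; simp [hu.2.1 x hx]

end

noncomputable section

lemma lintegral_conv_le {n : ℕ} {F : Type*} [NormedAddCommGroup F]
    {k : Euc n → ℝ} (hk : Continuous k) {H : Euc n → F} (hH : AEStronglyMeasurable H volume)
    (hk1 : ∫⁻ x, ENNReal.ofReal (k x) ≤ 1) :
    ∫⁻ x, ∫⁻ y, ENNReal.ofReal (k (x - y)) * ‖H y‖ₑ ≤ ∫⁻ y, ‖H y‖ₑ := by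
  rw [lintegral_lintegral_swap]
  · refine lintegral_mono fun y => ?_
    rw [lintegral_mul_const' _ _ enorm_ne_top, lintegral_sub_right_eq_self (fun x => ENNReal.ofReal (k x)) y]
    calc _ ≤ 1 * ‖H y‖ₑ := by gcongr
      _ = _ := one_mul _
  · refine AEMeasurable.mul (f := fun z : Euc n × Euc n => ENNReal.ofReal (k (z.1 - z.2)))
      (g := fun z : Euc n × Euc n => ‖H z.2‖ₑ) ?_ ?_
    · apply Measurable.aemeasurable; fun_prop
    · exact hH.enorm.comp_snd

lemma Adm.poincare {n : ℕ} (hn : 2 ≤ n) {Ω : Set (Euc n)} (hΩ : Bornology.IsBounded Ω) :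
    ∃ C : ℝ≥0, ∀ w H, Adm Ω w H → ∫⁻ x, ‖w x‖ₑ ≤ C * ∫⁻ x, ‖H x‖ₑ := by
  obtain ⟨R, hR⟩ := hΩ.subset_closedBall 0
  refine ⟨eLpNormLESNormFDerivOfLeConst ℝ volume (closedBall (0 : Euc n) (R + 1)) 1 1, ?_⟩
  intro w H hw
  have hwi : Integrable w := by simpa using hw.1.1
  have hHi : Integrable H := by simpa using hw.1.2.1
  let κ : ℕ → ContDiffBump (0 : Euc n) := fun k =>
    ⟨1 / (k + 2 : ℝ) / 2, 1 / (k + 2 : ℝ), by positivity, by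
      have : 0 < 1 / (k + 2 : ℝ) := by positivity
      linarith⟩
  have hk0 : Tendsto (fun k => (κ k).rOut) atTop (𝓝 0) := by
    have := tendsto_one_div_add_atTop_nhds_zero_nat (𝕜 := ℝ)
    refine squeeze_zero (fun k => (κ k).rOut_pos.le) (fun k => ?_) this
    show 1 / (k + 2 : ℝ) ≤ 1 / (k + 1 : ℝ)
    gcongr; norm_num
  have hae := ContDiffBump.ae_convolution_tendsto_right_of_locallyIntegrable (φ := κ) (K := 2)
    (g := w) (μ := volume) hk0 (Eventually.of_forall fun k => by
      show 1 / (k + 2 : ℝ) ≤ 2 * (1 / (k + 2 : ℝ) / 2)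
      linarith) hwi.locallyIntegrable
  set f : ℕ → Euc n → ℝ := fun k =>
    MeasureTheory.convolution ((κ k).normed volume) w (ContinuousLinearMap.lsmul ℝ ℝ) volume with hf
  have hκs : ∀ k, ContDiff ℝ (⊤ : ℕ∞) ((κ k).normed volume) := fun k => (κ k).contDiff_normed
  have hκc : ∀ k, HasCompactSupport ((κ k).normed volume) := fun k => (κ k).hasCompactSupport_normed
  have hfs : ∀ k, ContDiff ℝ 1 (f k) := fun k => by
    have := (hκc k).contDiff_convolution_left (ContinuousLinearMap.lsmul ℝ ℝ) (n := 1)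
      (μ := volume) ((hκs k).of_le (by exact_mod_cast le_top)) hwi.locallyIntegrable
    exact_mod_cast this
  have hder : ∀ k x, fderiv ℝ (f k) x = ∫ y, ((κ k).normed volume (x - y)) • H y := by
    intro k x
    have h1 := (hκc k).hasFDerivAt_convolution_left (ContinuousLinearMap.lsmul ℝ ℝ)
      (μ := volume) ((hκs k).of_le (by exact_mod_cast le_top)) hwi.locallyIntegrable x
    rw [h1.fderiv]
    have hc : HasCompactSupport (fun y => (κ k).normed volume (x - y)) :=
      (hκc k).comp_homeomorph (Homeomorph.subLeft x)
    have hs : ContDiff ℝ (⊤ : ℕ∞) (fun y => (κ k).normed volume (x - y)) :=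
      (hκs k).comp (contDiff_const.sub contDiff_id)
    have h2 := hw.1.2.2 (fun y => (κ k).normed volume (x - y)) hs hc (subset_univ _)
    rw [setIntegral_univ, setIntegral_univ] at h2
    rw [← neg_eq_iff_eq_neg] at h2
    rw [← h2, ← integral_neg]
    rw [convolution_eq_swap]
    refine integral_congr_ae (Eventually.of_forall fun y => ?_)
    have h3 : fderiv ℝ (fun y => (κ k).normed volume (x - y)) y = - fderiv ℝ ((κ k).normed volume) (x - y) := by
      have hd : HasFDerivAt ((κ k).normed volume) (fderiv ℝ ((κ k).normed volume) (x - y)) (x - y) :=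
        ((hκs k).differentiable (by simp)).differentiableAt.hasFDerivAt
      have := hd.comp y ((hasFDerivAt_const x y).sub (hasFDerivAt_id y))
      rw [HasFDerivAt.fderiv (f := fun y => (κ k).normed volume (x - y)) this]
      ext v; simp
    simp only [h3]
    ext v
    simp [ContinuousLinearMap.precompL, mul_comm]
  have hsupp : ∀ k, (f k).support ⊆ closedBall 0 (R + 1) := by
    intro k x hx
    have hx := support_convolution_subset_swap (L := ContinuousLinearMap.lsmul ℝ ℝ) (μ := volume) hx
    obtain ⟨b, hb, a, ha, rfl⟩ := hx
    have hb' : b ∈ Ω := by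
      by_contra h; exact hb (hw.2.1 b h)
    have hb'' := hR hb'
    rw [(κ k).support_normed_eq] at ha
    have : (κ k).rOut ≤ 1 := by
      show 1 / (k + 2 : ℝ) ≤ 1
      rw [div_le_one (by positivity)]
      have : (0:ℝ) ≤ k := by positivity
      linarith
    simp only [mem_closedBall, mem_ball, dist_zero_right] at *
    calc ‖b + a‖ ≤ ‖b‖ + ‖a‖ := norm_add_le _ _
      _ ≤ _ := by linarith
  have hb : ∀ k, ∫⁻ x, ‖f k x‖ₑ ≤
      eLpNormLESNormFDerivOfLeConst ℝ volume (closedBall (0 : Euc n) (R + 1)) 1 1 * ∫⁻ x, ‖H x‖ₑ := by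
    intro k
    have h := eLpNorm_le_eLpNorm_fderiv volume (hfs k) (hsupp k) (p := 1) le_rfl
      (by simp; omega) isBounded_closedBall
    simp only [ENNReal.coe_one, eLpNorm_one_eq_lintegral_enorm] at h
    refine h.trans ?_
    refine mul_le_mul_right ?_ _
    refine le_trans ?_ (lintegral_conv_le (k := (κ k).normed volume) (hκs k).continuous hHi.1 ?_)
    · refine lintegral_mono fun x => ?_
      rw [hder]
      refine (enorm_integral_le_lintegral_enorm _).trans (le_of_eq ?_)
      refine lintegral_congr fun y => ?_
      rw [enorm_smul, Real.enorm_of_nonneg ((κ k).nonneg_normed _)]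
    · rw [← ofReal_integral_eq_lintegral_ofReal (κ k).integrable_normed
        (Eventually.of_forall (κ k).nonneg_normed), (κ k).integral_normed]
      simp
  calc ∫⁻ x, ‖w x‖ₑ = ∫⁻ x, liminf (fun k => ‖f k x‖ₑ) atTop := by
        refine lintegral_congr_ae ?_
        filter_upwards [hae] with x hx
        exact (hx.enorm.liminf_eq).symm
    _ ≤ liminf (fun k => ∫⁻ x, ‖f k x‖ₑ) atTop :=
        lintegral_liminf_le fun k => (hfs k).continuous.measurable.enorm
    _ ≤ _ := by
        refine liminf_le_of_le (by isBoundedDefault) fun b hb' => ?_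
        obtain ⟨k, hk⟩ := hb'.exists
        exact hk.trans (hb k)
end

noncomputable section

/-- convexity defect -/
def dfc {V : Type*} [NormedAddCommGroup V] [NormedSpace ℝ V] (p : ℝ) (ξ η : V) : ℝ :=
  (‖ξ‖ ^ p + ‖η‖ ^ p) / 2 - ‖(1/2 : ℝ) • ξ + (1/2 : ℝ) • η‖ ^ p

lemma mid_norm_le {V : Type*} [NormedAddCommGroup V] [NormedSpace ℝ V] (ξ η : V) :
    ‖(1/2 : ℝ) • ξ + (1/2 : ℝ) • η‖ ≤ (1/2) * ‖ξ‖ + (1/2) * ‖η‖ := by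
  refine (norm_add_le _ _).trans (le_of_eq ?_)
  rw [norm_smul, norm_smul]; norm_num

lemma mid_pow_le {p : ℝ} (hp : 1 ≤ p) {s t : ℝ} (hs : 0 ≤ s) (ht : 0 ≤ t) :
    ((1/2) * s + (1/2) * t) ^ p ≤ (s ^ p + t ^ p) / 2 := by
  have := (convexOn_rpow hp).2 hs ht (by norm_num : (0:ℝ) ≤ 1/2) (by norm_num : (0:ℝ) ≤ 1/2) (by norm_num)
  simp only [smul_eq_mul] at this
  linarith

lemma dfc_nonneg {V : Type*} [NormedAddCommGroup V] [NormedSpace ℝ V] {p : ℝ} (hp : 1 ≤ p) (ξ η : V) :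
    0 ≤ dfc p ξ η := by
  have h1 := rpow_le_rpow (norm_nonneg _) (mid_norm_le ξ η) (by linarith : 0 ≤ p)
  have h2 := mid_pow_le hp (norm_nonneg ξ) (norm_nonneg η)
  unfold dfc; linarith

lemma dfc_pos {V : Type*} [NormedAddCommGroup V] [InnerProductSpace ℝ V] {p : ℝ} (hp : 1 < p) {ξ η : V}
    (h : ξ ≠ η) : 0 < dfc p ξ η := by
  have h1 := rpow_le_rpow (norm_nonneg _) (mid_norm_le ξ η) (by linarith : 0 ≤ p)
  have h2 := mid_pow_le hp.le (norm_nonneg ξ) (norm_nonneg η)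
  by_cases hn : ‖ξ‖ = ‖η‖
  · have h3 : ‖(1/2 : ℝ) • ξ + (1/2 : ℝ) • η‖ < (1/2) * ‖ξ‖ + (1/2) * ‖η‖ := by
      refine lt_of_le_of_ne (mid_norm_le ξ η) fun he => h ?_
      apply eq_of_norm_eq_of_norm_add_eq hn
      rw [← smul_add, norm_smul] at he
      norm_num at he; linarith
    have := rpow_lt_rpow (norm_nonneg _) h3 (by linarith : 0 < p)
    unfold dfc; linarith
  · have := (strictConvexOn_rpow hp).2 (norm_nonneg ξ) (norm_nonneg η) hn
      (by norm_num : (0:ℝ) < 1/2) (by norm_num : (0:ℝ) < 1/2) (by norm_num)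
    simp only [smul_eq_mul] at this
    unfold dfc; linarith

lemma dfc_smul {V : Type*} [NormedAddCommGroup V] [NormedSpace ℝ V] {p : ℝ} {l : ℝ} (hl : 0 ≤ l) (ξ η : V) :
    dfc p (l • ξ) (l • η) = l ^ p * dfc p ξ η := by
  unfold dfc
  have : (1/2 : ℝ) • l • ξ + (1/2 : ℝ) • l • η = l • ((1/2 : ℝ) • ξ + (1/2 : ℝ) • η) := by module
  rw [this]; simp only [norm_smul, Real.norm_of_nonneg hl]
  rw [mul_rpow hl (norm_nonneg _), mul_rpow hl (norm_nonneg _), mul_rpow hl (norm_nonneg _)]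
  ring

lemma uc_one {V : Type*} [NormedAddCommGroup V] [InnerProductSpace ℝ V] [FiniteDimensional ℝ V]
    {p : ℝ} (hp : 1 < p) {τ : ℝ} (hτ : 0 < τ) :
    ∃ C : ℝ, 0 ≤ C ∧ ∀ ξ η : V, ‖ξ - η‖ ^ p ≤ C * dfc p ξ η + τ * (‖ξ‖ ^ p + ‖η‖ ^ p) := by
  have hp0 : 0 < p := by linarith
  set S : Set (V × V) := {z | ‖z.1‖ ^ p + ‖z.2‖ ^ p = 1 ∧ τ ≤ ‖z.1 - z.2‖ ^ p} with hS
  have c1 : Continuous fun z : V × V => ‖z.1‖ ^ p := continuous_fst.norm.rpow_const fun _ => Or.inr hp0.le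
  have c2 : Continuous fun z : V × V => ‖z.2‖ ^ p := continuous_snd.norm.rpow_const fun _ => Or.inr hp0.le
  have c3 : Continuous fun z : V × V => ‖z.1 - z.2‖ ^ p :=
    (continuous_fst.sub continuous_snd).norm.rpow_const fun _ => Or.inr hp0.le
  have c4 : Continuous fun z : V × V => dfc p z.1 z.2 := by
    unfold dfc
    refine ((c1.add c2).div_const 2).sub (Continuous.rpow_const (by fun_prop) fun _ => Or.inr hp0.le)
  have hScl : IsClosed S := (isClosed_eq (c1.add c2) continuous_const).inter (isClosed_le continuous_const c3)
  have hle : ∀ {s t : ℝ}, 0 ≤ s → 0 ≤ t → s ^ p + t ^ p = 1 → s ≤ 1 := by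
    intro s t hs ht h
    by_contra! h'
    have := one_lt_rpow h' hp0
    have := rpow_nonneg ht p
    linarith
  have hSc : IsCompact S := by
    have : ProperSpace V := FiniteDimensional.proper ℝ V
    refine (isCompact_closedBall (0 : V × V) 1).of_isClosed_subset hScl ?_
    rintro ⟨x, y⟩ ⟨h, -⟩
    simp only at h
    rw [mem_closedBall, dist_zero_right, Prod.norm_def]
    exact max_le (hle (norm_nonneg _) (norm_nonneg y) h)
      (hle (norm_nonneg _) (norm_nonneg x) (by linarith))
  obtain ⟨c, hc, hcS⟩ : ∃ c > 0, ∀ z ∈ S, c ≤ dfc p z.1 z.2 := by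
    rcases S.eq_empty_or_nonempty with h | h
    · exact ⟨1, one_pos, by simp [h]⟩
    · obtain ⟨z, hz, hm⟩ := hSc.exists_isMinOn h c4.continuousOn
      refine ⟨dfc p z.1 z.2, dfc_pos hp ?_, fun y hy => hm hy⟩
      intro he
      have := hz.2
      rw [he, sub_self, norm_zero, Real.zero_rpow hp0.ne'] at this
      linarith
  refine ⟨2 ^ p / c, by positivity, ?_⟩
  have key : ∀ ξ η : V, ‖ξ‖ ^ p + ‖η‖ ^ p = 1 → ‖ξ - η‖ ^ p ≤ 2 ^ p / c * dfc p ξ η + τ * (‖ξ‖ ^ p + ‖η‖ ^ p) := by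
    intro ξ η h
    have hd := dfc_nonneg hp.le ξ η
    by_cases hz : τ ≤ ‖ξ - η‖ ^ p
    · have h1 := hcS (ξ, η) ⟨h, hz⟩
      have h2 : ‖ξ - η‖ ≤ 2 := by
        have := norm_sub_le ξ η
        have := hle (norm_nonneg _) (norm_nonneg η) h
        have := hle (norm_nonneg η) (norm_nonneg ξ) (by linarith)
        linarith
      have h3 := rpow_le_rpow (norm_nonneg _) h2 hp0.le
      have h4 : (2:ℝ) ^ p ≤ 2 ^ p / c * dfc p ξ η := by
        rw [div_mul_eq_mul_div, le_div_iff₀ hc]; gcongr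
      rw [h]; linarith
    · rw [h]
      have : 0 ≤ 2 ^ p / c * dfc p ξ η := by positivity
      linarith
  intro ξ η
  set N := ‖ξ‖ ^ p + ‖η‖ ^ p with hN
  have hx0 := rpow_nonneg (norm_nonneg ξ) p
  have hy0 := rpow_nonneg (norm_nonneg η) p
  rcases (add_nonneg hx0 hy0).eq_or_lt with h | h
  · have e1 : ξ = 0 := by
      have : ‖ξ‖ ^ p = 0 := by linarith
      rw [rpow_eq_zero (norm_nonneg _) hp0.ne'] at this; simpa using this
    have e2 : η = 0 := by
      have : ‖η‖ ^ p = 0 := by linarith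
      rw [rpow_eq_zero (norm_nonneg _) hp0.ne'] at this; simpa using this
    have := dfc_nonneg hp.le ξ η
    subst e1 e2
    have h6 : ‖(0 : V) - 0‖ ^ p = 0 := by rw [sub_zero, norm_zero, Real.zero_rpow hp0.ne']
    rw [h6]; positivity
  · rw [← hN] at h
    set l := N ^ (-1 / p) with hl
    have hl0 : 0 < l := rpow_pos_of_pos h _
    have hlp : l ^ p = N⁻¹ := by
      rw [hl, ← rpow_mul h.le, div_mul_cancel₀ _ hp0.ne', Real.rpow_neg_one]
    have hns : ∀ v : V, ‖l • v‖ ^ p = N⁻¹ * ‖v‖ ^ p := by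
      intro v; rw [norm_smul, Real.norm_of_nonneg hl0.le, mul_rpow hl0.le (norm_nonneg _), hlp]
    have := key (l • ξ) (l • η) (by rw [hns, hns, ← mul_add, ← hN, inv_mul_cancel₀ h.ne'])
    rw [dfc_smul hl0.le, hlp, ← smul_sub, hns, hns, hns, ← mul_add, ← hN] at this
    have h5 := mul_le_mul_of_nonneg_left this h.le
    have hNN : N * N⁻¹ = 1 := mul_inv_cancel₀ h.ne'
    calc ‖ξ - η‖ ^ p = N * (N⁻¹ * ‖ξ - η‖ ^ p) := by rw [← mul_assoc, hNN, one_mul]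
      _ ≤ _ := h5
      _ = 2 ^ p / c * dfc p ξ η * (N * N⁻¹) + τ * N * (N * N⁻¹) := by ring
      _ = _ := by rw [hNN]; ring

lemma uc_dual {n : ℕ} {p : ℝ} (hp : 1 < p) {τ : ℝ} (hτ : 0 < τ) :
    ∃ C : ℝ, 0 ≤ C ∧ ∀ ξ η : Euc n →L[ℝ] ℝ,
      ‖ξ - η‖ ≤ C * dfc p ξ η + τ * (1 + (‖ξ‖ ^ p + ‖η‖ ^ p)) := by
  obtain ⟨C, hC, h⟩ := uc_one (V := Euc n) hp (τ := τ ^ p) (by positivity)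
  refine ⟨τ ^ (1 - p) * C, by positivity, fun ξ η => ?_⟩
  set e := (InnerProductSpace.toDual ℝ (Euc n)).symm with he
  have h1 := h (e ξ) (e η)
  have hd : dfc p (e ξ) (e η) = dfc p ξ η := by
    unfold dfc
    have : (1/2 : ℝ) • e ξ + (1/2 : ℝ) • e η = e ((1/2 : ℝ) • ξ + (1/2 : ℝ) • η) := by
      rw [map_add]; simp
    rw [this]; simp only [LinearIsometryEquiv.norm_map]
  rw [hd, ← map_sub] at h1
  simp only [LinearIsometryEquiv.norm_map] at h1
  set s := ‖ξ - η‖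
  have hs : 0 ≤ s := norm_nonneg _
  have h2 : s ≤ τ + τ ^ (1 - p) * s ^ p := by
    rcases le_or_gt s τ with h | h
    · have : 0 ≤ τ ^ (1 - p) * s ^ p := by positivity
      linarith
    · have hs' : 0 < s := hτ.trans h
      have : s = s ^ (1 - p) * s ^ p := by rw [← rpow_add hs']; simp
      have h3 : s ^ (1 - p) ≤ τ ^ (1 - p) := rpow_le_rpow_of_nonpos hτ h.le (by linarith)
      have h4 : s ^ (1 - p) * s ^ p ≤ τ ^ (1 - p) * s ^ p := by gcongr
      linarith
  have h3 : τ ^ (1 - p) * s ^ p ≤ τ ^ (1 - p) * (C * dfc p ξ η + τ ^ p * (‖ξ‖ ^ p + ‖η‖ ^ p)) := by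
    gcongr
  have h4 : τ ^ (1 - p) * τ ^ p = τ := by rw [← rpow_add hτ]; simp
  have h5 : τ ^ (1 - p) * (C * dfc p ξ η + τ ^ p * (‖ξ‖ ^ p + ‖η‖ ^ p)) =
    τ ^ (1 - p) * C * dfc p ξ η + (τ ^ (1 - p) * τ ^ p) * (‖ξ‖ ^ p + ‖η‖ ^ p) := by ring
  rw [h4] at h5
  linarith
end

noncomputable section
open scoped Manifold ContDiff

lemma exists_cutoff {n : ℕ} {K Ω : Set (Euc n)} (hK : IsCompact K) (hΩ : IsOpen Ω) (h : K ⊆ Ω) :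
    ∃ χ : Euc n → ℝ, ContDiff ℝ (⊤ : ℕ∞) χ ∧ HasCompactSupport χ ∧ tsupport χ ⊆ Ω ∧
      ∃ V, IsOpen V ∧ K ⊆ V ∧ ∀ x ∈ V, χ x = 1 := by
  obtain ⟨L, hL, hKL, hLΩ⟩ := exists_compact_between hK hΩ h
  obtain ⟨f, h1, h2, h3⟩ := exists_contMDiffMap_one_nhds_of_subset_interior (n := (⊤ : ℕ∞)) 𝓘(ℝ, Euc n) hK.isClosed hKL
  have hs : tsupport f ⊆ L := by
    refine closure_minimal ?_ hL.isClosed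
    intro x hx; by_contra h; exact hx (h2 x h)
  refine ⟨f, f.contMDiff.contDiff, HasCompactSupport.of_support_subset_isCompact hL
    (subset_closure.trans hs), hs.trans hLΩ, ?_⟩
  obtain ⟨V, hV, hKV, hVf⟩ := (eventually_nhdsSet_iff_exists).1 h1
  exact ⟨V, hV, hKV, hVf⟩

lemma ind_int {n : ℕ} {Ω : Set (Euc n)} {F : Type*} [NormedAddCommGroup F] {H : Euc n → F}
    (h : IntegrableOn H Ω) (hΩ : MeasurableSet Ω) : Integrable (Ω.indicator H) :=
  (integrable_indicator_iff hΩ).2 h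

lemma adm_of_diff {n : ℕ} {Ω K : Set (Euc n)} (hΩ : IsOpen Ω) (hK : IsCompact K) (hKΩ : K ⊆ Ω)
    {w : Euc n → ℝ} {H : Euc n → Euc n →L[ℝ] ℝ} (hw : W11On Ω w H)
    (h0 : ∀ᵐ x ∂(volume.restrict Ω), x ∉ K → w x = 0) :
    Adm Ω (Ω.indicator w) (Ω.indicator H) := by
  obtain ⟨a1, a2, a3⟩ := hw
  refine ⟨⟨?_, ?_, ?_⟩, fun x hx => indicator_of_notMem hx _, fun x hx => indicator_of_notMem hx _⟩
  · rw [integrableOn_univ, integrable_indicator_iff hΩ.measurableSet]; exact a1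
  · rw [integrableOn_univ]; exact ind_int a2 hΩ.measurableSet
  have hUo : IsOpen (Ω \ K) := hΩ.sdiff hK.isClosed
  have hH0 : ∀ᵐ x, x ∈ Ω \ K → H x = 0 := by
    refine hUo.ae_eq_zero_of_integral_contDiff_smul_eq_zero (a2.mono_set sdiff_subset).locallyIntegrableOn ?_
    intro g hg hgc hgs
    have := a3 g hg hgc (hgs.trans sdiff_subset)
    have e1 : ∫ x in Ω, w x • fderiv ℝ g x = 0 := by
      rw [integral_eq_zero_of_ae]
      filter_upwards [h0] with x hx
      by_cases hxK : x ∈ K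
      · have : x ∉ tsupport (fderiv ℝ g) := fun h => (hgs (tsupport_fderiv_subset ℝ h)).2 hxK
        simp [image_eq_zero_of_notMem_tsupport this]
      · simp [hx hxK]
    rw [e1, zero_eq_neg] at this
    rw [← this]
    rw [setIntegral_eq_integral_of_forall_compl_eq_zero]
    intro x hx
    rw [image_eq_zero_of_notMem_tsupport (fun h => hx (hgs h).1), zero_smul]
  intro φ h1 h2 _
  obtain ⟨χ, c1, c2, c3, V, hV, hKV, hχ⟩ := exists_cutoff hK hΩ hKΩ
  have ht := a3 (fun x => χ x * φ x) (c1.mul h1) (c2.mul_right) ((tsupport_mul_subset_left).trans c3)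
  rw [setIntegral_univ, setIntegral_univ]
  have e1 : ∫ x, Ω.indicator w x • fderiv ℝ φ x = ∫ x in Ω, w x • fderiv ℝ (fun x => χ x * φ x) x := by
    rw [← integral_indicator hΩ.measurableSet]
    have h0' := (ae_restrict_iff' hΩ.measurableSet).1 h0
    refine integral_congr_ae ?_
    filter_upwards [h0'] with x hx
    by_cases hxΩ : x ∈ Ω
    · simp only [indicator_of_mem hxΩ]
      by_cases hxK : x ∈ K
      · have : (fun x => χ x * φ x) =ᶠ[𝓝 x] φ := by
          filter_upwards [hV.mem_nhds (hKV hxK)] with y hy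
          rw [hχ y hy, one_mul]
        rw [this.fderiv_eq]
      · simp [hx hxΩ hxK]
    · simp [hxΩ]
  have e2 : ∫ x, φ x • Ω.indicator H x = ∫ x in Ω, (χ x * φ x) • H x := by
    rw [← integral_indicator hΩ.measurableSet]
    refine integral_congr_ae ?_
    filter_upwards [hH0] with x hx
    by_cases hxΩ : x ∈ Ω
    · simp only [indicator_of_mem hxΩ]
      by_cases hxK : x ∈ K
      · rw [hχ x (hKV hxK), one_mul]
      · simp [hx ⟨hxΩ, hxK⟩]
    · simp [hxΩ]
  rw [e1, e2, ht]

lemma l1_complete {X F : Type*} [MeasurableSpace X] {μ : Measure X} [NormedAddCommGroup F] [CompleteSpace F]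
    {f : ℕ → X → F} (hf : ∀ k, Integrable (f k) μ)
    (h : ∀ ε : ℝ≥0∞, 0 < ε → ∃ N, ∀ m, N ≤ m → ∀ n, N ≤ n → ∫⁻ x, ‖f m x - f n x‖ₑ ∂μ < ε) :
    ∃ g, Integrable g μ ∧ Tendsto (fun k => ∫⁻ x, ‖f k x - g x‖ₑ ∂μ) atTop (𝓝 0) := by
  have hc : CauchySeq fun k => (hf k).toL1 (f k) := by
    rw [EMetric.cauchySeq_iff]
    intro ε hε
    obtain ⟨N, hN⟩ := h ε hε
    refine ⟨N, fun m hm n hn => ?_⟩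
    rw [Integrable.edist_toL1_toL1]
    simpa only [edist_eq_enorm_sub] using hN m hm n hn
  obtain ⟨g, hg⟩ := cauchySeq_tendsto_of_complete hc
  refine ⟨g, L1.integrable_coeFn g, ?_⟩
  rw [tendsto_iff_edist_tendsto_0] at hg
  refine hg.congr fun k => ?_
  conv_lhs => rw [← Integrable.toL1_coeFn g (L1.integrable_coeFn g)]
  rw [Integrable.edist_toL1_toL1]
  simp only [edist_eq_enorm_sub]

lemma tendsto_integral_of_lintegral {X F : Type*} [MeasurableSpace X] {μ : Measure X} [NormedAddCommGroup F]
    {f : ℕ → X → F} {g : X → F} (hf : ∀ k, Integrable (f k) μ) (hg : Integrable g μ)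
    (h : Tendsto (fun k => ∫⁻ x, ‖f k x - g x‖ₑ ∂μ) atTop (𝓝 0)) :
    Tendsto (fun k => ∫ x, ‖f k x - g x‖ ∂μ) atTop (𝓝 0) := by
  have := (ENNReal.tendsto_toReal (by simp)).comp h
  refine this.congr fun k => ?_
  simp only [Function.comp]
  exact (integral_norm_eq_lintegral_enorm ((hf k).sub hg).1).symm
end

noncomputable section

/-- the double phase integrand -/
def dpf {n : ℕ} (p q : ℝ) (a : Euc n → ℝ) : Euc n → ℝ → ℝ := fun x t => t ^ p / p + a x * t ^ q / q

lemma dpf_nonneg {n : ℕ} {p q : ℝ} (hp : 1 < p) (hq : 1 < q) {a : Euc n → ℝ} (ha : ∀ x, 0 ≤ a x)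
    (x : Euc n) {t : ℝ} (ht : 0 ≤ t) : 0 ≤ dpf p q a x t := by
  have := ha x
  unfold dpf; positivity

lemma pow_le_dpf {n : ℕ} {p q : ℝ} (hp : 1 < p) (hq : 1 < q) {a : Euc n → ℝ} (ha : ∀ x, 0 ≤ a x)
    (x : Euc n) {t : ℝ} (ht : 0 ≤ t) : t ^ p ≤ p * dpf p q a x t := by
  have := ha x
  have h : 0 ≤ p * (a x * t ^ q / q) := by positivity
  have h2 : p * (t ^ p / p) = t ^ p := by field_simp
  unfold dpf; rw [mul_add, h2]; linarith

lemma dpf_mid {n : ℕ} {p q : ℝ} (hp : 1 < p) (hq : 1 < q) {a : Euc n → ℝ} (ha : ∀ x, 0 ≤ a x)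
    (x : Euc n) (ξ η : Euc n →L[ℝ] ℝ) :
    2 * dpf p q a x ‖(1/2 : ℝ) • ξ + (1/2 : ℝ) • η‖ + 2 / p * dfc p ξ η ≤ dpf p q a x ‖ξ‖ + dpf p q a x ‖η‖ := by
  have h1 := Real.rpow_le_rpow (norm_nonneg _) (mid_norm_le ξ η) (by linarith : 0 ≤ q)
  have h2 := mid_pow_le hq.le (norm_nonneg ξ) (norm_nonneg η)
  have h3 := h1.trans h2
  have h4 : a x * ‖(1/2 : ℝ) • ξ + (1/2 : ℝ) • η‖ ^ q / q ≤ a x * ((‖ξ‖ ^ q + ‖η‖ ^ q) / 2) / q := by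
    have := ha x
    gcongr
  unfold dpf dfc
  have : 2 / p * ((‖ξ‖ ^ p + ‖η‖ ^ p) / 2 - ‖(1/2 : ℝ) • ξ + (1/2 : ℝ) • η‖ ^ p) =
    ‖ξ‖ ^ p / p + ‖η‖ ^ p / p - 2 * (‖(1/2 : ℝ) • ξ + (1/2 : ℝ) • η‖ ^ p / p) := by
    field_simp
  rw [this]
  have h5 : a x * ((‖ξ‖ ^ q + ‖η‖ ^ q) / 2) / q = (a x * ‖ξ‖ ^ q / q + a x * ‖η‖ ^ q / q) / 2 := by
    ring
  linarith

lemma dpf_aemeas {n : ℕ} {p q : ℝ} {a : Euc n → ℝ} (ha : Measurable a) {G : Euc n → Euc n →L[ℝ] ℝ}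
    {μ : Measure (Euc n)} (hG : AEStronglyMeasurable G μ) :
    AEMeasurable (fun x => ENNReal.ofReal (dpf p q a x ‖G x‖)) μ := by
  have h := hG.norm.aemeasurable
  unfold dpf
  have := ha.aemeasurable (μ := μ)
  fun_prop

lemma cauchy_key {n : ℕ} {Ω : Set (Euc n)} (hΩ : volume Ω ≠ ⊤)
    {p q : ℝ} (hp : 1 < p) (hq : 1 < q) {a : Euc n → ℝ} (ham : Measurable a) (ha : ∀ x, 0 ≤ a x)
    (I : ℝ≥0∞) (hI : I ≠ ⊤) {ε : ℝ≥0∞} (hε : 0 < ε) :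
    ∃ η : ℝ≥0, 0 < η ∧ ∀ G1 G2 : Euc n → Euc n →L[ℝ] ℝ, IntegrableOn G1 Ω → IntegrableOn G2 Ω →
      energyOf Ω (dpf p q a) (fun x => ‖G1 x‖) ≤ I + η → energyOf Ω (dpf p q a) (fun x => ‖G2 x‖) ≤ I + η →
      I ≤ energyOf Ω (dpf p q a) (fun x => ‖(1/2 : ℝ) • G1 x + (1/2 : ℝ) • G2 x‖) →
      ∫⁻ x in Ω, ‖G1 x - G2 x‖ₑ < ε := by
  have hp0 : 0 < p := by linarith
  set M : ℝ≥0∞ := volume Ω + ENNReal.ofReal p * (I + 1) + ENNReal.ofReal p * (I + 1) with hM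
  have hMt : M ≠ ⊤ := by
    simp only [hM]
    have : ENNReal.ofReal p * (I + 1) ≠ ⊤ := ENNReal.mul_ne_top ENNReal.ofReal_ne_top (by simp [hI])
    simp [hΩ, this]
  obtain ⟨τ, hτ, hτM⟩ := ENNReal.exists_nnreal_pos_mul_lt hMt (b := ε / 2) (by simp [hε.ne'])
  obtain ⟨C, hC, huc⟩ := uc_dual (n := n) hp (τ := τ) (by exact_mod_cast hτ)
  obtain ⟨η, hη, hηC⟩ := ENNReal.exists_nnreal_pos_mul_lt (a := ENNReal.ofReal (C * p / 2) * 2)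
    (b := ε / 2) (ENNReal.mul_ne_top ENNReal.ofReal_ne_top (by simp)) (by simp [hε.ne'])
  refine ⟨min η 1, lt_min hη one_pos, fun G1 G2 g1 g2 e1 e2 e3 => ?_⟩
  have hη1 : ((min η 1 : ℝ≥0) : ℝ≥0∞) ≤ 1 := by exact_mod_cast min_le_right _ _
  have hηη : ((min η 1 : ℝ≥0) : ℝ≥0∞) ≤ η := by exact_mod_cast min_le_left _ _
  have gm : AEStronglyMeasurable (fun x => (1/2 : ℝ) • G1 x + (1/2 : ℝ) • G2 x) (volume.restrict Ω) :=
    (g1.1.const_smul (1/2 : ℝ)).add (g2.1.const_smul (1/2 : ℝ))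
  set D : ℝ≥0∞ := ∫⁻ x in Ω, ENNReal.ofReal (2 / p * dfc p (G1 x) (G2 x)) with hD
  have hmid : 2 * I + D ≤ 2 * I + 2 * (min η 1 : ℝ≥0) := by
    calc 2 * I + D ≤ 2 * energyOf Ω (dpf p q a) (fun x => ‖(1/2 : ℝ) • G1 x + (1/2 : ℝ) • G2 x‖) + D := by
          gcongr
      _ = ∫⁻ x in Ω, (2 * ENNReal.ofReal (dpf p q a x ‖(1/2 : ℝ) • G1 x + (1/2 : ℝ) • G2 x‖)
            + ENNReal.ofReal (2 / p * dfc p (G1 x) (G2 x))) := by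
          rw [lintegral_add_left' ((dpf_aemeas ham gm).const_mul 2),
            lintegral_const_mul'' _ (dpf_aemeas ham gm)]
          rfl
      _ ≤ ∫⁻ x in Ω, (ENNReal.ofReal (dpf p q a x ‖G1 x‖) + ENNReal.ofReal (dpf p q a x ‖G2 x‖)) := by
          refine lintegral_mono fun x => ?_
          have h1 := dpf_nonneg hp hq ha x (norm_nonneg (G1 x))
          have h2 := dpf_nonneg hp hq ha x (norm_nonneg (G2 x))
          have h3 := dpf_nonneg hp hq ha x (norm_nonneg ((1/2 : ℝ) • G1 x + (1/2 : ℝ) • G2 x))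
          have h4 := dfc_nonneg hp.le (G1 x) (G2 x)
          have e2 : ∀ X : ℝ, 2 * ENNReal.ofReal X = ENNReal.ofReal (2 * X) := fun X => by
            rw [ENNReal.ofReal_mul (by norm_num)]; simp
          rw [← ENNReal.ofReal_add h1 h2, e2, ← ENNReal.ofReal_add (by positivity) (by positivity)]
          exact ENNReal.ofReal_le_ofReal (dpf_mid hp hq ha x _ _)
      _ = energyOf Ω (dpf p q a) (fun x => ‖G1 x‖) + energyOf Ω (dpf p q a) (fun x => ‖G2 x‖) := by
          rw [lintegral_add_left' (dpf_aemeas ham g1.1)]; rfl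
      _ ≤ (I + (min η 1 : ℝ≥0)) + (I + (min η 1 : ℝ≥0)) := add_le_add e1 e2
      _ = _ := by ring
  have hDle : D ≤ 2 * η := by
    have := (ENNReal.add_le_add_iff_left (ENNReal.mul_ne_top (by simp) hI)).1 hmid
    exact this.trans (by gcongr)
  have hpw : ∀ G : Euc n → Euc n →L[ℝ] ℝ, energyOf Ω (dpf p q a) (fun x => ‖G x‖) ≤ I + (min η 1 : ℝ≥0) →
      ∫⁻ x in Ω, ENNReal.ofReal (‖G x‖ ^ p) ≤ ENNReal.ofReal p * (I + 1) := by
    intro G hG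
    calc _ ≤ ∫⁻ x in Ω, ENNReal.ofReal p * ENNReal.ofReal (dpf p q a x ‖G x‖) := by
          refine lintegral_mono fun x => ?_
          rw [← ENNReal.ofReal_mul hp0.le]
          exact ENNReal.ofReal_le_ofReal (pow_le_dpf hp hq ha x (norm_nonneg _))
      _ = ENNReal.ofReal p * energyOf Ω (dpf p q a) (fun x => ‖G x‖) := by
          rw [lintegral_const_mul' _ _ ENNReal.ofReal_ne_top]; rfl
      _ ≤ _ := by gcongr; exact hG.trans (by gcongr)
  have mG : ∀ {G : Euc n → Euc n →L[ℝ] ℝ}, IntegrableOn G Ω →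
      AEMeasurable (fun x => ENNReal.ofReal (‖G x‖ ^ p)) (volume.restrict Ω) := by
    intro G hG
    have := hG.1.norm.aemeasurable
    fun_prop
  calc ∫⁻ x in Ω, ‖G1 x - G2 x‖ₑ
      ≤ ∫⁻ x in Ω, (ENNReal.ofReal τ * (1 + ENNReal.ofReal (‖G1 x‖ ^ p) + ENNReal.ofReal (‖G2 x‖ ^ p)) +
          ENNReal.ofReal (C * p / 2) * ENNReal.ofReal (2 / p * dfc p (G1 x) (G2 x))) := by
        refine lintegral_mono fun x => ?_
        have h4 := dfc_nonneg hp.le (G1 x) (G2 x)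
        rw [← ENNReal.ofReal_one, ← ENNReal.ofReal_add (by norm_num) (by positivity),
          ← ENNReal.ofReal_add (by positivity) (by positivity), ← ENNReal.ofReal_mul (by positivity),
          ← ENNReal.ofReal_mul (by positivity), ← ENNReal.ofReal_add (by positivity) (by positivity),
          ← ofReal_norm]
        refine ENNReal.ofReal_le_ofReal ((huc _ _).trans (le_of_eq ?_))
        field_simp
        ring
    _ = ENNReal.ofReal τ * (volume Ω + (∫⁻ x in Ω, ENNReal.ofReal (‖G1 x‖ ^ p)) +
          ∫⁻ x in Ω, ENNReal.ofReal (‖G2 x‖ ^ p)) + ENNReal.ofReal (C * p / 2) * D := by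
        rw [lintegral_add_left', lintegral_const_mul' _ _ ENNReal.ofReal_ne_top,
          lintegral_const_mul' _ _ ENNReal.ofReal_ne_top, lintegral_add_right' _ (mG g2),
          lintegral_add_right' _ (mG g1)]
        · simp [hD]
        · have := mG g1
          have := mG g2
          fun_prop
    _ ≤ τ * M + ENNReal.ofReal (C * p / 2) * (2 * η) := by
        rw [ENNReal.ofReal_coe_nnreal]
        exact add_le_add (mul_le_mul_right (add_le_add (add_le_add le_rfl (hpw _ e1)) (hpw _ e2)) _)
          (mul_le_mul_right hDle _)
    _ = τ * M + η * (ENNReal.ofReal (C * p / 2) * 2) := by ring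
    _ < ε / 2 + ε / 2 := ENNReal.add_lt_add hτM hηC
    _ = ε := ENNReal.add_halves ε

lemma int_zero {F : Type*} [NormedAddCommGroup F] {n : ℕ} {s : Set (Euc n)} :
    IntegrableOn (fun _ : Euc n => (0 : F)) s := integrableOn_zero

theorem direct_method {n : ℕ} (hn : 2 ≤ n) {Ω : Set (Euc n)} (hΩo : IsOpen Ω)
    (hΩb : Bornology.IsBounded Ω) {p q : ℝ} (hp : 1 < p) (hq : 1 < q) {a : Euc n → ℝ}
    (ham : Measurable a) (ha : ∀ x, 0 ≤ a x) (hac : Continuous a) {U : Euc n → ℝ} {GU : Euc n → Euc n →L[ℝ] ℝ}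
    (hU : W11On Ω U GU) (hE : energyOf Ω (dpf p q a) (fun x => ‖GU x‖) < ⊤) :
    ∃ w H, Adm Ω w H ∧ IsLocalMinimizer Ω (dpf p q a) (fun x => U x + w x) (fun x => GU x + H x) ∧
      energyOf Ω (dpf p q a) (fun x => ‖GU x + H x‖) ≤ energyOf Ω (dpf p q a) (fun x => ‖GU x‖) := by
  set E : (Euc n → Euc n →L[ℝ] ℝ) → ℝ≥0∞ := fun G => energyOf Ω (dpf p q a) (fun x => ‖G x‖) with hEdef
  set S : Set ℝ≥0∞ := {e | ∃ w H, Adm Ω w H ∧ e = E (fun x => GU x + H x)} with hS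
  set I := sInf S with hIdef
  have hadd : ∀ {w H}, Adm Ω w H → W11On Ω (fun x => U x + w x) (fun x => GU x + H x) := by
    intro w H h; simpa using hU.lin h.w11 1 1
  have hIle : ∀ {w H}, Adm Ω w H → I ≤ E (fun x => GU x + H x) := fun h => sInf_le ⟨_, _, h, rfl⟩
  have hz : Adm Ω (fun _ => (0:ℝ)) (fun _ => (0 : Euc n →L[ℝ] ℝ)) :=
    ⟨⟨by simp, int_zero, fun φ _ _ _ => by simp⟩, by simp, by simp⟩
  have hI0 : I ≤ E GU := by simpa using hIle hz
  have hIt : I ≠ ⊤ := (hI0.trans_lt hE).ne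
  have hvol : volume Ω ≠ ⊤ := hΩb.measure_lt_top.ne
  have hex : ∀ k : ℕ, ∃ z : (Euc n → ℝ) × (Euc n → Euc n →L[ℝ] ℝ), Adm Ω z.1 z.2 ∧
      E (fun x => GU x + z.2 x) < I + (k + 1 : ℝ≥0∞)⁻¹ := by
    intro k
    have : sInf S < I + (k + 1 : ℝ≥0∞)⁻¹ := ENNReal.lt_add_right hIt (by
      rw [ENNReal.inv_ne_zero]; exact_mod_cast ENNReal.natCast_ne_top (k+1))
    obtain ⟨e, ⟨w, H, h, rfl⟩, hlt⟩ := sInf_lt_iff.1 this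
    exact ⟨(w, H), h, hlt⟩
  choose z hzA hzE using hex
  have hlim : Tendsto (fun k : ℕ => I + (k + 1 : ℝ≥0∞)⁻¹) atTop (𝓝 I) := by
    have h1 : Tendsto (fun k : ℕ => ((k + 1 : ℕ) : ℝ≥0∞)⁻¹) atTop (𝓝 0) :=
      ENNReal.tendsto_inv_nat_nhds_zero.comp (tendsto_add_atTop_nat 1)
    simpa using h1.const_add I
  -- Cauchy
  have hHi : ∀ k, Integrable (z k).2 := fun k => by simpa using (hzA k).1.2.1
  have hwi : ∀ k, Integrable (z k).1 := fun k => by simpa using (hzA k).1.1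
  have hcH : ∀ ε : ℝ≥0∞, 0 < ε → ∃ N, ∀ m, N ≤ m → ∀ k, N ≤ k → ∫⁻ x, ‖(z m).2 x - (z k).2 x‖ₑ < ε := by
    intro ε hε
    obtain ⟨η, hη, hk⟩ := cauchy_key hvol hp hq ham ha I hIt hε
    have hev : ∀ᶠ k : ℕ in atTop, I + (k + 1 : ℝ≥0∞)⁻¹ < I + η := by
      refine hlim.eventually_lt_const (ENNReal.lt_add_right hIt (by exact_mod_cast hη.ne'))
    obtain ⟨N, hN⟩ := eventually_atTop.1 hev
    refine ⟨N, fun m hm k hk' => ?_⟩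
    have h1 := hk (fun x => GU x + (z m).2 x) (fun x => GU x + (z k).2 x)
      (hadd (hzA m)).2.1 (hadd (hzA k)).2.1 ((hzE m).le.trans (hN m hm).le)
      ((hzE k).le.trans (hN k hk').le) (by
        have := hIle ((hzA m).lin (hzA k) (1/2) (1/2))
        refine this.trans (le_of_eq ?_)
        simp only [hEdef]
        congr 1; ext x; congr 1; module)
    have h2 : ∫⁻ x, ‖(z m).2 x - (z k).2 x‖ₑ = ∫⁻ x in Ω, ‖(z m).2 x - (z k).2 x‖ₑ := by
      rw [← lintegral_indicator hΩo.measurableSet]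
      refine lintegral_congr fun x => ?_
      by_cases hx : x ∈ Ω
      · simp [hx]
      · simp only [hx, (hzA m).2.2 x hx, (hzA k).2.2 x hx, sub_self, not_false_eq_true, indicator_of_notMem]
        exact enorm_zero (E := Euc n →L[ℝ] ℝ)
    rw [h2]
    simpa using h1
  obtain ⟨CP, hCP⟩ := Adm.poincare hn hΩb
  have hcw : ∀ ε : ℝ≥0∞, 0 < ε → ∃ N, ∀ m, N ≤ m → ∀ k, N ≤ k → ∫⁻ x, ‖(z m).1 x - (z k).1 x‖ₑ < ε := by
    intro ε hε
    obtain ⟨δ, hδ, hlt⟩ := ENNReal.exists_nnreal_pos_mul_lt (a := CP) (b := ε) (by simp) hε.ne'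
    obtain ⟨N, hN⟩ := hcH δ (by exact_mod_cast hδ)
    refine ⟨N, fun m hm k hk => ?_⟩
    have h1 := hCP _ _ ((hzA m).lin (hzA k) 1 (-1))
    have h2 := (hN m hm k hk).le
    have e1 : ∀ x, 1 * (z m).1 x + -1 * (z k).1 x = (z m).1 x - (z k).1 x := fun x => by ring
    have e2 : ∀ x, (1:ℝ) • (z m).2 x + (-1:ℝ) • (z k).2 x = (z m).2 x - (z k).2 x := fun x => by module
    simp only [e1, e2] at h1
    refine h1.trans_lt (lt_of_le_of_lt ?_ hlt)
    rw [mul_comm]; gcongr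
  obtain ⟨H0, hH0, hH0l⟩ := l1_complete hHi hcH
  obtain ⟨w0, hw0, hw0l⟩ := l1_complete hwi hcw
  set H := Ω.indicator H0 with hH
  set w := Ω.indicator w0 with hw
  have hHint : Integrable H := hH0.indicator hΩo.measurableSet
  have hwint : Integrable w := hw0.indicator hΩo.measurableSet
  have hHl : Tendsto (fun k => ∫⁻ x, ‖(z k).2 x - H x‖ₑ) atTop (𝓝 0) := by
    refine tendsto_of_tendsto_of_tendsto_of_le_of_le tendsto_const_nhds hH0l (fun _ => zero_le) fun k => ?_
    refine lintegral_mono fun x => ?_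
    by_cases hx : x ∈ Ω
    · simp [hH, hx]
    · simp only [hH, hx, (hzA k).2.2 x hx, sub_self, not_false_eq_true, indicator_of_notMem]
      exact (enorm_zero (E := Euc n →L[ℝ] ℝ)).le.trans zero_le
  have hwl : Tendsto (fun k => ∫⁻ x, ‖(z k).1 x - w x‖ₑ) atTop (𝓝 0) := by
    refine tendsto_of_tendsto_of_tendsto_of_le_of_le tendsto_const_nhds hw0l (fun _ => zero_le) fun k => ?_
    refine lintegral_mono fun x => ?_
    by_cases hx : x ∈ Ω
    · simp [hw, hx]
    · simp [hw, hx, (hzA k).2.1 x hx]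
  have hA : Adm Ω w H := by
    refine ⟨W11On.lim (fun k => (hzA k).1) (by simpa using hwint) (by simpa using hHint) ?_ ?_,
      fun x hx => indicator_of_notMem hx _, fun x hx => indicator_of_notMem hx _⟩
    · simpa using tendsto_integral_of_lintegral hwi hwint hwl
    · simpa using tendsto_integral_of_lintegral hHi hHint hHl
  have hEI : E (fun x => GU x + H x) ≤ I := by
    have hm : TendstoInMeasure volume (fun k => (z k).2) atTop H := by
      refine tendstoInMeasure_of_tendsto_eLpNorm (p := 1) one_ne_zero (fun k => (hHi k).1) hHint.1 ?_
      simpa [eLpNorm_one_eq_lintegral_enorm] using hHl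
    obtain ⟨ns, hns, hae⟩ := hm.exists_seq_tendsto_ae
    have h1 : E (fun x => GU x + H x) = ∫⁻ x in Ω,
        liminf (fun k => ENNReal.ofReal (dpf p q a x ‖GU x + (z (ns k)).2 x‖)) atTop := by
      refine lintegral_congr_ae ?_
      filter_upwards [ae_restrict_of_ae hae] with x hx
      have hc : Continuous fun ξ : Euc n →L[ℝ] ℝ => ENNReal.ofReal (dpf p q a x ‖GU x + ξ‖) := by
        unfold dpf
        refine ENNReal.continuous_ofReal.comp ?_
        have c1 : Continuous fun ξ : Euc n →L[ℝ] ℝ => ‖GU x + ξ‖ := by fun_prop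
        exact ((c1.rpow_const fun _ => Or.inr (by linarith)).div_const _).add
          ((continuous_const.mul (c1.rpow_const fun _ => Or.inr (by linarith))).div_const _)
      exact (((hc.tendsto _).comp hx).liminf_eq).symm
    rw [h1]
    refine (lintegral_liminf_le' fun k => dpf_aemeas ham (hadd (hzA (ns k))).2.1.1).trans ?_
    have h2 : Tendsto (fun k => I + ((ns k : ℕ) + 1 : ℝ≥0∞)⁻¹) atTop (𝓝 I) := hlim.comp hns.tendsto_atTop
    rw [← h2.liminf_eq]
    exact liminf_le_liminf (Eventually.of_forall fun k => (hzE (ns k)).le)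
  refine ⟨w, H, hA, ⟨hadd hA, hEI.trans_lt hIt.lt_top, ?_⟩, hEI.trans hI0⟩
  rintro v Gv hv ⟨K, hK, hKΩ, hvK⟩
  have hd := hv.lin (hadd hA) 1 (-1)
  have hAd := adm_of_diff hΩo hK hKΩ hd (by
    filter_upwards [hvK] with x hx hxK
    rw [hx hxK]; ring)
  have := hIle (hA.lin hAd 1 1)
  refine hEI.trans (this.trans (le_of_eq ?_))
  refine setLIntegral_congr_fun hΩo.measurableSet fun x hx => ?_
  simp only [indicator_of_mem hx]
  congr 3
  module
end

noncomputable section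

open Classical in
def dg (T : Set ℕ) (ω : ℕ → Bool) (i : ℕ) : ℝ := if i ∈ T ∧ ω i = true then (1/2 : ℝ) ^ (i + 2) else 0

def dpt (T : Set ℕ) (ω : ℕ → Bool) : ℝ := ∑' i, dg T ω i

open Classical in
def dQ (T : Set ℕ) (ω : ℕ → Bool) : ℕ → ℕ
  | 0 => 0
  | k + 1 => 2 * dQ T ω k + if k ∈ T ∧ ω k = true then 1 else 0

open Classical in
def dcnt (T : Set ℕ) (k : ℕ) : ℕ := ((Finset.range k).filter (· ∈ T)).card

lemma dg_nonneg (T : Set ℕ) (ω : ℕ → Bool) (i : ℕ) : 0 ≤ dg T ω i := by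
  unfold dg; split_ifs <;> positivity

lemma dg_le (T : Set ℕ) (ω : ℕ → Bool) (i : ℕ) : dg T ω i ≤ (1/2 : ℝ) ^ (i + 2) := by
  unfold dg; split_ifs
  · exact le_rfl
  · positivity

lemma summ_geo (c : ℕ) : Summable fun i : ℕ => (1/2 : ℝ) ^ (i + c) :=
  (_root_.summable_nat_add_iff c).2 summable_geometric_two

lemma dg_summ (T : Set ℕ) (ω : ℕ → Bool) : Summable (dg T ω) :=
  Summable.of_nonneg_of_le (dg_nonneg T ω) (dg_le T ω) (summ_geo 2)

lemma dpt_cont (T : Set ℕ) : Continuous (dpt T) := by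
  refine continuous_tsum (u := fun i => (1/2 : ℝ) ^ (i + 2)) (fun i => ?_) (summ_geo 2) (fun i ω => ?_)
  · classical
    have h1 : Continuous fun b : Bool => if i ∈ T ∧ b = true then (1/2 : ℝ) ^ (i + 2) else 0 :=
      continuous_of_discreteTopology
    have := h1.comp (continuous_apply (A := fun _ : ℕ => Bool) i)
    unfold dg
    convert this using 2
    simp only [Function.comp]
    try congr
  · rw [Real.norm_of_nonneg (dg_nonneg T ω i)]; exact dg_le T ω i

lemma dpt_prefix (T : Set ℕ) (ω : ℕ → Bool) (k : ℕ) :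
    ∑ i ∈ Finset.range k, dg T ω i = dQ T ω k * (1/2 : ℝ) ^ (k + 1) := by
  induction k with
  | zero => simp [dQ]
  | succ k ih =>
    rw [Finset.sum_range_succ, ih, dQ, dg]
    split_ifs <;> push_cast <;> ring

lemma dpt_tail (T : Set ℕ) (ω : ℕ → Bool) (k : ℕ) :
    dQ T ω k * (1/2 : ℝ) ^ (k + 1) ≤ dpt T ω ∧ dpt T ω ≤ dQ T ω k * (1/2 : ℝ) ^ (k + 1) + (1/2 : ℝ) ^ (k + 1) := by
  have h := (dg_summ T ω).sum_add_tsum_nat_add k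
  rw [dpt_prefix] at h
  have h1 : 0 ≤ ∑' i, dg T ω (i + k) := tsum_nonneg fun i => dg_nonneg T ω _
  have h2 : ∑' i, dg T ω (i + k) ≤ ∑' i : ℕ, (1/2 : ℝ) ^ (i + k + 2) :=
    Summable.tsum_le_tsum (fun i => dg_le T ω _) ((_root_.summable_nat_add_iff k).2 (dg_summ T ω))
      (by simpa [add_assoc] using summ_geo (k + 2))
  have h3 : ∑' i : ℕ, (1/2 : ℝ) ^ (i + k + 2) = (1/2 : ℝ) ^ (k + 1) := by
    simp only [add_assoc, pow_add _ _ (k + 2)]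
    rw [_root_.tsum_mul_right, tsum_geometric_two]; ring
  unfold dpt
  constructor <;> linarith

lemma dpt_mem (T : Set ℕ) (ω : ℕ → Bool) : 0 ≤ dpt T ω ∧ dpt T ω ≤ 1/2 := by
  have := dpt_tail T ω 0
  simpa [dQ] using this

lemma dQ_pattern (T : Set ℕ) (k : ℕ) : ∀ m : ℕ, ∃ b : ℕ → Bool, ∀ ω, dQ T ω k = m → ∀ i < k, i ∈ T → ω i = b i := by
  induction k with
  | zero => intro m; exact ⟨fun _ => true, by simp⟩
  | succ k ih =>
    intro m
    obtain ⟨b, hb⟩ := ih (m / 2)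
    refine ⟨fun i => if i = k then decide (m % 2 = 1) else b i, fun ω h i hi hiT => ?_⟩
    rw [dQ] at h
    by_cases hik : i = k
    · subst hik
      cases hω : ω i <;> simp [hω, hiT] at h ⊢ <;> omega
    · simp only [hik, if_false]
      refine hb ω ?_ i (by omega) hiT
      split_ifs at h <;> omega

/-- fair coin -/
def coin : Measure Bool := (PMF.uniformOfFintype Bool).toMeasure

instance : IsProbabilityMeasure coin := by unfold coin; infer_instance

lemma coin_singleton (b : Bool) : coin {b} = 2⁻¹ := by
  unfold coin
  rw [PMF.toMeasure_apply_singleton _ _ (measurableSet_singleton b)]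
  simp

def coins : Measure (ℕ → Bool) := Measure.infinitePi fun _ => coin

instance : IsProbabilityMeasure coins := by unfold coins; infer_instance

lemma coins_dQ (T : Set ℕ) (k m : ℕ) : coins {ω | dQ T ω k = m} ≤ 2⁻¹ ^ dcnt T k := by
  classical
  obtain ⟨b, hb⟩ := dQ_pattern T k m
  calc coins {ω | dQ T ω k = m} ≤ coins (Set.pi ((Finset.range k).filter (· ∈ T) : Finset ℕ) fun i => {b i}) := by
        refine measure_mono fun ω hω => ?_
        intro i hi
        simp only [Finset.coe_filter, Finset.mem_range, mem_ofPred_eq] at hi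
        exact hb ω hω i hi.1 hi.2
    _ = _ := by
        unfold coins
        rw [Measure.infinitePi_pi]
        · simp only [coin_singleton, Finset.prod_const, dcnt]
        · intro i _; exact measurableSet_singleton _

lemma coins_ball (T : Set ℕ) (k : ℕ) (y : ℝ) :
    coins (dpt T ⁻¹' closedBall y ((1/2 : ℝ) ^ k)) ≤ 6 * 2⁻¹ ^ dcnt T k := by
  set m0 : ℤ := ⌈y * 2 ^ (k + 1) - 3⌉ with hm0
  have hsub : dpt T ⁻¹' closedBall y ((1/2 : ℝ) ^ k) ⊆
      ⋃ j ∈ Finset.range 6, {ω | dQ T ω k = (m0 + j).toNat} := by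
    intro ω hω
    simp only [mem_preimage, mem_closedBall, Real.dist_eq, abs_le] at hω
    obtain ⟨h1, h2⟩ := dpt_tail T ω k
    have e : (1/2 : ℝ) ^ (k + 1) * 2 ^ (k + 1) = 1 := by rw [← mul_pow]; norm_num
    have e' : (1/2 : ℝ) ^ k * 2 ^ (k + 1) = 2 := by rw [pow_succ, ← mul_assoc, ← mul_pow]; norm_num
    have hP : (0 : ℝ) < 2 ^ (k + 1) := by positivity
    have a1 : (dQ T ω k : ℝ) ≤ y * 2 ^ (k + 1) + 2 := by
      have : dQ T ω k * (1/2 : ℝ) ^ (k + 1) ≤ y + (1/2 : ℝ) ^ k := by linarith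
      have := mul_le_mul_of_nonneg_right this hP.le
      rw [mul_assoc, e, add_mul, e'] at this; linarith
    have a2 : y * 2 ^ (k + 1) - 3 ≤ (dQ T ω k : ℝ) := by
      have : y - (1/2 : ℝ) ^ k ≤ dQ T ω k * (1/2 : ℝ) ^ (k + 1) + (1/2 : ℝ) ^ (k + 1) := by linarith
      have := mul_le_mul_of_nonneg_right this hP.le
      rw [sub_mul, e', add_mul, mul_assoc, e] at this; linarith
    have b1 : m0 ≤ (dQ T ω k : ℤ) := Int.ceil_le.2 (by exact_mod_cast a2)
    have b2 : (dQ T ω k : ℤ) ≤ m0 + 5 := by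
      have : y * 2 ^ (k + 1) - 3 ≤ m0 := Int.le_ceil _
      have : (dQ T ω k : ℝ) ≤ m0 + 5 := by linarith
      exact_mod_cast this
    simp only [mem_iUnion, Finset.mem_range, mem_ofPred_eq, exists_prop]
    exact ⟨((dQ T ω k : ℤ) - m0).toNat, by omega, by omega⟩
  refine (measure_mono hsub).trans ((measure_biUnion_finset_le _ _).trans ?_)
  refine (Finset.sum_le_sum fun j _ => coins_dQ T k _).trans ?_
  simp

open Classical in
lemma dpt_cover (T : Set ℕ) (k : ℕ) : ∃ F : Finset ℝ, F.card ≤ 2 ^ dcnt T k ∧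
    ∀ ω, ∃ y ∈ F, |dpt T ω - y| ≤ (1/2 : ℝ) ^ k := by
  refine ⟨(((Finset.range k).filter (· ∈ T)).powerset).image fun s => ∑ i ∈ s, (1/2 : ℝ) ^ (i + 2),
    Finset.card_image_le.trans (by rw [Finset.card_powerset, dcnt]), fun ω => ?_⟩
  refine ⟨∑ i ∈ Finset.range k, dg T ω i, ?_, ?_⟩
  · rw [Finset.mem_image]
    refine ⟨(Finset.range k).filter (fun i => i ∈ T ∧ ω i = true), ?_, ?_⟩
    · rw [Finset.mem_powerset]
      intro i; simp only [Finset.mem_filter]; tauto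
    · rw [Finset.sum_filter]; rfl
  · rw [dpt_prefix]
    obtain ⟨h1, h2⟩ := dpt_tail T ω k
    have : (1/2 : ℝ) ^ (k + 1) ≤ (1/2 : ℝ) ^ k := pow_le_pow_of_le_one (by norm_num) (by norm_num) (by omega)
    rw [abs_le]; constructor <;> linarith [show (0:ℝ) < (1/2 : ℝ) ^ k by positivity]

/-- product version -/
def dptE (T : Set ℕ) (n : ℕ) (ω : Fin n → ℕ → Bool) : Euc n := WithLp.toLp 2 fun i => dpt T (ω i)

lemma dptE_cont (T : Set ℕ) (n : ℕ) : Continuous (dptE T n) := by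
  unfold dptE
  refine (PiLp.continuous_toLp 2 _).comp ?_
  exact continuous_pi fun i => (dpt_cont T).comp (continuous_apply i)

def dnu (T : Set ℕ) (n : ℕ) : Measure (Euc n) := Measure.map (dptE T n) (Measure.pi fun _ => coins)

instance (T : Set ℕ) (n : ℕ) : IsProbabilityMeasure (dnu T n) :=
  Measure.isProbabilityMeasure_map (dptE_cont T n).measurable.aemeasurable

lemma dnu_ball (T : Set ℕ) (n k : ℕ) (x : Euc n) :
    dnu T n (closedBall x ((1/2 : ℝ) ^ k)) ≤ (6 * 2⁻¹ ^ dcnt T k) ^ n := by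
  unfold dnu
  rw [Measure.map_apply (dptE_cont T n).measurable measurableSet_closedBall]
  calc _ ≤ (Measure.pi fun _ : Fin n => coins) (Set.univ.pi fun i => dpt T ⁻¹' closedBall (x i) ((1/2 : ℝ) ^ k)) := by
        refine measure_mono fun ω hω i _ => ?_
        simp only [mem_preimage, mem_closedBall] at hω ⊢
        refine le_trans ?_ hω
        rw [dist_eq_norm, dist_eq_norm]
        exact PiLp.norm_apply_le (dptE T n ω - x) i
    _ = ∏ i : Fin n, coins (dpt T ⁻¹' closedBall (x i) ((1/2 : ℝ) ^ k)) := Measure.pi_pi _ _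
    _ ≤ ∏ i : Fin n, (6 * 2⁻¹ ^ dcnt T k) := Finset.prod_le_prod' fun i _ => coins_ball T k _
    _ = _ := by simp

lemma euc_norm_le {n : ℕ} (x : Euc n) {r : ℝ} (hr : 0 ≤ r) (h : ∀ i, |x i| ≤ r) : ‖x‖ ≤ n * r := by
  rw [EuclideanSpace.norm_eq]
  refine Real.sqrt_le_iff.2 ⟨by positivity, ?_⟩
  calc ∑ i, ‖x i‖ ^ 2 ≤ ∑ i : Fin n, r ^ 2 :=
        Finset.sum_le_sum fun i _ => pow_le_pow_left₀ (norm_nonneg _) (h i) 2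
    _ = n * r ^ 2 := by simp
    _ ≤ (n * r) ^ 2 := by
        rcases Nat.eq_zero_or_pos n with rfl | hn
        · simp
        · have : (1 : ℝ) ≤ n := by exact_mod_cast hn
          have h2 : (n : ℝ) ≤ n ^ 2 := by nlinarith
          rw [mul_pow]; gcongr

lemma dptE_cover (T : Set ℕ) (n k : ℕ) : ∃ F : Finset (Euc n), F.card ≤ (2 ^ dcnt T k) ^ n ∧
    range (dptE T n) ⊆ ⋃ y ∈ F, closedBall y (n * (1/2 : ℝ) ^ k) := by
  classical
  obtain ⟨F, hF, hc⟩ := dpt_cover T k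
  refine ⟨(Fintype.piFinset fun _ : Fin n => F).image (WithLp.toLp 2), ?_, ?_⟩
  · refine Finset.card_image_le.trans ?_
    rw [Fintype.card_piFinset]
    simpa using Nat.pow_le_pow_left hF n
  · rintro _ ⟨ω, rfl⟩
    choose y hyF hy using fun i => hc (ω i)
    simp only [mem_iUnion, exists_prop]
    refine ⟨WithLp.toLp 2 y, Finset.mem_image_of_mem _ (Fintype.mem_piFinset.2 hyF), ?_⟩
    rw [mem_closedBall, dist_eq_norm]
    exact euc_norm_le _ (by positivity) fun i => hy i

lemma exists_T {f : ℕ → ℕ} (h0 : f 0 = 0) (h1 : ∀ k, f k ≤ f (k + 1)) (h2 : ∀ k, f (k + 1) ≤ f k + 1) :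
    ∃ T : Set ℕ, ∀ k, dcnt T k = f k := by
  refine ⟨{k | f (k + 1) = f k + 1}, fun k => ?_⟩
  induction k with
  | zero => simp [dcnt, h0]
  | succ k ih =>
    rw [dcnt] at ih ⊢
    rw [Finset.range_add_one, Finset.filter_insert]
    have a := h1 k
    have b := h2 k
    by_cases h : f (k + 1) = f k + 1
    · rw [if_pos (show k ∈ {k | f (k + 1) = f k + 1} from h), Finset.card_insert_of_notMem (by simp), ih, h]
    · rw [if_neg (show ¬ k ∈ {k | f (k + 1) = f k + 1} from h), ih]; omega

/-- growth function -/
def fgr (β : ℝ) (k : ℕ) : ℕ := ⌊β * (k - √k)⌋₊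

lemma sqrt_le_nat (k : ℕ) : √(k : ℝ) ≤ k := by
  rcases Nat.eq_zero_or_pos k with rfl | h
  · simp
  · have : (1 : ℝ) ≤ k := by exact_mod_cast h
    rw [Real.sqrt_le_iff]; constructor <;> nlinarith

lemma sqrt_succ (k : ℕ) : √((k + 1 : ℕ) : ℝ) ≤ √(k : ℝ) + 1 := by
  rw [Real.sqrt_le_iff]
  refine ⟨by positivity, ?_⟩
  have := Real.sq_sqrt (show (0:ℝ) ≤ k by positivity)
  push_cast
  nlinarith [Real.sqrt_nonneg (k : ℝ)]

lemma exists_T_fgr {β : ℝ} (h0 : 0 < β) (h1 : β ≤ 1) : ∃ T : Set ℕ, ∀ k, dcnt T k = fgr β k := by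
  refine exists_T (by simp [fgr]) (fun k => ?_) (fun k => ?_)
  · unfold fgr
    have := sqrt_succ k
    push_cast at this ⊢
    exact Nat.floor_le_floor (mul_le_mul_of_nonneg_left (by linarith) h0.le)
  · unfold fgr
    have h3 : √(k : ℝ) ≤ √((k + 1 : ℕ) : ℝ) := Real.sqrt_le_sqrt (by push_cast; linarith)
    have h4 := sqrt_le_nat k
    rw [← Nat.floor_add_one (mul_nonneg h0.le (by linarith))]
    refine Nat.floor_le_floor ?_
    push_cast at h3 ⊢
    nlinarith
end

noncomputable section

structure FracData (n : ℕ) (s0 : ℝ) (ν : Measure (Euc n)) (S : Set (Euc n)) : Prop where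
  prob : IsProbabilityMeasure ν
  comp : IsCompact S
  bd : ∀ x ∈ S, ∀ i, 0 ≤ x i ∧ x i ≤ 1/2
  conc : ν Sᶜ = 0
  frost : ∀ s, 0 < s → s < s0 → ∃ K : ℝ≥0, ∀ x r, 0 < r → ν (closedBall x r) ≤ K * ENNReal.ofReal (r ^ s)
  cover : ∀ k : ℕ, ∃ F : Finset (Euc n), (F.card : ℝ) ≤ 2 ^ (s0 * (k - √k)) ∧
    S ⊆ ⋃ y ∈ F, closedBall y (n * (1/2 : ℝ) ^ k)

lemma half_pow (k : ℕ) : (1/2 : ℝ) ^ k = (2 : ℝ) ^ (-(k : ℝ)) := by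
  rw [Real.rpow_neg (by norm_num), Real.rpow_natCast]; simp

lemma exists_dyadic {r : ℝ} (h0 : 0 < r) (h1 : r ≤ 1) : ∃ k : ℕ, (1/2 : ℝ) ^ (k + 1) < r ∧ r ≤ (1/2 : ℝ) ^ k :=
  exists_nat_pow_near_of_lt_one h0 h1 (by norm_num) (by norm_num)

lemma exists_frac {n : ℕ} (hn : 1 ≤ n) {s0 : ℝ} (h0 : 0 < s0) (h1 : s0 < n) : ∃ ν S, FracData n s0 ν S := by
  have hn0 : (0 : ℝ) < n := by exact_mod_cast hn
  obtain ⟨T, hT⟩ := exists_T_fgr (β := s0 / n) (by positivity) ((div_le_one hn0).2 h1.le)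
  have hβ : ∀ y : ℝ, s0 / n * y * n = s0 * y := fun y => by field_simp
  refine ⟨dnu T n, range (dptE T n), inferInstance, isCompact_range (dptE_cont T n), ?_, ?_, ?_, ?_⟩
  · rintro _ ⟨ω, rfl⟩ i; exact dpt_mem T (ω i)
  · unfold dnu
    rw [Measure.map_apply (dptE_cont T n).measurable (isCompact_range (dptE_cont T n)).isClosed.isOpen_compl.measurableSet]
    have he : dptE T n ⁻¹' (range (dptE T n))ᶜ = ∅ := by ext ω; simp
    rw [he, measure_empty]
  · intro s hs hs0
    set C : ℝ := 6 ^ n * (2 ^ (n : ℝ) * 2 ^ (s0 ^ 2 / (4 * (s0 - s)))) * 2 ^ s with hC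
    have hC1 : 1 ≤ C := by
      have a1 : (1:ℝ) ≤ 6 ^ n := one_le_pow₀ (by norm_num)
      have a2 : (1:ℝ) ≤ 2 ^ (n : ℝ) := Real.one_le_rpow (by norm_num) (by positivity)
      have a3 : (1:ℝ) ≤ 2 ^ (s0 ^ 2 / (4 * (s0 - s))) :=
        Real.one_le_rpow (by norm_num) (div_nonneg (by positivity) (by linarith))
      have a4 : (1:ℝ) ≤ 2 ^ s := Real.one_le_rpow (by norm_num) hs.le
      rw [hC]
      exact one_le_mul_of_one_le_of_one_le (one_le_mul_of_one_le_of_one_le a1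
        (one_le_mul_of_one_le_of_one_le a2 a3)) a4
    refine ⟨C.toNNReal, fun x r hr => ?_⟩
    change _ ≤ ENNReal.ofReal C * _
    rw [← ENNReal.ofReal_mul (by linarith)]
    rcases le_or_gt r 1 with hr1 | hr1
    · obtain ⟨k, hk1, hk2⟩ := exists_dyadic hr hr1
      refine (measure_mono (closedBall_subset_closedBall hk2)).trans ((dnu_ball T n k x).trans ?_)
      rw [hT]
      have e : (6 * 2⁻¹ ^ fgr (s0 / n) k : ℝ≥0∞) ^ n = ENNReal.ofReal ((6 * (1/2) ^ fgr (s0 / n) k) ^ n) := by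
        rw [ENNReal.ofReal_pow (by positivity), ENNReal.ofReal_mul (by norm_num), ENNReal.ofReal_pow (by norm_num)]
        rw [show (1/2 : ℝ) = 2⁻¹ by norm_num, ENNReal.ofReal_inv_of_pos (by norm_num)]; norm_num
      rw [e]
      refine ENNReal.ofReal_le_ofReal ?_
      rw [mul_pow, hC, mul_assoc, mul_assoc]
      refine mul_le_mul_of_nonneg_left ?_ (by positivity)
      rw [half_pow, ← Real.rpow_natCast, ← Real.rpow_mul (by norm_num)]
      have hfl : s0 / n * (k - √k) < fgr (s0 / n) k + 1 := Nat.lt_floor_add_one _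
      have h2 : s0 * (k - √k) ≤ (fgr (s0 / n) k + 1) * n := by
        rw [← hβ]; gcongr
      have h3 : s * k ≤ s0 * (k - √k) + s0 ^ 2 / (4 * (s0 - s)) := by
        have hd : 0 < s0 - s := by linarith
        have hq := Real.sq_sqrt (show (0:ℝ) ≤ k by positivity)
        have : 0 ≤ (s0 - s) * (√k - s0 / (2 * (s0 - s))) ^ 2 := by positivity
        have e2 : (s0 - s) * (√k - s0 / (2 * (s0 - s))) ^ 2 =
            (s0 - s) * √k ^ 2 - s0 * √k + s0 ^ 2 / (4 * (s0 - s)) := by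
          field_simp; ring
        rw [e2, hq] at this
        linarith
      have h4 : (2:ℝ) ^ (-(k:ℝ) * s) ≤ 2 ^ s * r ^ s := by
        rw [← Real.mul_rpow (by norm_num) hr.le, Real.rpow_mul (by norm_num), ← half_pow]
        refine Real.rpow_le_rpow (by positivity) ?_ hs.le
        rw [pow_succ] at hk1; linarith
      calc (2:ℝ) ^ (-(fgr (s0 / n) k : ℝ) * n)
          ≤ 2 ^ ((n : ℝ) + s0 ^ 2 / (4 * (s0 - s)) + -(k:ℝ) * s) :=
            Real.rpow_le_rpow_of_exponent_le (by norm_num) (by linarith)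
        _ = 2 ^ (n : ℝ) * 2 ^ (s0 ^ 2 / (4 * (s0 - s))) * 2 ^ (-(k:ℝ) * s) := by
            rw [Real.rpow_add (by norm_num), Real.rpow_add (by norm_num)]
        _ ≤ _ := by
            rw [mul_assoc, mul_assoc]; gcongr
    · refine prob_le_one.trans ?_
      rw [← ENNReal.ofReal_one]
      refine ENNReal.ofReal_le_ofReal ?_
      exact one_le_mul_of_one_le_of_one_le hC1 (Real.one_le_rpow hr1.le hs.le)
  · intro k
    obtain ⟨F, hF, hc⟩ := dptE_cover T n k
    refine ⟨F, ?_, hc⟩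
    have : (F.card : ℝ) ≤ (2 ^ dcnt T k) ^ n := by exact_mod_cast hF
    refine this.trans ?_
    rw [hT, ← hβ, Real.rpow_mul (by norm_num), Real.rpow_natCast]
    gcongr
    rw [← Real.rpow_natCast]
    refine Real.rpow_le_rpow_of_exponent_le (by norm_num) (Nat.floor_le ?_)
    have := sqrt_le_nat k
    exact mul_nonneg (by positivity) (by linarith)

namespace FracData
variable {n : ℕ} {s0 : ℝ} {ν : Measure (Euc n)} {S : Set (Euc n)}

lemma ne (h : FracData n s0 ν S) : S.Nonempty := by
  by_contra hS
  rw [not_nonempty_iff_eq_empty] at hS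
  have := h.conc
  have hp := h.prob
  simp [hS] at this

lemma vol (h : FracData n s0 ν S) : ∃ C : ℝ≥0, ∀ k : ℕ,
    volume {x | infDist x S ≤ (1/2 : ℝ) ^ k} ≤ C * ENNReal.ofReal (2 ^ (s0 * (k - √k) - n * k)) := by
  have hb : volume (ball (0 : Euc n) 1) ≠ ⊤ := measure_ball_lt_top.ne
  refine ⟨(ENNReal.ofReal ((n + 1 : ℝ) ^ n) * volume (ball (0 : Euc n) 1)).toNNReal, fun k => ?_⟩
  rw [ENNReal.coe_toNNReal (ENNReal.mul_ne_top ENNReal.ofReal_ne_top hb)]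
  obtain ⟨F, hF, hc⟩ := h.cover k
  have hsub : {x | infDist x S ≤ (1/2 : ℝ) ^ k} ⊆ ⋃ y ∈ F, closedBall y ((n + 1) * (1/2 : ℝ) ^ k) := by
    intro x hx
    obtain ⟨z, hz, hxz⟩ := h.comp.exists_infDist_eq_dist h.ne x
    have := hc hz
    simp only [mem_iUnion, exists_prop, mem_closedBall] at this ⊢
    obtain ⟨y, hy, hzy⟩ := this
    refine ⟨y, hy, ?_⟩
    have hx : infDist x S ≤ (1/2 : ℝ) ^ k := hx
    calc dist x y ≤ dist x z + dist z y := dist_triangle _ _ _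
      _ ≤ _ := by linarith
  refine (measure_mono hsub).trans ((measure_biUnion_finset_le _ _).trans ?_)
  simp_rw [Measure.addHaar_closedBall volume _ (show 0 ≤ ((n:ℝ) + 1) * (1/2 : ℝ) ^ k by positivity)]
  rw [Finset.sum_const, nsmul_eq_mul, finrank_euclideanSpace_fin, mul_pow, ENNReal.ofReal_mul (by positivity)]
  rw [sub_eq_add_neg, Real.rpow_add (by norm_num), ENNReal.ofReal_mul (by positivity)]
  have e : ((1/2 : ℝ) ^ k) ^ n = 2 ^ (-(n * k : ℝ)) := by
    rw [half_pow, ← Real.rpow_natCast, ← Real.rpow_mul (by norm_num)]; congr 1; ring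
  rw [e]
  have hF' : (F.card : ℝ≥0∞) ≤ ENNReal.ofReal (2 ^ (s0 * (k - √k))) := by
    rw [← ENNReal.ofReal_natCast]; exact ENNReal.ofReal_le_ofReal hF
  calc _ = ENNReal.ofReal ((n + 1 : ℝ) ^ n) * volume (ball (0 : Euc n) 1) *
        ((F.card : ℝ≥0∞) * ENNReal.ofReal (2 ^ (-(n * k : ℝ)))) := by ring
    _ ≤ _ := by gcongr

lemma summ_sqrt {c : ℝ} (hc : 0 < c) : Summable fun k : ℕ => (2 : ℝ) ^ (-(c * √k)) := by
  set L := c * Real.log 2 with hL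
  have hL0 : 0 < L := mul_pos hc (Real.log_pos (by norm_num))
  have h2 : Summable fun k : ℕ => (24 / L ^ 4) * (1 / (k : ℝ) ^ 2) :=
    (Real.summable_one_div_nat_pow.2 (by norm_num)).mul_left _
  refine (_root_.summable_nat_add_iff 1).1 ?_
  refine Summable.of_nonneg_of_le (fun k => by positivity) (fun k => ?_) ((_root_.summable_nat_add_iff 1).2 h2)
  have h3 := Real.pow_div_factorial_le_exp (L * √((k + 1 : ℕ) : ℝ)) (by positivity) 4
  have hq := Real.sq_sqrt (show (0:ℝ) ≤ ((k + 1 : ℕ) : ℝ) by positivity)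
  have hk : (0:ℝ) < ((k + 1 : ℕ) : ℝ) := by positivity
  have e1 : (L * √((k + 1 : ℕ) : ℝ)) ^ 4 = L ^ 4 * ((k + 1 : ℕ) : ℝ) ^ 2 := by
    rw [mul_pow, show √((k + 1 : ℕ) : ℝ) ^ 4 = (√((k + 1 : ℕ) : ℝ) ^ 2) ^ 2 by ring, hq]
  rw [e1] at h3
  have e2 : (2 : ℝ) ^ (-(c * √((k + 1 : ℕ) : ℝ))) = (Real.exp (L * √((k + 1 : ℕ) : ℝ)))⁻¹ := by
    rw [Real.rpow_def_of_pos (by norm_num), ← Real.exp_neg, hL]; congr 1; ring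
  rw [e2]
  have h4 : (4).factorial = 24 := rfl
  rw [h4] at h3
  push_cast at h3 hk ⊢
  rw [inv_le_comm₀ (Real.exp_pos _) (by positivity)]
  refine le_trans (le_of_eq ?_) h3
  field_simp

lemma integral_dist (h : FracData n s0 ν S) (h0 : 0 < s0) {e : ℝ} (he : 0 < e) (hes : s0 + e = n) :
    ∫⁻ x in {x | 0 < infDist x S ∧ infDist x S ≤ 1}, ENNReal.ofReal ((infDist x S) ^ (-e)) < ⊤ := by
  obtain ⟨C, hC⟩ := h.vol
  have hsub : {x | 0 < infDist x S ∧ infDist x S ≤ 1} ⊆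
      ⋃ k : ℕ, {x | (1/2 : ℝ) ^ (k + 1) < infDist x S ∧ infDist x S ≤ (1/2 : ℝ) ^ k} := by
    rintro x ⟨h1, h2⟩
    obtain ⟨k, hk⟩ := exists_dyadic h1 h2
    exact mem_iUnion.2 ⟨k, hk⟩
  have hcont : Continuous fun x : Euc n => infDist x S := continuous_infDist_pt S
  refine (lintegral_mono_set hsub).trans_lt ((lintegral_iUnion_le _ _).trans_lt ?_)
  have hk : ∀ k : ℕ, ∫⁻ x in {x | (1/2 : ℝ) ^ (k + 1) < infDist x S ∧ infDist x S ≤ (1/2 : ℝ) ^ k},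
      ENNReal.ofReal ((infDist x S) ^ (-e)) ≤ (ENNReal.ofReal (2 ^ e) * C) * ENNReal.ofReal (2 ^ (-(s0 * √k))) := by
    intro k
    have hm : MeasurableSet {x | (1/2 : ℝ) ^ (k + 1) < infDist x S ∧ infDist x S ≤ (1/2 : ℝ) ^ k} :=
      (measurableSet_lt measurable_const hcont.measurable).inter (measurableSet_le hcont.measurable measurable_const)
    calc _ ≤ ∫⁻ x in {x | (1/2 : ℝ) ^ (k + 1) < infDist x S ∧ infDist x S ≤ (1/2 : ℝ) ^ k},
          ENNReal.ofReal (2 ^ (e * (k + 1))) := by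
          refine setLIntegral_mono' hm fun x hx => ENNReal.ofReal_le_ofReal ?_
          refine (Real.rpow_le_rpow_of_nonpos (by positivity) hx.1.le (by linarith)).trans (le_of_eq ?_)
          rw [half_pow, ← Real.rpow_mul (by norm_num)]; congr 1; push_cast; ring
      _ = ENNReal.ofReal (2 ^ (e * (k + 1))) * volume {x | (1/2 : ℝ) ^ (k + 1) < infDist x S ∧ infDist x S ≤ (1/2 : ℝ) ^ k} := by
          rw [setLIntegral_const]
      _ ≤ ENNReal.ofReal (2 ^ (e * (k + 1))) * (C * ENNReal.ofReal (2 ^ (s0 * (k - √k) - n * k))) := by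
          gcongr
          exact (measure_mono fun x hx => hx.2).trans (hC k)
      _ = _ := by
          rw [mul_left_comm, ← ENNReal.ofReal_mul (by positivity), ← Real.rpow_add (by norm_num)]
          rw [show e * (k + 1) + (s0 * (k - √k) - n * k) = e + -(s0 * √k) by rw [← hes]; ring,
            Real.rpow_add (by norm_num), ENNReal.ofReal_mul (by positivity)]
          ring
  refine (ENNReal.tsum_le_tsum hk).trans_lt ?_
  rw [ENNReal.tsum_mul_left]
  refine ENNReal.mul_lt_top (ENNReal.mul_lt_top ENNReal.ofReal_lt_top ENNReal.coe_lt_top) ?_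
  rw [← ENNReal.ofReal_tsum_of_nonneg (fun k => by positivity) (summ_sqrt h0)]
  exact ENNReal.ofReal_lt_top

lemma vol_tendsto (h : FracData n s0 ν S) (h0 : 0 < s0) (h1 : s0 < n) :
    Tendsto (fun k : ℕ => volume {x | infDist x S ≤ (1/2 : ℝ) ^ k}) atTop (𝓝 0) := by
  obtain ⟨C, hC⟩ := h.vol
  refine tendsto_of_tendsto_of_tendsto_of_le_of_le tendsto_const_nhds ?_ (fun _ => zero_le) hC
  have h2 := (summ_sqrt h0).tendsto_atTop_zero
  have h3 : Tendsto (fun k : ℕ => (2:ℝ) ^ (s0 * (k - √k) - n * k)) atTop (𝓝 0) := by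
    refine squeeze_zero (fun k => by positivity) (fun k => ?_) h2
    refine Real.rpow_le_rpow_of_exponent_le (by norm_num) ?_
    have : (0:ℝ) ≤ k := by positivity
    nlinarith
  have h4 := ENNReal.Tendsto.const_mul (a := (C : ℝ≥0∞)) (ENNReal.tendsto_ofReal h3) (Or.inr ENNReal.coe_ne_top)
  simpa using h4

lemma null (h : FracData n s0 ν S) (h0 : 0 < s0) (h1 : s0 < n) : volume S = 0 := by
  refine le_antisymm (ge_of_tendsto' (h.vol_tendsto h0 h1) fun k => measure_mono fun x hx => ?_) zero_le
  show infDist x S ≤ _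
  rw [infDist_zero_of_mem hx]; positivity
end FracData
end

noncomputable section

lemma fderiv_zero_of_nots {n : ℕ} {φ : Euc n → ℝ} {x : Euc n} (hx : x ∉ tsupport φ) : fderiv ℝ φ x = 0 := by
  by_contra h
  exact hx (support_fderiv_subset ℝ h)

lemma W11On.mono {n : ℕ} {Ω Ω' : Set (Euc n)} {u : Euc n → ℝ} {G : Euc n → Euc n →L[ℝ] ℝ}
    (h : W11On Ω u G) (hs : Ω' ⊆ Ω) : W11On Ω' u G := by
  refine ⟨h.1.mono_set hs, h.2.1.mono_set hs, fun φ h1 h2 h3 => ?_⟩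
  have := h.2.2 φ h1 h2 (h3.trans hs)
  have e1 : ∀ A : Set (Euc n), tsupport φ ⊆ A → ∫ x in A, u x • fderiv ℝ φ x = ∫ x, u x • fderiv ℝ φ x := by
    intro A hA
    refine setIntegral_eq_integral_of_forall_compl_eq_zero fun x hx => ?_
    rw [fderiv_zero_of_nots (fun h => hx (hA h)), smul_zero]
  have e2 : ∀ A : Set (Euc n), tsupport φ ⊆ A → ∫ x in A, φ x • G x = ∫ x, φ x • G x := by
    intro A hA
    refine setIntegral_eq_integral_of_forall_compl_eq_zero fun x hx => ?_
    rw [image_eq_zero_of_notMem_tsupport (fun h => hx (hA h))]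
    exact zero_smul ℝ (G x)
  rw [e1 _ (h3.trans hs), e2 _ (h3.trans hs)] at this
  rw [e1 _ h3, e2 _ h3, this]

/-- scalar form -/
lemma W11On.pair {n : ℕ} {Ω : Set (Euc n)} {u : Euc n → ℝ} {G : Euc n → Euc n →L[ℝ] ℝ}
    (h : W11On Ω u G) {φ : Euc n → ℝ} (h1 : ContDiff ℝ (⊤ : ℕ∞) φ) (h2 : HasCompactSupport φ)
    (h3 : tsupport φ ⊆ Ω) (v : Euc n) :
    ∫ x in Ω, u x * fderiv ℝ φ x v = -∫ x in Ω, φ x * G x v := by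
  have := congrArg (fun L : Euc n →L[ℝ] ℝ => L v) (h.2.2 φ h1 h2 h3)
  simp only [neg_apply] at this
  have hc : Continuous (fderiv ℝ φ) := h1.continuous_fderiv (by simp)
  rw [ContinuousLinearMap.integral_apply (test_int1 h.1 hc (h2.fderiv ℝ)),
    ContinuousLinearMap.integral_apply (test_int2 h.2.1 h1.continuous h2)] at this
  exact this

lemma w11_of_lip {n : ℕ} {Ω : Set (Euc n)} (hΩ : volume Ω ≠ ⊤) {f : Euc n → ℝ} {K : ℝ≥0}
    (hf : LipschitzWith K f) (hfi : IntegrableOn f Ω) : W11On Ω f (fderiv ℝ f) := by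
  have hfin : IsFiniteMeasure (volume.restrict Ω) := ⟨by simpa using hΩ.lt_top⟩
  have hG : IntegrableOn (fderiv ℝ f) Ω := by
    refine Integrable.of_bound (C := K) (measurable_fderiv ℝ f).aestronglyMeasurable ?_
    exact Eventually.of_forall fun x => norm_fderiv_le_of_lipschitz ℝ hf
  refine ⟨hfi, hG, fun φ h1 h2 h3 => ?_⟩
  have hc : Continuous (fderiv ℝ φ) := h1.continuous_fderiv (by simp)
  obtain ⟨D, hD⟩ := hc.bounded_above_of_compact_support (h2.fderiv ℝ)
  have hφ : LipschitzWith D.toNNReal φ := lipschitzWith_of_nnnorm_fderiv_le (h1.differentiable (by simp)) fun x => by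
    rw [← NNReal.coe_le_coe]; exact (hD x).trans (Real.le_coe_toNNReal D)
  ext v
  simp only [neg_apply]
  rw [ContinuousLinearMap.integral_apply (test_int1 hfi hc (h2.fderiv ℝ)),
    ContinuousLinearMap.integral_apply (test_int2 hG h1.continuous h2)]
  rw [setIntegral_eq_integral_of_forall_compl_eq_zero, setIntegral_eq_integral_of_forall_compl_eq_zero]
  · have h := hf.integral_lineDeriv_mul_eq (μ := volume) hφ h2 v
    have e1 : ∫ x, lineDeriv ℝ φ x (-v) * f x = -∫ x, (f x • fderiv ℝ φ x) v := by
      rw [← integral_neg]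
      refine integral_congr_ae (Eventually.of_forall fun x => ?_)
      simp only
      rw [((h1.differentiable (by simp)) x).lineDeriv_eq_fderiv]
      simp [mul_comm]
    have e2 : ∫ x, lineDeriv ℝ f x v * φ x = ∫ x, (φ x • fderiv ℝ f x) v := by
      refine integral_congr_ae ?_
      filter_upwards [hf.ae_differentiableAt] with x hx
      rw [hx.lineDeriv_eq_fderiv]
      simp [mul_comm]
    rw [e1, e2] at h
    linarith
  · intro x hx
    rw [image_eq_zero_of_notMem_tsupport (fun h => hx (h3 h))]
    simp
  · intro x hx
    rw [fderiv_zero_of_nots (fun h => hx (h3 h)), smul_zero]; rfl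

/-! coordinates -/
lemma lastC_cont {n : ℕ} : Continuous (lastC (n := n)) := by unfold lastC; fun_prop
lemma frontC_cont {n : ℕ} : Continuous (frontC (n := n)) := by
  unfold frontC; exact (PiLp.continuous_toLp 2 _).comp (continuous_pi fun i => by fun_prop)

lemma norm_split {n : ℕ} (x : Euc (n + 1)) : ‖x‖ ^ 2 = ‖frontC x‖ ^ 2 + lastC x ^ 2 := by
  rw [EuclideanSpace.norm_sq_eq, EuclideanSpace.norm_sq_eq, Fin.sum_univ_castSucc]
  simp [frontC, lastC]

lemma frontC_sub {n : ℕ} (x y : Euc (n + 1)) : frontC (x - y) = frontC x - frontC y := by ext i; simp [frontC]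
lemma frontC_add {n : ℕ} (x y : Euc (n + 1)) : frontC (x + y) = frontC x + frontC y := by ext i; simp [frontC]
lemma frontC_smul {n : ℕ} (c : ℝ) (x : Euc (n + 1)) : frontC (c • x) = c • frontC x := by ext i; simp [frontC]
lemma lastC_sub {n : ℕ} (x y : Euc (n + 1)) : lastC (x - y) = lastC x - lastC y := by simp [lastC]
lemma lastC_add {n : ℕ} (x y : Euc (n + 1)) : lastC (x + y) = lastC x + lastC y := by simp [lastC]
lemma lastC_smul {n : ℕ} (c : ℝ) (x : Euc (n + 1)) : lastC (c • x) = c * lastC x := by simp [lastC]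

lemma frontC_snoc {n : ℕ} (y : Euc n) (t : ℝ) : frontC (snocC y t) = y := by ext i; simp [frontC, snocC]
lemma lastC_snoc {n : ℕ} (y : Euc n) (t : ℝ) : lastC (snocC y t) = t := by simp [lastC, snocC]
lemma snoc_eta {n : ℕ} (x : Euc (n + 1)) : snocC (frontC x) (lastC x) = x := by
  ext i
  refine Fin.lastCases ?_ (fun i => ?_) i <;> simp [frontC, snocC, lastC]

lemma norm_front_le {n : ℕ} (x : Euc (n + 1)) : ‖frontC x‖ ≤ ‖x‖ := by
  have := norm_split x
  exact abs_le_of_sq_le_sq' (by nlinarith [sq_nonneg (lastC x)]) (norm_nonneg _) |>.2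

lemma abs_last_le {n : ℕ} (x : Euc (n + 1)) : |lastC x| ≤ ‖x‖ := PiLp.norm_apply_le x (Fin.last n)

lemma norm_le_split {n : ℕ} (x : Euc (n + 1)) : ‖x‖ ≤ ‖frontC x‖ + |lastC x| := by
  have := norm_split x
  refine abs_le_of_sq_le_sq' ?_ (by positivity) |>.2
  nlinarith [norm_nonneg (frontC x), abs_nonneg (lastC x), sq_abs (lastC x), mul_nonneg (norm_nonneg (frontC x)) (abs_nonneg (lastC x))]

lemma mp_split {n : ℕ} : MeasurePreserving (fun x : Euc (n + 1) => (frontC x, lastC x)) volume (volume.prod volume) := by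
  have h1 := EuclideanSpace.volume_preserving_symm_measurableEquiv_toLp (Fin (n + 1))
  have h2 := volume_preserving_piFinSuccAbove (fun _ : Fin (n + 1) => ℝ) (Fin.last n)
  have h3 : MeasurePreserving (Prod.swap : ℝ × (Fin n → ℝ) → _) := Measure.measurePreserving_swap
  have h4 := (EuclideanSpace.volume_preserving_symm_measurableEquiv_toLp (Fin n)).symm
  have h5 := h4.prod (MeasurePreserving.id (volume : Measure ℝ))
  have := h5.comp (h3.comp (h2.comp h1))
  have e : (fun x : Euc (n + 1) => (frontC x, lastC x)) = (Prod.map (⇑(MeasurableEquiv.toLp 2 (Fin n → ℝ)).symm.symm) id ∘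
      Prod.swap ∘
        ⇑(MeasurableEquiv.piFinSuccAbove (fun x => ℝ) (Fin.last n)) ∘ ⇑(MeasurableEquiv.toLp 2 (Fin (n + 1) → ℝ)).symm) := by
    funext x
    refine Prod.ext ?_ ?_
    · ext i
      change x i.castSucc = x ((Fin.last n).succAbove i)
      rw [Fin.succAbove_last]
    · rfl
  rw [e]
  exact this

/-- the clamped quotient -/
def vD {n : ℕ} (D : Euc n → ℝ) (x : Euc (n + 1)) : ℝ :=
  max (-(D (frontC x))) (min (lastC x) (D (frontC x))) / D (frontC x)

lemma clamp_lip (z z' D D' : ℝ) : |max (-D) (min z D) - max (-D') (min z' D')| ≤ |z - z'| + |D - D'| := by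
  have h1 : |min z D - min z' D'| ≤ max |z - z'| |D - D'| := abs_min_sub_min_le_max z D z' D'
  have h2 : |max (-D) (min z D) - max (-D') (min z' D')| ≤ max |-D - -D'| |min z D - min z' D'| := abs_max_sub_max_le_max _ _ _ _
  have h3 : |-D - -D'| = |D - D'| := by rw [← abs_neg]; congr 1; ring
  rw [h3] at h2
  refine h2.trans (max_le ?_ (h1.trans (max_le ?_ ?_))) <;> linarith [abs_nonneg (z - z'), abs_nonneg (D - D')]

lemma vD_abs {n : ℕ} {D : Euc n → ℝ} (hD : ∀ x, 0 ≤ D x) (x : Euc (n + 1)) : |vD D x| ≤ 1 := by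
  unfold vD
  have h := hD (frontC x)
  rw [abs_div, abs_of_nonneg h]
  refine div_le_one_of_le₀ ?_ h
  rw [abs_le]
  exact ⟨le_max_left _ _, max_le (by linarith) (min_le_right _ _)⟩

lemma vD_lip {n : ℕ} {D : Euc n → ℝ} (hD : ∀ x, 0 ≤ D x) (hl : ∀ x y, |D x - D y| ≤ ‖x - y‖)
    {x : Euc (n + 1)} (hx : 0 < D (frontC x)) (y : Euc (n + 1)) :
    |vD D y - vD D x| ≤ 3 / D (frontC x) * ‖y - x‖ := by
  have hv := vD_abs hD y
  have h1 := clamp_lip (lastC y) (lastC x) (D (frontC y)) (D (frontC x))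
  have h2 := hl (frontC y) (frontC x)
  rw [← frontC_sub] at h2
  have h3 := h2.trans (norm_front_le _)
  have h4 := abs_last_le (y - x)
  rw [lastC_sub] at h4
  set c := max (-(D (frontC y))) (min (lastC y) (D (frontC y))) with hc
  set c' := max (-(D (frontC x))) (min (lastC x) (D (frontC x))) with hc'
  have e : vD D y - vD D x = ((c - c') + vD D y * (D (frontC x) - D (frontC y))) / D (frontC x) := by
    have : vD D y * D (frontC y) = c := by
      unfold vD
      rcases eq_or_ne (D (frontC y)) 0 with h0 | h0
      · rw [hc, h0]; simp [h0]
      · rw [div_mul_cancel₀ _ h0]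
    rw [eq_div_iff hx.ne', sub_mul]
    have e2 : vD D x * D (frontC x) = c' := by unfold vD; rw [div_mul_cancel₀ _ hx.ne']
    rw [e2]
    linarith
  rw [e, abs_div, abs_of_pos hx, div_mul_eq_mul_div]
  gcongr
  refine (abs_add_le _ _).trans ?_
  rw [abs_mul]
  have h5 : |vD D y| * |D (frontC x) - D (frontC y)| ≤ 1 * |D (frontC x) - D (frontC y)| := by gcongr
  rw [abs_sub_comm (D (frontC x))] at h5
  rw [abs_sub_comm (D (frontC x))]
  linarith

lemma vD_fderiv_le {n : ℕ} {D : Euc n → ℝ} (hD : ∀ x, 0 ≤ D x) (hl : ∀ x y, |D x - D y| ≤ ‖x - y‖)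
    {x : Euc (n + 1)} (hx : 0 < D (frontC x)) : ‖fderiv ℝ (vD D) x‖ ≤ 3 / D (frontC x) :=
  norm_fderiv_le_of_lip' ℝ (by positivity) (Eventually.of_forall fun y => vD_lip hD hl hx y)

lemma vD_sign {n : ℕ} {D : Euc n → ℝ} {x : Euc (n + 1)} (hx : 0 < D (frontC x)) (h : D (frontC x) ≤ |lastC x|) :
    vD D x = SignType.sign (lastC x) := by
  unfold vD
  rcases le_abs'.1 h with h1 | h1
  · have h0 : lastC x < 0 := by linarith
    rw [min_eq_left (by linarith), max_eq_left h1, sign_neg h0]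
    simp [neg_div, div_self hx.ne']
  · have h0 : 0 < lastC x := by linarith
    rw [min_eq_right h1, max_eq_right (by linarith), sign_pos h0]
    simp [div_self hx.ne']

lemma vD_fderiv_zero {n : ℕ} {D : Euc n → ℝ} (hl : ∀ x y, |D x - D y| ≤ ‖x - y‖)
    {x : Euc (n + 1)} (hx : 0 < D (frontC x)) (h : D (frontC x) < |lastC x|) : fderiv ℝ (vD D) x = 0 := by
  have hDc : Continuous D := by
    refine (LipschitzWith.of_dist_le_mul (K := 1) fun x y => ?_).continuous
    rw [Real.dist_eq, dist_eq_norm]; simpa using hl x y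
  have hne : lastC x ≠ 0 := by intro h0; rw [h0, abs_zero] at h; linarith
  have c1 : Continuous fun y : Euc (n + 1) => D (frontC y) := hDc.comp frontC_cont
  have ev : vD D =ᶠ[𝓝 x] fun _ => ((SignType.sign (lastC x) : SignType) : ℝ) := by
    filter_upwards [c1.continuousAt.eventually_const_lt hx,
      (c1.tendsto x).eventually_lt (lastC_cont.abs.tendsto x) h,
      (isOpen_lt continuous_const (lastC_cont.mul (continuous_const (y := lastC x)))).mem_nhds
        (show (0:ℝ) < lastC x * lastC x from mul_self_pos.2 hne)] with y h1 h2 h3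
    rw [vD_sign h1 h2.le]
    have h3 : 0 < lastC y * lastC x := h3
    congr 1
    rcases lt_or_gt_of_ne hne with h4 | h4
    · rw [sign_neg h4, sign_neg (by nlinarith)]
    · rw [sign_pos h4, sign_pos (by nlinarith)]
  rw [ev.fderiv_eq]; simp
end

noncomputable section

lemma lint_split {n : ℕ} {F : Euc n × ℝ → ℝ≥0∞} (hF : Measurable F) :
    ∫⁻ x : Euc (n + 1), F (frontC x, lastC x) = ∫⁻ y, ∫⁻ z, F (y, z) := by
  rw [mp_split.lintegral_comp hF, lintegral_prod _ hF.aemeasurable]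

lemma lint_ball_split {n : ℕ} {F : Euc n × ℝ → ℝ≥0∞} (hF : Measurable F) (R : ℝ) :
    ∫⁻ x in ball (0 : Euc (n + 1)) R, F (frontC x, lastC x) ≤
      ∫⁻ y in ball (0 : Euc n) R, ∫⁻ z in Icc (-R) R, F (y, z) := by
  have h1 : Measurable ((ball (0 : Euc n) R ×ˢ Icc (-R) R).indicator F) :=
    hF.indicator (measurableSet_ball.prod measurableSet_Icc)
  have h2 := lint_split h1
  calc _ ≤ ∫⁻ x : Euc (n + 1), (ball (0 : Euc n) R ×ˢ Icc (-R) R).indicator F (frontC x, lastC x) := by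
        rw [← lintegral_indicator measurableSet_ball]
        refine lintegral_mono fun x => ?_
        by_cases hx : x ∈ ball (0 : Euc (n + 1)) R
        swap
        · rw [indicator_of_notMem hx]; exact zero_le
        rw [indicator_of_mem hx]
        rw [mem_ball_zero_iff] at hx
        have a := norm_front_le x
        have b := abs_le.1 ((abs_last_le x).trans hx.le)
        rw [indicator_of_mem]
        exact ⟨by rw [mem_ball_zero_iff]; exact a.trans_lt hx, b⟩
    _ = _ := by
        rw [h2, ← lintegral_indicator measurableSet_ball]
        refine lintegral_congr fun y => ?_
        by_cases hy : y ∈ ball (0 : Euc n) R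
        · rw [indicator_of_mem hy, ← lintegral_indicator measurableSet_Icc]
          refine lintegral_congr fun z => ?_
          by_cases hz : z ∈ Icc (-R) R
          · rw [indicator_of_mem hz, indicator_of_mem (mem_prod.2 ⟨hy, hz⟩)]
          · rw [indicator_of_notMem hz, indicator_of_notMem (fun h => hz h.2)]
        · rw [indicator_of_notMem hy]
          simp only [indicator_of_notMem (fun h => hy (mem_prod.1 h).1 : (y, _) ∉ _), lintegral_zero]

def dl {n : ℕ} (S : Set (Euc n)) (x : Euc n) : ℝ := min (infDist x S) (1 / 4)

lemma dl_nonneg {n : ℕ} (S : Set (Euc n)) (x : Euc n) : 0 ≤ dl S x := le_min infDist_nonneg (by norm_num)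
lemma dl_le {n : ℕ} (S : Set (Euc n)) (x : Euc n) : dl S x ≤ 1 / 4 := min_le_right _ _
lemma dl_lip {n : ℕ} (S : Set (Euc n)) (x y : Euc n) : |dl S x - dl S y| ≤ ‖x - y‖ := by
  refine (abs_min_sub_min_le_max _ _ _ _).trans (max_le ?_ (by simp))
  have := (lipschitz_infDist_pt S).dist_le_mul x y
  rwa [Real.dist_eq, dist_eq_norm, NNReal.coe_one, one_mul] at this
lemma dl_cont {n : ℕ} (S : Set (Euc n)) : Continuous (dl S) := (continuous_infDist_pt S).min continuous_const
lemma dl_pos {n : ℕ} {S : Set (Euc n)} (hc : IsClosed S) (hne : S.Nonempty) {x : Euc n} (hx : x ∉ S) : 0 < dl S x :=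
  lt_min ((hc.notMem_iff_infDist_pos hne).1 hx) (by norm_num)
lemma dl_zero {n : ℕ} {S : Set (Euc n)} {x : Euc n} (hx : x ∈ S) : dl S x = 0 := by
  simp [dl, infDist_zero_of_mem hx]

lemma FracData.int_dl {n : ℕ} {s0 : ℝ} {ν : Measure (Euc n)} {S : Set (Euc n)} (h : FracData n s0 ν S) (h0 : 0 < s0)
    {e : ℝ} (he : 0 < e) (hes : s0 + e = n) (R : ℝ) :
    ∫⁻ x in ball (0 : Euc n) R, ENNReal.ofReal (dl S x ^ (-e)) < ⊤ := by
  have hi := h.integral_dist h0 he hes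
  have hm : MeasurableSet {x : Euc n | 0 < infDist x S ∧ infDist x S ≤ 1} :=
    (measurableSet_lt measurable_const (continuous_infDist_pt S).measurable).inter
      (measurableSet_le (continuous_infDist_pt S).measurable measurable_const)
  calc _ ≤ ∫⁻ x in ball (0 : Euc n) R, ({x : Euc n | 0 < infDist x S ∧ infDist x S ≤ 1}.indicator
        (fun x => ENNReal.ofReal (4 ^ e) * ENNReal.ofReal (infDist x S ^ (-e))) x + ENNReal.ofReal (4 ^ e)) := by
        refine lintegral_mono fun x => ?_
        rcases (infDist_nonneg (x := x) (s := S)).eq_or_lt with h1 | h1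
        · have : dl S x = 0 := by simp [dl, ← h1]
          rw [this, Real.zero_rpow (by linarith)]; simp
        by_cases h2 : infDist x S ≤ 1
        · rw [indicator_of_mem (show x ∈ {x : Euc n | 0 < infDist x S ∧ infDist x S ≤ 1} from ⟨h1, h2⟩)]
          refine le_add_right ?_
          rw [← ENNReal.ofReal_mul (by positivity)]
          refine ENNReal.ofReal_le_ofReal ?_
          have h3 : infDist x S / 4 ≤ dl S x := le_min (by linarith) (by linarith)
          calc dl S x ^ (-e) ≤ (infDist x S / 4) ^ (-e) :=
                Real.rpow_le_rpow_of_nonpos (by positivity) h3 (by linarith)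
            _ = _ := by
                rw [Real.div_rpow h1.le (by norm_num), Real.rpow_neg (by norm_num : (0:ℝ) ≤ 4)]
                field_simp
        · refine le_add_left ?_
          refine ENNReal.ofReal_le_ofReal ?_
          have : dl S x = 1 / 4 := min_eq_right (by linarith)
          rw [this, one_div, Real.inv_rpow (by norm_num), Real.rpow_neg (by norm_num), inv_inv]
    _ < ⊤ := by
        rw [lintegral_add_right _ measurable_const]
        refine ENNReal.add_lt_top.2 ⟨?_, ?_⟩
        · refine (setLIntegral_le_lintegral _ _).trans_lt ?_
          rw [lintegral_indicator hm, lintegral_const_mul' _ _ (by simp)]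
          exact ENNReal.mul_lt_top (by simp) hi
        · rw [setLIntegral_const]
          exact ENNReal.mul_lt_top (by simp) measure_ball_lt_top

lemma pow_lint_fin {b R : ℝ} (hb : -1 < b) (hR : 0 ≤ R) : ∫⁻ z in Icc (-R) R, ENNReal.ofReal (|z| ^ b) < ⊤ := by
  have h1 : IntegrableOn (fun z : ℝ => |z| ^ b) (Icc (-R) R) := by
    have h2 : IntervalIntegrable (fun z : ℝ => z ^ b) volume 0 R := intervalIntegral.intervalIntegrable_rpow' hb
    have h3 : IntegrableOn (fun z : ℝ => |z| ^ b) (Ioc 0 R) := by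
      rw [intervalIntegrable_iff_integrableOn_Ioc_of_le hR] at h2
      refine h2.congr_fun (fun z hz => ?_) measurableSet_Ioc
      simp only [abs_of_pos hz.1]
    have h4 : IntegrableOn (fun z : ℝ => |z| ^ b) (Ico (-R) 0) := by
      have := (integrableOn_Ioc_iff_integrableOn_Ioo (f := fun z : ℝ => |z| ^ b) (μ := volume) (a := 0) (b := R)).1 h3
      have h5 : IntegrableOn (fun z : ℝ => |z| ^ b) (Ioo (-R) 0) := by
        have h6 := this.comp_neg
        have e : -Ioo 0 R = Ioo (-R) (0:ℝ) := by simp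
        rw [e] at h6
        simpa using h6
      exact (integrableOn_Ico_iff_integrableOn_Ioo).2 h5
    have h5 : IntegrableOn (fun z : ℝ => |z| ^ b) {0} := integrableOn_singleton (by simp) (by rw [measure_singleton]; simp)
    refine (h3.union (h4.union h5)).mono_set fun z hz => ?_
    rcases lt_trichotomy z 0 with h | h | h
    · exact Or.inr (Or.inl ⟨hz.1, h⟩)
    · exact Or.inr (Or.inr h)
    · exact Or.inl ⟨h, hz.2⟩
  have := h1.2
  rw [hasFiniteIntegral_iff_ofReal (Eventually.of_forall fun z => by positivity)] at this
  exact this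

open Classical in
def Uf {n : ℕ} (S : Set (Euc n)) (x : Euc (n + 1)) : ℝ :=
  if frontC x ∈ S then ((SignType.sign (lastC x) : SignType) : ℝ) else vD (dl S) x
open Classical in
def GUf {n : ℕ} (S : Set (Euc n)) (x : Euc (n + 1)) : Euc (n + 1) →L[ℝ] ℝ :=
  if frontC x ∈ S then 0 else fderiv ℝ (vD (dl S)) x

section
variable {n : ℕ} {S : Set (Euc n)}

lemma Uf_abs (x : Euc (n + 1)) : |Uf S x| ≤ 1 := by
  unfold Uf
  split_ifs with h
  · rcases lt_trichotomy (lastC x) 0 with h | h | h <;> simp [h]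
  · exact vD_abs (dl_nonneg S) x

lemma Uf_sign (hc : IsClosed S) (hne : S.Nonempty) {x : Euc (n + 1)} (h : dl S (frontC x) ≤ |lastC x|) :
    Uf S x = SignType.sign (lastC x) := by
  unfold Uf
  split_ifs with h1
  · rfl
  · exact vD_sign (dl_pos hc hne h1) h

lemma GUf_zero (hc : IsClosed S) (hne : S.Nonempty) {x : Euc (n + 1)} (h : dl S (frontC x) < |lastC x|) :
    GUf S x = 0 := by
  unfold GUf
  split_ifs with h1
  · rfl
  · exact vD_fderiv_zero (dl_lip S) (dl_pos hc hne h1) h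

lemma GUf_le (hc : IsClosed S) (hne : S.Nonempty) (x : Euc (n + 1)) : ‖GUf S x‖ ≤ 3 / dl S (frontC x) := by
  unfold GUf
  split_ifs with h1
  · rw [norm_zero]; exact div_nonneg (by norm_num) (dl_nonneg _ _)
  · exact vD_fderiv_le (dl_nonneg S) (dl_lip S) (dl_pos hc hne h1)

lemma GUf_meas (hc : IsClosed S) : Measurable (GUf S) := by
  unfold GUf
  exact Measurable.ite (hc.measurableSet.preimage frontC_cont.measurable) measurable_const (measurable_fderiv ℝ _)

lemma Uf_meas (hc : IsClosed S) : Measurable (Uf S) := by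
  unfold Uf
  have h1 : Measurable (fun x : Euc (n + 1) => dl S (frontC x)) := ((dl_cont S).comp frontC_cont).measurable
  have h2 : Measurable (fun x : Euc (n + 1) => lastC x) := lastC_cont.measurable
  refine Measurable.ite (hc.measurableSet.preimage frontC_cont.measurable) ?_ ?_
  · have : (fun x : Euc (n + 1) => ((SignType.sign (lastC x) : SignType) : ℝ)) =
        fun x => if 0 < lastC x then (1:ℝ) else if lastC x < 0 then -1 else 0 := by
      funext x
      rcases lt_trichotomy (lastC x) 0 with h | h | h
      · simp [h, h.le]
      · simp [h]
      · simp [h]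
    rw [this]
    exact Measurable.ite (measurableSet_lt measurable_const h2) measurable_const
      (Measurable.ite (measurableSet_lt h2 measurable_const) measurable_const measurable_const)
  · unfold vD
    exact (h1.neg.max (h2.min h1)).div h1

lemma fr_null (hS : volume S = 0) : ∀ᵐ x : Euc (n + 1), frontC x ∉ S := by
  have h := mp_split (n := n) |>.quasiMeasurePreserving
  have h2 : ∀ᵐ y : Euc n × ℝ ∂(volume.prod volume), y.1 ∉ S := by
    have : (volume.prod volume : Measure (Euc n × ℝ)) (S ×ˢ univ) = 0 := by
      rw [Measure.prod_prod, hS, zero_mul]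
    rw [ae_iff]
    refine measure_mono_null (fun y hy => ?_) this
    simp at hy; exact ⟨hy, mem_univ _⟩
  exact h.ae h2

/-- energy bound -/
lemma FracData.GUf_energy {p : ℝ} {ν : Measure (Euc n)} (h : FracData n (n + 1 - p) ν S) (hp : 1 < p) (hpn : p < n + 1) (R : ℝ) :
    ∫⁻ x in ball (0 : Euc (n + 1)) R, ENNReal.ofReal (‖GUf S x‖ ^ p) < ⊤ := by
  have hc : IsClosed S := h.comp.isClosed
  have hne := h.ne
  let F : Euc n × ℝ → ℝ≥0∞ := fun y => {y : Euc n × ℝ | |y.2| ≤ dl S y.1}.indicator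
    (fun y => ENNReal.ofReal (3 ^ p * dl S y.1 ^ (-p))) y
  have hF : Measurable F := by
    refine Measurable.indicator ?_ ?_
    · exact ENNReal.measurable_ofReal.comp ((((dl_cont S).measurable.comp measurable_fst).pow_const _).const_mul _)
    · exact measurableSet_le measurable_snd.abs ((dl_cont S).measurable.comp measurable_fst)
  calc _ ≤ ∫⁻ x in ball (0 : Euc (n + 1)) R, F (frontC x, lastC x) := by
        refine lintegral_mono fun x => ?_
        by_cases hx : |lastC x| ≤ dl S (frontC x)
        · have : F (frontC x, lastC x) = ENNReal.ofReal (3 ^ p * dl S (frontC x) ^ (-p)) := indicator_of_mem (s := {y : Euc n × ℝ | |y.2| ≤ dl S y.1}) hx _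
          rw [this]
          refine ENNReal.ofReal_le_ofReal ?_
          calc _ ≤ (3 / dl S (frontC x)) ^ p := Real.rpow_le_rpow (norm_nonneg _) (GUf_le hc hne x) (by linarith)
            _ = _ := by rw [Real.div_rpow (by norm_num) (dl_nonneg _ _), Real.rpow_neg (dl_nonneg _ _)]; rfl
        · rw [GUf_zero hc hne (by linarith), norm_zero, Real.zero_rpow (by linarith)]; simp
    _ ≤ _ := lint_ball_split hF R
    _ ≤ ∫⁻ y in ball (0 : Euc n) R, ENNReal.ofReal (2 * 3 ^ p) * ENNReal.ofReal (dl S y ^ (-(p - 1))) := by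
        refine lintegral_mono fun y => ?_
        refine (setLIntegral_le_lintegral _ _).trans ?_
        have : ∀ z, F (y, z) = (Icc (-(dl S y)) (dl S y)).indicator (fun _ => ENNReal.ofReal (3 ^ p * dl S y ^ (-p))) z := by
          intro z
          by_cases hz : |z| ≤ dl S y
          · rw [indicator_of_mem (show z ∈ Icc (-(dl S y)) (dl S y) from abs_le.1 hz)]
            exact indicator_of_mem (s := {y : Euc n × ℝ | |y.2| ≤ dl S y.1}) hz _
          · rw [indicator_of_notMem (show z ∉ Icc (-(dl S y)) (dl S y) from fun h => hz (abs_le.2 h))]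
            exact indicator_of_notMem (s := {y : Euc n × ℝ | |y.2| ≤ dl S y.1}) hz _
        simp only [this]
        rw [lintegral_indicator measurableSet_Icc, setLIntegral_const, Real.volume_Icc, ← ENNReal.ofReal_mul (by have := dl_nonneg S y; positivity),
          ← ENNReal.ofReal_mul (by positivity)]
        refine ENNReal.ofReal_le_ofReal (le_of_eq ?_)
        rcases (dl_nonneg S y).eq_or_lt with h0 | h0
        · rw [← h0, Real.zero_rpow (by linarith), Real.zero_rpow (by linarith)]; ring
        · rw [show -(p - 1) = -p + 1 by ring, Real.rpow_add h0, Real.rpow_one]; ring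
    _ < ⊤ := by
        rw [lintegral_const_mul' _ _ ENNReal.ofReal_ne_top]
        exact ENNReal.mul_lt_top ENNReal.ofReal_lt_top (h.int_dl (by linarith) (by linarith) (by ring) R)

lemma FracData.Uf_w11 {p : ℝ} {ν : Measure (Euc n)} (h : FracData n (n + 1 - p) ν S) (hp : 1 < p) (hpn : p < n + 1) (R : ℝ) (hR : 0 ≤ R) :
    W11On (ball (0 : Euc (n + 1)) R) (Uf S) (GUf S) := by
  have hc : IsClosed S := h.comp.isClosed
  have hne := h.ne
  have hnull := h.null (by linarith) (by linarith)
  let D : ℕ → Euc n → ℝ := fun J x => max (dl S x) ((1/2) ^ J)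
  have hD0 : ∀ J x, 0 < D J x := fun J x => lt_max_of_lt_right (by positivity)
  have hDl : ∀ J x y, |D J x - D J y| ≤ ‖x - y‖ := fun J x y =>
    (abs_max_sub_max_le_max _ _ _ _).trans (max_le (dl_lip S x y) (by simp))
  have hfin : IsFiniteMeasure (volume.restrict (ball (0 : Euc (n + 1)) R)) := ⟨by simpa using measure_ball_lt_top⟩
  have hlip : ∀ J, LipschitzWith (3 / (1/2) ^ J) (vD (D J)) := fun J => by
    refine LipschitzWith.of_dist_le_mul fun x y => ?_
    rw [Real.dist_eq, dist_eq_norm]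
    refine (vD_lip (fun x => (hD0 J x).le) (hDl J) (hD0 J _) x).trans ?_
    refine mul_le_mul_of_nonneg_right ?_ (norm_nonneg _)
    push_cast
    exact div_le_div_of_nonneg_left (by norm_num) (by positivity) (le_max_right _ _)
  have hJi : ∀ J, IntegrableOn (vD (D J)) (ball (0 : Euc (n + 1)) R) := fun J =>
    Integrable.of_bound (C := 1) (hlip J).continuous.aestronglyMeasurable
      (Eventually.of_forall fun x => vD_abs (fun x => (hD0 J x).le) x)
  have hJ : ∀ J, W11On (ball (0 : Euc (n + 1)) R) (vD (D J)) (fderiv ℝ (vD (D J))) := fun J =>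
    w11_of_lip measure_ball_lt_top.ne (hlip J) (hJi J)
  have hU : IntegrableOn (Uf S) (ball (0 : Euc (n + 1)) R) :=
    Integrable.of_bound (C := 1) (Uf_meas hc).aestronglyMeasurable (Eventually.of_forall fun x => Uf_abs x)
  -- domination
  let θ := min (p - 1) (1 / 2)
  have hθ0 : 0 < θ := lt_min (by linarith) (by norm_num)
  have hθ1 : θ ≤ p - 1 := min_le_left _ _
  have hθ2 : θ ≤ 1/2 := min_le_right _ _
  let F : Euc n × ℝ → ℝ≥0∞ := fun y => ENNReal.ofReal (3 * dl S y.1 ^ (-θ)) * ENNReal.ofReal (|y.2| ^ (θ - 1))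
  have hF : Measurable F := by
    refine Measurable.mul (f := fun y : Euc n × ℝ => ENNReal.ofReal (3 * dl S y.1 ^ (-θ))) (g := fun y : Euc n × ℝ => ENNReal.ofReal (|y.2| ^ (θ - 1))) ?_ ?_
    · exact ENNReal.measurable_ofReal.comp ((((dl_cont S).measurable.comp measurable_fst).pow_const _).const_mul _)
    · exact ENNReal.measurable_ofReal.comp (measurable_snd.abs.pow_const _)
  let f : Euc (n + 1) → ℝ := fun x => 3 * dl S (frontC x) ^ (-θ) * |lastC x| ^ (θ - 1)
  have hf0 : ∀ x, 0 ≤ f x := fun x => by have := dl_nonneg S (frontC x); positivity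
  have hfm : Measurable f := by
    change Measurable (fun x : Euc (n + 1) => 3 * dl S (frontC x) ^ (-θ) * |lastC x| ^ (θ - 1))
    refine Measurable.mul (f := fun x : Euc (n + 1) => 3 * dl S (frontC x) ^ (-θ)) (g := fun x : Euc (n + 1) => |lastC x| ^ (θ - 1)) ?_ ?_
    · exact (((dl_cont S).comp frontC_cont).measurable.pow_const _).const_mul _
    · exact lastC_cont.measurable.abs.pow_const _
  have hfF : ∀ x, ENNReal.ofReal (f x) = F (frontC x, lastC x) := fun x =>
    ENNReal.ofReal_mul (by have := dl_nonneg S (frontC x); positivity)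
  have hfi : IntegrableOn f (ball (0 : Euc (n + 1)) R) := by
    refine ⟨hfm.aestronglyMeasurable, ?_⟩
    rw [hasFiniteIntegral_iff_ofReal (Eventually.of_forall hf0)]
    simp only [hfF]
    refine (lint_ball_split hF R).trans_lt ?_
    have hz := pow_lint_fin (b := θ - 1) (R := R) (by linarith) hR
    simp only [F, lintegral_const_mul' _ _ ENNReal.ofReal_ne_top]
    rw [lintegral_mul_const' _ _ hz.ne]
    refine ENNReal.mul_lt_top ?_ hz
    have := h.int_dl (e := p - 1) (by linarith) (by linarith) (by ring) R
    refine lt_of_le_of_lt (lintegral_mono (g := fun y => ENNReal.ofReal 3 * ENNReal.ofReal (dl S y ^ (-(p - 1)))) fun y => ?_) ?_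
    · simp only
      rw [← ENNReal.ofReal_mul (by norm_num)]
      refine ENNReal.ofReal_le_ofReal (mul_le_mul_of_nonneg_left ?_ (by norm_num))
      rcases (dl_nonneg S y).eq_or_lt with h0 | h0
      · rw [← h0, Real.zero_rpow (by linarith), Real.zero_rpow (by linarith)]
      · exact Real.rpow_le_rpow_of_exponent_ge h0 ((dl_le S y).trans (by norm_num)) (by linarith)
    · rw [lintegral_const_mul' _ _ (by simp)]
      exact ENNReal.mul_lt_top (by simp) this
  have key : ∀ {a b z : ℝ}, 0 < a → a ≤ b → 0 < |z| → |z| ≤ b → 3 / b ≤ 3 * a ^ (-θ) * |z| ^ (θ - 1) := by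
    intro a b z ha hab hz hzb
    have hb : 0 < b := ha.trans_le hab
    have e : 3 / b = 3 * b ^ (-θ) * b ^ (θ - 1) := by
      rw [mul_assoc, ← Real.rpow_add hb, show -θ + (θ - 1) = -1 by ring, Real.rpow_neg_one]; rfl
    rw [e]
    have h1 := Real.rpow_le_rpow_of_nonpos ha hab (show -θ ≤ 0 by linarith)
    have h2 := Real.rpow_le_rpow_of_nonpos hz hzb (show θ - 1 ≤ 0 by linarith)
    have := Real.rpow_nonneg hb.le (θ - 1)
    have := Real.rpow_nonneg ha.le (-θ)
    gcongr
  have hz0 : ∀ᵐ x : Euc (n + 1), lastC x ≠ 0 := by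
    have h2 : ∀ᵐ y : Euc n × ℝ ∂(volume.prod volume), y.2 ≠ 0 := by
      have : (volume.prod volume : Measure (Euc n × ℝ)) (univ ×ˢ {0}) = 0 := by
        rw [Measure.prod_prod]; simp
      rw [ae_iff]
      refine measure_mono_null (fun y hy => ?_) this
      simp at hy; exact ⟨mem_univ _, hy⟩
    exact (mp_split (n := n)).quasiMeasurePreserving.ae h2
  have hGb : ∀ᵐ x ∂(volume.restrict (ball (0 : Euc (n + 1)) R)), ‖GUf S x‖ ≤ f x := by
    refine ae_restrict_of_ae ?_
    filter_upwards [fr_null hnull, hz0] with x h1 h2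
    by_cases h3 : dl S (frontC x) < |lastC x|
    · rw [GUf_zero hc hne h3, norm_zero]; exact hf0 x
    · exact (GUf_le hc hne x).trans (key (dl_pos hc hne h1) le_rfl (abs_pos.2 h2) (by linarith))
  have hGJb : ∀ J, ∀ᵐ x ∂(volume.restrict (ball (0 : Euc (n + 1)) R)), ‖fderiv ℝ (vD (D J)) x‖ ≤ f x := by
    intro J
    refine ae_restrict_of_ae ?_
    filter_upwards [fr_null hnull, hz0] with x h1 h2
    by_cases h3 : D J (frontC x) < |lastC x|
    · rw [vD_fderiv_zero (hDl J) (hD0 J _) h3, norm_zero]; exact hf0 x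
    · exact (vD_fderiv_le (fun x => (hD0 J x).le) (hDl J) (hD0 J _)).trans
        (key (dl_pos hc hne h1) (le_max_left _ _) (abs_pos.2 h2) (by linarith))
  have hG : IntegrableOn (GUf S) (ball (0 : Euc (n + 1)) R) := hfi.mono' (GUf_meas hc).aestronglyMeasurable hGb
  have hev : ∀ x : Euc (n + 1), frontC x ∉ S → ∀ᶠ J in atTop, ∀ᶠ y in 𝓝 x, vD (D J) y = Uf S y ∧ Uf S y = vD (dl S) y := by
    intro x hx
    have h0 := dl_pos hc hne hx
    have t : Tendsto (fun J : ℕ => (1/2 : ℝ) ^ J) atTop (𝓝 0) := tendsto_pow_atTop_nhds_zero_of_lt_one (by norm_num) (by norm_num)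
    filter_upwards [t.eventually_lt_const h0] with J hJ
    have c1 : Continuous fun y : Euc (n + 1) => dl S (frontC y) := (dl_cont S).comp frontC_cont
    filter_upwards [c1.continuousAt.eventually_const_lt hJ] with y hy
    have hyS : frontC y ∉ S := fun h => by
      rw [dl_zero h] at hy
      have : (0:ℝ) < (1/2) ^ J := by positivity
      linarith
    have e : Uf S y = vD (dl S) y := by unfold Uf; rw [if_neg hyS]
    refine ⟨?_, e⟩
    rw [e]
    unfold vD
    simp only [D, max_eq_left hy.le]
  refine W11On.lim hJ hU hG ?_ ?_
  · have := tendsto_integral_of_dominated_convergence (μ := volume.restrict (ball (0 : Euc (n + 1)) R))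
      (F := fun J x => ‖vD (D J) x - Uf S x‖) (f := fun _ => 0) (fun _ => 2)
      (fun J => ((hJi J).sub hU).aestronglyMeasurable.norm) (integrable_const _) ?_ ?_
    · simpa using this
    · intro J
      refine Eventually.of_forall fun x => ?_
      rw [norm_norm]
      refine (norm_sub_le _ _).trans ?_
      have h1 : ‖vD (D J) x‖ ≤ 1 := vD_abs (fun x => (hD0 J x).le) x
      have h2 : ‖Uf S x‖ ≤ 1 := Uf_abs (S := S) x
      linarith
    · refine ae_restrict_of_ae ?_
      filter_upwards [fr_null hnull] with x h1
      refine tendsto_const_nhds.congr' ?_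
      filter_upwards [hev x h1] with J hJ
      rw [hJ.self_of_nhds.1, sub_self, norm_zero]
  · have := tendsto_integral_of_dominated_convergence (μ := volume.restrict (ball (0 : Euc (n + 1)) R))
      (F := fun J x => ‖fderiv ℝ (vD (D J)) x - GUf S x‖) (f := fun _ => 0) (fun x => f x + f x)
      (fun J => ((hJ J).2.1.sub hG).aestronglyMeasurable.norm) (hfi.add hfi) ?_ ?_
    · simpa using this
    · intro J
      filter_upwards [hGb, hGJb J] with x h1 h2
      rw [norm_norm]
      exact (norm_sub_le _ _).trans (add_le_add h2 h1)
    · refine ae_restrict_of_ae ?_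
      filter_upwards [fr_null hnull] with x h1
      refine tendsto_const_nhds.congr' ?_
      filter_upwards [hev x h1] with J hJ
      have e1 : vD (D J) =ᶠ[𝓝 x] vD (dl S) := hJ.mono fun y hy => hy.1.trans hy.2
      have e2 : GUf S x = fderiv ℝ (vD (dl S)) x := by unfold GUf; rw [if_neg h1]
      rw [e1.fderiv_eq, e2, sub_self, norm_zero]
end
end

noncomputable section

open Convolution in
lemma conv_bound {d : ℕ} {f : Euc d → ℝ} (hf : LocallyIntegrable f) (hf1 : ∀ x, |f x| ≤ 1) (j : ℕ) :
    ∀ {F F' : Type} [NormedAddCommGroup F] [NormedSpace ℝ F] [NormedAddCommGroup F'] [NormedSpace ℝ F']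
      (L : ℝ →L[ℝ] F →L[ℝ] F') (g : Euc d → F) (_ : ContDiff ℝ (⊤ : ℕ∞) g) (_ : HasCompactSupport g) (x : Euc d),
      ‖iteratedFDeriv ℝ j (f ⋆[L, volume] g) x‖ ≤ ‖L‖ * ∫ y, ‖iteratedFDeriv ℝ j g y‖ := by
  induction j with
  | zero =>
    intro F F' _ _ _ _ L g hg hgc x
    simp only [norm_iteratedFDeriv_zero]
    have hgi : Integrable (fun y => ‖g y‖) := (hg.continuous.integrable_of_hasCompactSupport hgc).norm
    have hgi2 : Integrable (fun t => ‖g (x - t)‖) := hgi.comp_sub_left x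
    have : ∫ t, ‖g (x - t)‖ = ∫ y, ‖g y‖ := integral_sub_left_eq_self (fun y => ‖g y‖) volume x
    rw [← this, ← integral_const_mul]
    refine norm_integral_le_of_norm_le (hgi2.const_mul _) (Eventually.of_forall fun t => ?_)
    refine (L.le_opNorm₂ _ _).trans ?_
    have h1 : ‖f t‖ ≤ 1 := hf1 t
    have := mul_le_mul_of_nonneg_left h1 (norm_nonneg L)
    rw [mul_one] at this
    exact mul_le_mul_of_nonneg_right this (norm_nonneg _)
  | succ j ih =>
    intro F F' _ _ _ _ L g hg hgc x
    have e : fderiv ℝ (f ⋆[L, volume] g) = f ⋆[L.precompR (Euc d), volume] fderiv ℝ g := by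
      funext x
      exact (hgc.hasFDerivAt_convolution_right L hf (hg.of_le (by simp)) x).fderiv
    rw [← norm_iteratedFDeriv_fderiv, e]
    refine (ih (L.precompR (Euc d)) (fderiv ℝ g) (hg.fderiv_right (by simp)) (hgc.fderiv ℝ) x).trans ?_
    simp only [norm_iteratedFDeriv_fderiv]
    exact mul_le_mul_of_nonneg_right (ContinuousLinearMap.norm_precompR_le _ L) (integral_nonneg fun _ => norm_nonneg _)

open Convolution in
lemma exists_smooth_nbhd (d : ℕ) : ∃ C : ℕ → ℝ, (∀ j, 0 ≤ C j) ∧ ∀ A : Set (Euc d), MeasurableSet A → ∃ η : Euc d → ℝ,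
    ContDiff ℝ (⊤ : ℕ∞) η ∧ (∀ j x, ‖iteratedFDeriv ℝ j η x‖ ≤ C j) ∧ (∀ x, 0 ≤ η x) ∧
    (∀ x, η x ≠ 0 → ∃ y ∈ A, ‖x - y‖ < 1/16) ∧ (∀ x, ball x (1/16) ⊆ A → η x = 1) := by
  let φ : ContDiffBump (0 : Euc d) := ⟨1/32, 1/16, by norm_num, by norm_num⟩
  let g : Euc d → ℝ := φ.normed volume
  have hg : ContDiff ℝ (⊤ : ℕ∞) g := φ.contDiff_normed
  have hgc : HasCompactSupport g := φ.hasCompactSupport_normed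
  have hgs : ∀ x, g x ≠ 0 → ‖x‖ < 1/16 := fun x hx => by
    have : x ∈ Function.support g := hx
    rw [φ.support_normed_eq, mem_ball_zero_iff] at this; exact this
  refine ⟨fun j => ‖ContinuousLinearMap.lsmul ℝ ℝ (E := ℝ)‖ * ∫ y, ‖iteratedFDeriv ℝ j g y‖,
    fun j => mul_nonneg (norm_nonneg _) (integral_nonneg fun _ => norm_nonneg _), fun A hA => ?_⟩
  have hfm : Measurable (A.indicator fun _ => (1:ℝ)) := measurable_const.indicator hA
  have hf1 : ∀ x, |A.indicator (fun _ => (1:ℝ)) x| ≤ 1 := fun x => by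
    by_cases h : x ∈ A <;> simp [h]
  have hf : LocallyIntegrable (A.indicator fun _ => (1:ℝ)) := by
    refine (locallyIntegrable_const (1:ℝ)).mono hfm.aestronglyMeasurable (Eventually.of_forall fun x => ?_)
    simpa using hf1 x
  refine ⟨(A.indicator fun _ => (1:ℝ)) ⋆[ContinuousLinearMap.lsmul ℝ ℝ, volume] g,
    hgc.contDiff_convolution_right _ hf hg, fun j x => conv_bound hf hf1 j _ g hg hgc x, ?_, ?_, ?_⟩
  · intro x
    refine integral_nonneg fun t => ?_
    exact mul_nonneg (indicator_nonneg (fun _ _ => zero_le_one) t) (φ.nonneg_normed _)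
  · intro x hx
    by_contra hcon
    push Not at hcon
    apply hx
    rw [convolution_def]
    refine integral_eq_zero_of_ae (Eventually.of_forall fun t => ?_)
    by_cases ht : t ∈ A
    · have : g (x - t) = 0 := by
        by_contra h
        have := hgs _ h
        linarith [hcon t ht]
      simp [this]
    · simp [ht]
  · intro x hx
    rw [convolution_def]
    have : ∀ t, (ContinuousLinearMap.lsmul ℝ ℝ (A.indicator (fun _ => (1:ℝ)) t)) (g (x - t)) = g (x - t) := by
      intro t
      by_cases ht : t ∈ A
      · simp [ht]
      · have : g (x - t) = 0 := by
          by_contra h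
          have := hgs _ h
          apply ht
          apply hx
          rw [mem_ball, dist_comm, dist_eq_norm]; exact this
        simp [this]
    simp only [this]
    rw [integral_sub_left_eq_self g volume x]
    exact φ.integral_normed

lemma geo_aux (k j : ℕ) (a : ℝ) : (((1/2 : ℝ) ^ k) ^ a) * (2 ^ k) ^ j = ((2:ℝ) ^ ((j:ℝ) - a)) ^ k := by
  have h2 : (0:ℝ) < 2 := by norm_num
  rw [← Real.rpow_natCast (2 ^ ((j:ℝ) - a)), ← Real.rpow_mul h2.le, one_div, ← Real.rpow_natCast (2⁻¹), Real.inv_rpow h2.le,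
    ← Real.rpow_neg h2.le, ← Real.rpow_mul h2.le, ← pow_mul, ← Real.rpow_natCast 2, ← Real.rpow_add h2]
  congr 1; push_cast; ring

lemma closure_box_sub {d : ℕ} : closure (Box d) ⊆ {x | ∀ i, |x i| ≤ 1} := by
  refine closure_minimal (fun x hx i => (hx i).le) ?_
  simp only [ofPred_forall]
  exact isClosed_iInter fun i => isClosed_le (by fun_prop) continuous_const

lemma box_open {d : ℕ} : IsOpen (Box d) := by
  unfold Box
  simp only [ofPred_forall]
  exact isOpen_iInter_of_finite fun i => isOpen_lt (by fun_prop) continuous_const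

lemma box_convex {d : ℕ} : Convex ℝ (Box d) := by
  intro x hx y hy a b ha hb hab i
  simp only [PiLp.add_apply, PiLp.smul_apply, smul_eq_mul]
  have h1 := abs_lt.1 (hx i)
  have h2 := abs_lt.1 (hy i)
  rw [abs_lt]
  rcases ha.eq_or_lt with h | h
  · subst h
    have : b = 1 := by linarith
    subst this
    constructor <;> linarith
  · constructor <;> nlinarith

lemma box_ud {d : ℕ} : UniqueDiffOn ℝ (closure (Box d)) := by
  refine uniqueDiffOn_convex box_convex.closure ?_
  refine ⟨0, ?_⟩
  exact interior_mono subset_closure (by rw [box_open.interior_eq]; intro i; simp)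

lemma exists_weight {n : ℕ} {S : Set (Euc n)} (hne : S.Nonempty) {α α' : ℝ} (hα : 0 ≤ α) (hαα : α < α') :
    ∃ a : Euc (n + 1) → ℝ, Continuous a ∧ (∀ x, 0 ≤ a x) ∧ InHolderCls α (closure (Box (n + 1))) a ∧
      (∀ x, a x ≠ 0 → infDist (frontC x) S < |lastC x| ∧ infDist (frontC x) S ≤ 1/3) ∧
      ∀ x, |lastC x| ≤ 1 → infDist (frontC x) S ≤ |lastC x| / 32 → (|lastC x| / 4) ^ α' ≤ a x := by
  obtain ⟨C, hC0, hC⟩ := exists_smooth_nbhd (n + 1)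
  let A : ℕ → Set (Euc (n + 1)) := fun k => {y | 1 ≤ |lastC y| ∧ infDist ((1/2 : ℝ) ^ k • frontC y) S ≤ (1/2) ^ k / 4}
  have hA : ∀ k, MeasurableSet (A k) := fun k => by
    exact (isClosed_le continuous_const lastC_cont.abs).measurableSet.inter
      (isClosed_le ((continuous_infDist_pt S).comp (frontC_cont.const_smul ((1/2:ℝ)^k))) continuous_const).measurableSet
  choose η h1 h2 h3 h4 h5 using fun k => hC (A k) (hA k)
  let f : ℕ → Euc (n + 1) → ℝ := fun k x => ((1/2 : ℝ) ^ k) ^ α' * η k ((2:ℝ) ^ k • x)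
  have hf : ∀ k, ContDiff ℝ (⊤ : ℕ∞) (f k) := fun k => contDiff_const.mul ((h1 k).comp (contDiff_const_smul _))
  have hfb : ∀ j k x, ‖iteratedFDeriv ℝ j (f k) x‖ ≤ C j * ((2:ℝ) ^ ((j:ℝ) - α')) ^ k := by
    intro j k x
    have e1 : iteratedFDeriv ℝ j (f k) x = ((1/2 : ℝ) ^ k) ^ α' • iteratedFDeriv ℝ j (fun x => η k ((2:ℝ) ^ k • x)) x :=
      iteratedFDeriv_const_smul_apply' (a := ((1/2 : ℝ) ^ k) ^ α') (((h1 k).comp (contDiff_const_smul _)).of_le (mod_cast le_top)).contDiffAt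
    rw [e1, iteratedFDeriv_comp_const_smul _ ((h1 k).of_le (mod_cast le_top)), norm_smul, norm_smul, ← geo_aux,
      Real.norm_of_nonneg (by positivity), Real.norm_of_nonneg (by positivity)]
    calc _ ≤ ((1/2 : ℝ) ^ k) ^ α' * (((2:ℝ) ^ k) ^ j * C j) := by
          have := h2 k j ((2:ℝ) ^ k • x)
          gcongr
      _ = _ := by ring
  let m := ⌊α⌋₊
  have hm : (m : ℝ) ≤ α := Nat.floor_le hα
  have hm1 : α < m + 1 := Nat.lt_floor_add_one α
  have hr : ∀ b : ℝ, b < 0 → (2:ℝ) ^ b < 1 := fun b hb => Real.rpow_lt_one_of_one_lt_of_neg (by norm_num) hb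
  have hr0 : ∀ b : ℝ, 0 < (2:ℝ) ^ b := fun b => by positivity
  have hsum : ∀ j : ℕ, (j : ℕ∞) ≤ (m : ℕ∞) → Summable fun k => C j * ((2:ℝ) ^ ((j:ℝ) - α')) ^ k := by
    intro j hj
    have hj : (j:ℝ) ≤ m := by exact_mod_cast hj
    exact (summable_geometric_of_lt_one (hr0 _).le (hr _ (by linarith))).mul_left _
  have hfm : ∀ k, ContDiff ℝ ((m : ℕ∞) : WithTop ℕ∞) (f k) := fun k => (hf k).of_le (mod_cast le_top)
  let a : Euc (n + 1) → ℝ := fun x => ∑' k, f k x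
  have ha : ContDiff ℝ ((m : ℕ∞) : WithTop ℕ∞) a := contDiff_tsum hfm hsum fun j k x _ => hfb j k x
  have hf0 : ∀ k x, 0 ≤ f k x := fun k x => mul_nonneg (by positivity) (h3 k _)
  have hsf : ∀ x, Summable fun k => f k x := fun x => by
    refine Summable.of_norm_bounded (hsum 0 (by simp)) fun k => ?_
    have := hfb 0 k x
    rwa [norm_iteratedFDeriv_zero] at this
  refine ⟨a, ha.continuous, fun x => tsum_nonneg fun k => hf0 k x, ⟨?_, ?_⟩, ?_, ?_⟩
  · exact ha.contDiffOn
  · set β := α - m with hβ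
    have hβ0 : 0 ≤ β := by linarith
    have hβ1 : β < 1 := by linarith
    have hD : ∀ x ∈ closure (Box (n + 1)), iteratedFDerivWithin ℝ m a (closure (Box (n + 1))) x = ∑' k, iteratedFDeriv ℝ m (f k) x := by
      intro x hx
      rw [iteratedFDerivWithin_eq_iteratedFDeriv box_ud ha.contDiffAt hx]
      exact iteratedFDeriv_tsum_apply hfm hsum (fun j k x _ => hfb j k x) le_rfl x
    have hlip : ∀ k x y, ‖iteratedFDeriv ℝ m (f k) x - iteratedFDeriv ℝ m (f k) y‖ ≤ C (m + 1) * ((2:ℝ) ^ (((m + 1 : ℕ):ℝ) - α')) ^ k * ‖x - y‖ := by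
      intro k x y
      refine convex_univ.norm_image_sub_le_of_norm_fderiv_le (𝕜 := ℝ) (fun z _ => ?_) (fun z _ => ?_) (mem_univ y) (mem_univ x)
      · exact ((hf k).differentiable_iteratedFDeriv (m := m) (by exact_mod_cast WithTop.coe_lt_top m)) z
      · rw [norm_fderiv_iteratedFDeriv]; exact hfb (m + 1) k z
    let K : ℝ := (2 * C m) ^ (1 - β) * C (m + 1) ^ β
    have hK0 : 0 ≤ K := by have := hC0 m; have := hC0 (m+1); positivity
    have hk : ∀ k x y, ‖iteratedFDeriv ℝ m (f k) x - iteratedFDeriv ℝ m (f k) y‖ ≤ K * ‖x - y‖ ^ β * ((2:ℝ) ^ (α - α')) ^ k := by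
      intro k x y
      set N := ‖iteratedFDeriv ℝ m (f k) x - iteratedFDeriv ℝ m (f k) y‖
      have b1 : N ≤ 2 * C m * ((2:ℝ) ^ ((m:ℝ) - α')) ^ k := by
        refine (norm_sub_le _ _).trans ?_
        linarith [hfb m k x, hfb m k y]
      have b2 := hlip k x y
      have hN : 0 ≤ N := norm_nonneg _
      have e : N = N ^ (1 - β) * N ^ β := by
        rcases hN.eq_or_lt with h | h
        · rw [← h, Real.zero_rpow (by linarith), zero_mul]
        · rw [← Real.rpow_add h]; simp
      have q1 := Real.rpow_le_rpow hN b1 (show 0 ≤ 1 - β by linarith)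
      have q2 := Real.rpow_le_rpow hN b2 hβ0
      have c1 := hC0 m
      have c2 := hC0 (m + 1)
      have p1 := hr0 ((m:ℝ) - α')
      have p2 := hr0 (((m + 1 : ℕ):ℝ) - α')
      rw [e]
      refine (mul_le_mul q1 q2 (by positivity) (by positivity)).trans (le_of_eq ?_)
      rw [Real.mul_rpow (x := 2 * C m) (by positivity) (by positivity), Real.mul_rpow (x := C (m + 1) * _) (by positivity) (by positivity), Real.mul_rpow (x := C (m + 1)) (by positivity) (by positivity)]
      have e2 : (((2:ℝ) ^ ((m:ℝ) - α')) ^ k) ^ (1 - β) * (((2:ℝ) ^ (((m + 1 : ℕ):ℝ) - α')) ^ k) ^ β = ((2:ℝ) ^ (α - α')) ^ k := by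
        have t2 : (0:ℝ) ≤ 2 := by norm_num
        simp only [← Real.rpow_natCast, ← Real.rpow_mul t2]
        rw [← Real.rpow_add (by norm_num)]
        congr 1
        have : α = m + β := by rw [hβ]; ring
        rw [this]; push_cast; ring
      rw [← e2]; simp only [K]; ring
    have hsg : Summable fun k : ℕ => ((2:ℝ) ^ (α - α')) ^ k := summable_geometric_of_lt_one (hr0 _).le (hr _ (by linarith))
    have hsD : ∀ x, Summable fun k => iteratedFDeriv ℝ m (f k) x := fun x =>
      Summable.of_norm_bounded (hsum m le_rfl) fun k => hfb m k x
    let T := ∑' k : ℕ, ((2:ℝ) ^ (α - α')) ^ k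
    have hT0 : 0 ≤ T := tsum_nonneg fun k => by positivity
    refine ⟨(K * T).toNNReal, fun x hx y hy => ?_⟩
    have main : ‖(∑' k, iteratedFDeriv ℝ m (f k) x) - ∑' k, iteratedFDeriv ℝ m (f k) y‖ ≤ K * T * ‖x - y‖ ^ β := by
      rw [← (hsD x).tsum_sub (hsD y)]
      have := tsum_of_norm_bounded (hsg.mul_left (K * ‖x - y‖ ^ β)).hasSum fun k => hk k x y
      rw [_root_.tsum_mul_left] at this
      refine this.trans (le_of_eq ?_)
      simp only [T]; ring
    change edist (iteratedFDerivWithin ℝ m a (closure (Box (n + 1))) x) (iteratedFDerivWithin ℝ m a (closure (Box (n + 1))) y) ≤ _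
    rw [hD x hx, hD y hy, edist_dist, edist_dist, dist_eq_norm, dist_eq_norm, Real.coe_toNNReal _ hβ0,
      ENNReal.ofReal_rpow_of_nonneg (norm_nonneg _) hβ0]
    change _ ≤ ENNReal.ofReal (K * T) * _
    rw [← ENNReal.ofReal_mul (by positivity)]
    exact ENNReal.ofReal_le_ofReal main
  · intro x hx
    have : ∃ k, f k x ≠ 0 := by
      by_contra hcon
      push Not at hcon
      exact hx (by simp [a, hcon])
    obtain ⟨k, hk⟩ := this
    obtain ⟨y, hyA, hy⟩ := h4 k _ (right_ne_zero_of_mul hk)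
    have hb : (0:ℝ) < (1/2) ^ k := by positivity
    have hb1 : ((1/2:ℝ)) ^ k ≤ 1 := pow_le_one₀ (by norm_num) (by norm_num)
    have hbb : ((1/2:ℝ)) ^ k * 2 ^ k = 1 := by rw [← mul_pow]; norm_num
    have n1 : ‖x - (1/2 : ℝ) ^ k • y‖ ≤ (1/2) ^ k / 16 := by
      have : x - (1/2 : ℝ) ^ k • y = (1/2 : ℝ) ^ k • ((2:ℝ) ^ k • x - y) := by
        rw [smul_sub, smul_smul, hbb, one_smul]
      rw [this, norm_smul, Real.norm_of_nonneg hb.le]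
      nlinarith
    have n2 := (abs_last_le _).trans n1
    have n3 := (norm_front_le _).trans n1
    rw [lastC_sub, lastC_smul] at n2
    rw [frontC_sub, frontC_smul] at n3
    have n4 := infDist_le_infDist_add_dist (s := S) (x := frontC x) (y := (1/2 : ℝ) ^ k • frontC y)
    rw [dist_eq_norm] at n4
    have n5 : (1/2 : ℝ) ^ k ≤ |(1/2 : ℝ) ^ k * lastC y| := by
      rw [abs_mul, abs_of_pos hb]; nlinarith [hyA.1]
    have n6 := abs_sub_abs_le_abs_sub ((1/2 : ℝ) ^ k * lastC y) (lastC x)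
    rw [abs_sub_comm] at n6
    have n7 := hyA.2
    constructor <;> linarith
  · intro x hx1 hx2
    rcases (abs_nonneg (lastC x)).eq_or_lt with h0 | h0
    · rw [← h0, zero_div, Real.zero_rpow (by linarith)]
      exact tsum_nonneg fun k => hf0 k x
    obtain ⟨k, hk1, hk2⟩ := exists_dyadic h0 hx1
    have e2 : (1/2:ℝ) ^ (k+2) = (1/2)^k / 4 := by rw [pow_add]; norm_num; ring
    have e1 : (1/2:ℝ) ^ (k+1) = (1/2)^k / 2 := by rw [pow_add]; norm_num; ring
    have hb : (0:ℝ) < (1/2) ^ (k+2) := by positivity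
    have hbb : ((1/2:ℝ)) ^ (k+2) * 2 ^ (k+2) = 1 := by rw [← mul_pow]; norm_num
    have hone : η (k+2) ((2:ℝ) ^ (k+2) • x) = 1 := by
      refine h5 _ _ fun y hy => ?_
      rw [mem_ball, dist_comm, dist_eq_norm] at hy
      have n1 : ‖x - (1/2 : ℝ) ^ (k+2) • y‖ ≤ (1/2) ^ (k+2) / 16 := by
        have : x - (1/2 : ℝ) ^ (k+2) • y = (1/2 : ℝ) ^ (k+2) • ((2:ℝ) ^ (k+2) • x - y) := by
          rw [smul_sub, smul_smul, hbb, one_smul]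
        rw [this, norm_smul, Real.norm_of_nonneg hb.le]
        nlinarith
      have n2 := (abs_last_le _).trans n1
      have n3 := (norm_front_le _).trans n1
      rw [lastC_sub, lastC_smul] at n2
      rw [frontC_sub, frontC_smul] at n3
      have n4 := infDist_le_infDist_add_dist (s := S) (x := (1/2 : ℝ) ^ (k+2) • frontC y) (y := frontC x)
      rw [dist_comm, dist_eq_norm] at n4
      have n6 := abs_sub_abs_le_abs_sub (lastC x) ((1/2 : ℝ) ^ (k+2) * lastC y)
      rw [abs_mul, abs_of_pos hb] at n6
      refine ⟨?_, ?_⟩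
      · by_contra hcon
        push Not at hcon
        have := mul_lt_mul_of_pos_left hcon hb
        linarith
      · linarith
    have hfk : f (k+2) x = ((1/2 : ℝ) ^ (k+2)) ^ α' := by simp only [f, hone, mul_one]
    calc (|lastC x| / 4) ^ α' ≤ ((1/2 : ℝ) ^ (k+2)) ^ α' := Real.rpow_le_rpow (by positivity) (by linarith) (by linarith)
      _ = f (k+2) x := hfk.symm
      _ ≤ _ := (hsf x).le_tsum (k+2) fun j _ => hf0 j x
end

noncomputable section

lemma euc_sum {d : ℕ} (x : Euc d) : x = ∑ i, x i • (EuclideanSpace.single i (1:ℝ) : Euc d) := by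
  ext j
  simp [Pi.single_apply]

lemma W11On.div_id {d : ℕ} {Ω : Set (Euc d)} {u : Euc d → ℝ} {G : Euc d → Euc d →L[ℝ] ℝ}
    (h : W11On Ω u G) {φ : Euc d → ℝ} (h1 : ContDiff ℝ (⊤ : ℕ∞) φ) (h2 : HasCompactSupport φ)
    (h3 : tsupport φ ⊆ Ω) (x0 : Euc d) :
    ∫ x in Ω, u x * (d * φ x + fderiv ℝ φ x (x - x0)) = -∫ x in Ω, φ x * G x (x - x0) := by
  let e : Fin d → Euc d := fun i => EuclideanSpace.single i (1:ℝ)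
  let φi : Fin d → Euc d → ℝ := fun i x => (x - x0) i * φ x
  have hl : ∀ i, ContDiff ℝ (⊤ : ℕ∞) (fun x : Euc d => (x - x0) i) := fun i => by
    simp only [PiLp.sub_apply]; fun_prop
  have hφi : ∀ i, ContDiff ℝ (⊤ : ℕ∞) (φi i) := fun i => (hl i).mul h1
  have hci : ∀ i, HasCompactSupport (φi i) := fun i => h2.mul_left
  have hsi : ∀ i, tsupport (φi i) ⊆ Ω := fun i => (tsupport_mul_subset_right).trans h3
  have key : ∀ i, ∫ x in Ω, u x * fderiv ℝ (φi i) x (e i) = -∫ x in Ω, φi i x * G x (e i) := fun i =>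
    h.pair (hφi i) (hci i) (hsi i) (e i)
  have hder : ∀ i x, fderiv ℝ (φi i) x (e i) = φ x + (x - x0) i * fderiv ℝ φ x (e i) := by
    intro i x
    have d1 : HasFDerivAt (fun x : Euc d => (x - x0) i) (EuclideanSpace.proj i : Euc d →L[ℝ] ℝ) x := by
      have := (EuclideanSpace.proj i : Euc d →L[ℝ] ℝ).hasFDerivAt (x := x)
      simpa using this.sub_const (x0 i)
    have d2 := (h1.differentiable (by simp) x).hasFDerivAt
    have := d1.mul d2
    rw [show φi i = (fun x : Euc d => (x - x0) i) * φ from rfl, this.fderiv]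
    simp [e]; ring
  have hs := Finset.sum_congr rfl fun i (_ : i ∈ Finset.univ) => key i
  have i1 : ∀ i, IntegrableOn (fun x => u x * fderiv ℝ (φi i) x (e i)) Ω := fun i => by
    have hc : Continuous (fderiv ℝ (φi i)) := (hφi i).continuous_fderiv (by simp)
    exact (ContinuousLinearMap.apply ℝ ℝ (e i)).integrable_comp (test_int1 h.1 hc ((hci i).fderiv ℝ))
  have i2 : ∀ i, IntegrableOn (fun x => φi i x * G x (e i)) Ω := fun i =>
    (ContinuousLinearMap.apply ℝ ℝ (e i)).integrable_comp (test_int2 h.2.1 (hφi i).continuous (hci i))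
  rw [← integral_finsetSum _ fun i _ => i1 i, Finset.sum_neg_distrib, ← integral_finsetSum _ fun i _ => i2 i] at hs
  have e1 : ∀ x, u x * (d * φ x + fderiv ℝ φ x (x - x0)) = ∑ i, u x * fderiv ℝ (φi i) x (e i) := by
    intro x
    rw [← Finset.mul_sum]
    congr 1
    simp only [hder, Finset.sum_add_distrib]
    congr 1
    · simp
    · conv_lhs => rw [euc_sum (x - x0)]
      rw [map_sum]
      refine Finset.sum_congr rfl fun i _ => ?_
      simp only [map_smul, smul_eq_mul, e]
  have e2 : ∀ x, φ x * G x (x - x0) = ∑ i, φi i x * G x (e i) := by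
    intro x
    conv_lhs => rw [euc_sum (x - x0)]
    rw [map_sum, Finset.mul_sum]
    refine Finset.sum_congr rfl fun i _ => ?_
    simp only [map_smul, smul_eq_mul, φi, e]; ring
  simp only [e1, e2]
  exact hs
end

noncomputable section

def Tf (z : ℝ) : ℝ := Real.smoothTransition (2 - z ^ 2)
lemma Tf_smooth : ContDiff ℝ (⊤ : ℕ∞) Tf := Real.smoothTransition.contDiff.comp (by fun_prop)
lemma Tf_one {z : ℝ} (h : |z| ≤ 1) : Tf z = 1 := by
  refine Real.smoothTransition.one_of_one_le ?_
  have := sq_le_one_iff_abs_le_one z |>.2 h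
  linarith
lemma Tf_zero {z : ℝ} (h : 2 ≤ z ^ 2) : Tf z = 0 := Real.smoothTransition.zero_of_nonpos (by linarith)
lemma Tf_neg (z : ℝ) : Tf (-z) = Tf z := by simp [Tf]
lemma Tf'_odd (z : ℝ) : deriv Tf (-z) = - deriv Tf z := by
  have h := deriv_comp_neg Tf (x := z)
  rw [show (fun x => Tf (-x)) = Tf from funext Tf_neg] at h
  linarith
lemma Tf'_cont : Continuous (deriv Tf) := Tf_smooth.continuous_deriv (by simp)
lemma Tf'_zero1 {z : ℝ} (h : |z| < 1) : deriv Tf z = 0 := by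
  have : Tf =ᶠ[𝓝 z] fun _ => 1 := by
    filter_upwards [(isOpen_lt continuous_abs continuous_const).mem_nhds h] with y hy
    exact Tf_one (le_of_lt hy)
  rw [this.deriv_eq, deriv_const]
lemma Tf'_zero2 {z : ℝ} (h : 2 < z ^ 2) : deriv Tf z = 0 := by
  have : Tf =ᶠ[𝓝 z] fun _ => 0 := by
    filter_upwards [(isOpen_lt continuous_const (continuous_pow 2)).mem_nhds h] with y hy
    exact Tf_zero (le_of_lt hy)
  rw [this.deriv_eq, deriv_const]
lemma Tf'_sign (z : ℝ) : z * deriv Tf z ≤ 0 := by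
  have h2 : HasDerivAt Tf (deriv Real.smoothTransition (2 - z^2) * (-(2 * z))) z := by
    have a := ((Real.smoothTransition.contDiff (n := 1)).differentiable (by simp) (2 - z^2)).hasDerivAt
    have b : HasDerivAt (fun z : ℝ => 2 - z^2) (-(2*z)) z := by
      simpa using (hasDerivAt_pow 2 z).const_sub 2
    exact a.comp z b
  have h3 : 0 ≤ deriv Real.smoothTransition (2 - z^2) := Real.smoothTransition.monotone.deriv_nonneg
  rw [h2.deriv]
  nlinarith [mul_nonneg h3 (sq_nonneg z)]
lemma Tf_abs (z : ℝ) : 0 ≤ Tf z ∧ Tf z ≤ 1 := ⟨Real.smoothTransition.nonneg _, Real.smoothTransition.le_one _⟩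

variable {n : ℕ}
def psb (n : ℕ) : ContDiffBump (0 : Euc n) := ⟨1/64, 1/32, by norm_num, by norm_num⟩
def be (y : Euc (n + 1)) : ℝ := lastC y * (|lastC y|⁻¹) ^ (n + 2) * psb n ((lastC y)⁻¹ • frontC y)

lemma be_neg (y : Euc (n + 1)) : be (-y) = - be y := by
  have h1 : lastC (-y) = - lastC y := by simp [lastC]
  have h2 : frontC (-y) = - frontC y := by ext i; simp [frontC]
  unfold be
  rw [h1, h2, abs_neg, inv_neg, smul_neg, neg_smul, neg_neg]; ring
lemma be_smul {s : ℝ} (hs : 0 < s) (y : Euc (n + 1)) : s ^ (n + 1) * be (s • y) = be y := by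
  unfold be
  rw [lastC_smul, frontC_smul, smul_smul, abs_mul, abs_of_pos hs, mul_inv, mul_inv, mul_pow]
  rw [show s⁻¹ * (lastC y)⁻¹ * s = (lastC y)⁻¹ by field_simp]
  have : s ^ (n+1) * s * (s⁻¹) ^ (n+2) = 1 := by
    rw [← pow_succ, ← mul_pow, mul_inv_cancel₀ hs.ne', one_pow]
  linear_combination (lastC y * |lastC y|⁻¹ ^ (n + 2) * psb n ((lastC y)⁻¹ • frontC y)) * this
lemma be_supp {y : Euc (n + 1)} (h : be y ≠ 0) : ‖frontC y‖ < |lastC y| / 32 := by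
  have hz : lastC y ≠ 0 := fun h0 => h (by simp [be, h0])
  have : psb n ((lastC y)⁻¹ • frontC y) ≠ 0 := right_ne_zero_of_mul h
  have h2 : (lastC y)⁻¹ • frontC y ∈ Function.support (psb n) := this
  rw [(psb n).support_eq, mem_ball_zero_iff, norm_smul, norm_inv, Real.norm_eq_abs] at h2
  have h3 : |lastC y|⁻¹ * ‖frontC y‖ < 1 / 32 := h2
  have h4 := abs_pos.2 hz
  rw [inv_mul_lt_iff₀ h4] at h3
  linarith
lemma be_abs_eq (y : Euc (n + 1)) : SignType.sign (lastC y) * be y = |lastC y| * (|lastC y|⁻¹) ^ (n + 2) * psb n ((lastC y)⁻¹ • frontC y) := by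
  unfold be
  rw [← mul_assoc, ← mul_assoc, sign_mul_self]
lemma be_abs (y : Euc (n + 1)) : |be y| ≤ (|lastC y|⁻¹) ^ (n + 1) := by
  unfold be
  rw [abs_mul, abs_mul, abs_of_nonneg (psb n).nonneg, abs_of_nonneg (by positivity : 0 ≤ (|lastC y|⁻¹) ^ (n + 2))]
  by_cases hz : lastC y = 0
  · simp [hz]
  have h4 := abs_pos.2 hz
  calc _ ≤ |lastC y| * |lastC y|⁻¹ ^ (n + 2) * 1 := by gcongr; exact (psb n).le_one
    _ = _ := by rw [pow_succ]; field_simp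
lemma be_smooth {y : Euc (n + 1)} (h : lastC y ≠ 0) : ContDiffAt ℝ (⊤ : ℕ∞) be y := by
  have h1 : ContDiffAt ℝ (⊤ : ℕ∞) (lastC (n := n)) y := by unfold lastC; fun_prop
  have h2 : ContDiffAt ℝ (⊤ : ℕ∞) (frontC (n := n)) y := by
    rw [contDiffAt_euclidean]; intro i; simp only [frontC]; fun_prop
  unfold be
  refine (h1.mul ((h1.abs h).inv (abs_ne_zero.2 h) |>.pow _)).mul ?_
  exact (psb n).contDiff.contDiffAt.comp y ((h1.inv h).smul h2)

def Mf (y : Euc (n + 1)) : ℝ := be y * (lastC y * deriv Tf (lastC y))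
def Ff (r : ℝ) (y : Euc (n + 1)) : ℝ := (Tf (lastC y) - Tf (r⁻¹ * lastC y)) * be y

lemma Ff_zero {r : ℝ} (hr : 0 < r) (hr1 : r ≤ 1) {y : Euc (n + 1)} (h : |lastC y| ≤ r) : Ff r y = 0 := by
  unfold Ff
  rw [Tf_one (h.trans hr1), Tf_one, sub_self, zero_mul]
  rw [abs_mul, abs_inv, abs_of_pos hr, inv_mul_le_iff₀ hr]; linarith
lemma Ff_zero2 {r : ℝ} (hr : 0 < r) (hr1 : r ≤ 1) {y : Euc (n + 1)} (h : 2 ≤ lastC y ^ 2) : Ff r y = 0 := by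
  unfold Ff
  rw [Tf_zero h, Tf_zero, sub_self, zero_mul]
  have : 1 ≤ (r⁻¹) ^ 2 := one_le_pow₀ (one_le_inv₀ hr |>.2 hr1)
  rw [mul_pow]; nlinarith
lemma Ff_supp {r : ℝ} (hr : 0 < r) (hr1 : r ≤ 1) {y : Euc (n + 1)} (h : Ff r y ≠ 0) :
    ‖frontC y‖ ≤ |lastC y| / 32 ∧ |lastC y| ≤ 3/2 ∧ 0 < |lastC y| := by
  refine ⟨(be_supp (right_ne_zero_of_mul h)).le, ?_, ?_⟩
  · by_contra! h2
    exact h (Ff_zero2 hr hr1 (by rw [← sq_abs]; nlinarith))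
  · by_contra! h2
    exact h (Ff_zero hr hr1 (h2.trans hr.le))
lemma Ff_abs {r : ℝ} (y : Euc (n + 1)) : |Ff r y| ≤ (|lastC y|⁻¹) ^ (n + 1) := by
  unfold Ff
  rw [abs_mul]
  have h1 : |Tf (lastC y) - Tf (r⁻¹ * lastC y)| ≤ 1 := by
    have := Tf_abs (lastC y); have := Tf_abs (r⁻¹ * lastC y)
    rw [abs_le]; constructor <;> linarith
  calc _ ≤ 1 * |be y| := by gcongr
    _ ≤ _ := by rw [one_mul]; exact be_abs y
lemma Ff_smooth {r : ℝ} (hr : 0 < r) (hr1 : r ≤ 1) : ContDiff ℝ (⊤ : ℕ∞) (Ff (n := n) r) := by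
  rw [contDiff_iff_contDiffAt]
  intro y
  by_cases hz : lastC y = 0
  · have : Ff r =ᶠ[𝓝 y] fun _ => 0 := by
      filter_upwards [(isOpen_lt (continuous_abs.comp lastC_cont) continuous_const).mem_nhds
        (show |lastC y| < r by simpa [hz] using hr)] with x hx
      exact Ff_zero hr hr1 (le_of_lt hx)
    exact contDiffAt_const.congr_of_eventuallyEq this
  · have h1 : ContDiffAt ℝ (⊤ : ℕ∞) (lastC (n := n)) y := by unfold lastC; fun_prop
    exact ((Tf_smooth.contDiffAt.comp y h1).sub (Tf_smooth.contDiffAt.comp y (contDiffAt_const.mul h1))).mul (be_smooth hz)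
lemma Ff_tsupp {r : ℝ} (hr : 0 < r) (hr1 : r ≤ 1) : tsupport (Ff (n := n) r) ⊆ closedBall 0 2 := by
  refine closure_minimal (fun y hy => ?_) isClosed_closedBall
  obtain ⟨h1, h2, h3⟩ := Ff_supp hr hr1 hy
  rw [mem_closedBall_zero_iff]
  exact (norm_le_split y).trans (by linarith)
lemma Mf_supp {y : Euc (n + 1)} (h : Mf y ≠ 0) : ‖frontC y‖ ≤ |lastC y| / 32 ∧ |lastC y| ≤ 3/2 ∧ 1 ≤ |lastC y| := by
  have hd : deriv Tf (lastC y) ≠ 0 := right_ne_zero_of_mul (right_ne_zero_of_mul h)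
  refine ⟨(be_supp (left_ne_zero_of_mul h)).le, ?_, ?_⟩
  · by_contra! h2
    exact hd (Tf'_zero2 (by rw [← sq_abs]; nlinarith))
  · by_contra! h2
    exact hd (Tf'_zero1 h2)
lemma Mf_norm {y : Euc (n + 1)} (h : Mf y ≠ 0) : ‖y‖ ≤ 2 := by
  obtain ⟨h1, h2, h3⟩ := Mf_supp h
  exact (norm_le_split y).trans (by linarith)
lemma Mf_cont : Continuous (Mf (n := n)) := by
  rw [continuous_iff_continuousAt]
  intro y
  by_cases hz : lastC y = 0
  · have : Mf =ᶠ[𝓝 y] fun _ => 0 := by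
      filter_upwards [(isOpen_lt (continuous_abs.comp lastC_cont) continuous_const).mem_nhds
        (show |lastC y| < 1 by simp [hz])] with x hx
      by_contra h0
      exact absurd (Mf_supp h0).2.2 (not_le.2 hx)
    exact continuousAt_const.congr this.symm
  · exact (be_smooth hz).continuousAt.mul (lastC_cont.mul (Tf'_cont.comp lastC_cont)).continuousAt
lemma Mf_csupp : HasCompactSupport (Mf (n := n)) := by
  refine HasCompactSupport.of_support_subset_isCompact (isCompact_closedBall 0 2) fun y hy => ?_
  rw [mem_closedBall_zero_iff]; exact Mf_norm hy
lemma Mf_neg (y : Euc (n + 1)) : Mf (-y) = - Mf y := by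
  have h1 : lastC (-y) = - lastC y := by simp [lastC]
  unfold Mf; rw [be_neg, h1, Tf'_odd]; ring
lemma Mf_int : ∫ y : Euc (n + 1), Mf y = 0 := by
  have := integral_neg_eq_self (fun y : Euc (n + 1) => Mf y) volume
  simp only [Mf_neg, integral_neg] at this
  linarith
def c1 (n : ℕ) : ℝ := ∫ y : Euc (n + 1), -(SignType.sign (lastC y) * Mf y)
lemma c1_pos : 0 < c1 n := by
  have hg : ∀ y : Euc (n + 1), -(SignType.sign (lastC y) * Mf y) =
      (SignType.sign (lastC y) * be y) * (-(lastC y * deriv Tf (lastC y))) := fun y => by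
    unfold Mf; ring
  have hnn : ∀ y : Euc (n + 1), 0 ≤ -(SignType.sign (lastC y) * Mf y) := fun y => by
    rw [hg, be_abs_eq]
    exact mul_nonneg (mul_nonneg (by positivity) (psb n).nonneg) (by linarith [Tf'_sign (lastC y)])
  obtain ⟨z, hz, hz2⟩ := exists_deriv_eq_slope Tf (show (1:ℝ) < 2 by norm_num)
    Tf_smooth.continuous.continuousOn (Tf_smooth.differentiable (by simp)).differentiableOn
  rw [Tf_one (z := 1) (by simp), Tf_zero (z := 2) (by norm_num)] at hz2
  have hz0 : 0 < z := by linarith [hz.1]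
  refine Continuous.integral_pos_of_hasCompactSupport_nonneg_nonzero (x := snocC 0 z) ?_ ?_ hnn ?_
  · rw [continuous_iff_continuousAt]
    intro y
    by_cases hz : lastC y = 0
    · have : (fun y : Euc (n + 1) => -(SignType.sign (lastC y) * Mf y)) =ᶠ[𝓝 y] fun _ => 0 := by
        filter_upwards [(isOpen_lt (continuous_abs.comp lastC_cont) continuous_const).mem_nhds
          (show |lastC y| < 1 by simp [hz])] with x hx
        have : Mf x = 0 := by
          by_contra h0
          exact absurd (Mf_supp h0).2.2 (not_le.2 hx)
        simp [this]
      exact continuousAt_const.congr this.symm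
    · have he : (fun y : Euc (n + 1) => -(lastC y * |lastC y|⁻¹ * Mf y)) =ᶠ[𝓝 y] (fun y : Euc (n + 1) => -(SignType.sign (lastC y) * Mf y)) := by
        filter_upwards [(isOpen_ne_fun lastC_cont continuous_const).mem_nhds hz] with x hx
        have : lastC x * |lastC x|⁻¹ = SignType.sign (lastC x) := by
          rw [mul_inv_eq_iff_eq_mul₀ (abs_ne_zero.2 hx), sign_mul_abs]
        rw [this]
      refine ContinuousAt.congr ?_ he
      exact ((lastC_cont.continuousAt.mul ((continuous_abs.comp lastC_cont).continuousAt.inv₀ (abs_ne_zero.2 hz))).mul Mf_cont.continuousAt).neg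
  · exact (Mf_csupp.mul_left).neg
  · rw [hg, be_abs_eq, lastC_snoc, frontC_snoc, hz2, smul_zero, (psb n).one_of_mem_closedBall (mem_closedBall_self (psb n).rIn_pos.le)]
    have := abs_pos.2 hz0.ne'
    refine mul_ne_zero (by positivity) ?_
    norm_num; exact hz0.ne'

lemma Ff_euler {r : ℝ} (hr : 0 < r) (hr1 : r ≤ 1) (y : Euc (n + 1)) :
    ((n + 1 : ℕ) : ℝ) * Ff r y + fderiv ℝ (Ff r) y y = Mf y - (r⁻¹) ^ (n + 1) * Mf (r⁻¹ • y) := by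
  have h1 : HasDerivAt (fun s : ℝ => s ^ (n + 1) * Ff r (s • y)) (((n + 1 : ℕ) : ℝ) * Ff r y + fderiv ℝ (Ff r) y y) 1 := by
    have a := hasDerivAt_pow (n + 1) (1 : ℝ)
    have b : HasDerivAt (fun s : ℝ => Ff r (s • y)) (fderiv ℝ (Ff r) y y) 1 := by
      have c : HasDerivAt (fun s : ℝ => s • y) y 1 := by simpa using (hasDerivAt_id (1:ℝ)).smul_const y
      have d := ((Ff_smooth hr hr1 (n := n)).differentiable (by simp) ((1:ℝ) • y)).hasFDerivAt
      have := d.comp_hasDerivAt (1:ℝ) c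
      rw [one_smul] at this
      exact this
    have := a.mul b
    simp only [one_pow, mul_one, one_mul, one_smul] at this
    exact this
  have h2 : HasDerivAt (fun s : ℝ => (Tf (s * lastC y) - Tf (s * (r⁻¹ * lastC y))) * be y)
      ((deriv Tf (lastC y) * lastC y - deriv Tf (r⁻¹ * lastC y) * (r⁻¹ * lastC y)) * be y) 1 := by
    have T : ∀ c : ℝ, HasDerivAt (fun s : ℝ => Tf (s * c)) (deriv Tf c * c) 1 := fun c => by
      have a : HasDerivAt Tf (deriv Tf c) (1 * c) := by
        rw [one_mul]; exact (Tf_smooth.differentiable (by simp) c).hasDerivAt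
      have b : HasDerivAt (fun s : ℝ => s * c) c 1 := by simpa using (hasDerivAt_id (1:ℝ)).mul_const c
      exact HasDerivAt.comp (h₂ := Tf) (h := fun s : ℝ => s * c) (1:ℝ) a b
    exact ((T _).sub (T _)).mul_const _
  have h3 : (fun s : ℝ => s ^ (n + 1) * Ff r (s • y)) =ᶠ[𝓝 1] (fun s : ℝ => (Tf (s * lastC y) - Tf (s * (r⁻¹ * lastC y))) * be y) := by
    filter_upwards [lt_mem_nhds (show (0:ℝ) < 1 by norm_num)] with s hs
    unfold Ff
    rw [lastC_smul, ← be_smul hs y, show r⁻¹ * (s * lastC y) = s * (r⁻¹ * lastC y) by ring]; ring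
  have h4 := h1.unique (h2.congr_of_eventuallyEq h3)
  rw [h4]; unfold Mf
  rw [← be_smul (inv_pos.2 hr) y, lastC_smul]; ring
end

noncomputable section
variable {n : ℕ}
open Classical in
def Kc (xb : Euc n) (x : Euc (n + 1)) : ℝ := if ‖frontC x - xb‖ ≤ |lastC x| / 32 then 2 * (|lastC x|⁻¹) ^ n else 0

lemma cone_est {v : Euc (n + 1) → ℝ} {Gv : Euc (n + 1) → Euc (n + 1) →L[ℝ] ℝ} {R t : ℝ} {x0 : Euc (n + 1)}
    (h : W11On (ball 0 R) v Gv) (hB : closedBall x0 3 ⊆ ball 0 R) (hz : lastC x0 = 0)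
    (hv : ∀ x ∈ ball (0 : Euc (n + 1)) R, 1 ≤ |lastC x| → v x = t * SignType.sign (lastC x))
    (hL : ¬ IsNonLebesguePoint v x0) :
    ENNReal.ofReal (t * c1 n) ≤ ∫⁻ x in ball 0 R, ENNReal.ofReal (Kc (frontC x0) x * ‖Gv x‖) := by
  unfold IsNonLebesguePoint at hL
  push Not at hL
  obtain ⟨c, hc⟩ := hL
  obtain ⟨C, hC⟩ := (Mf_csupp (n := n)).exists_bound_of_continuous Mf_cont
  have hC0 : 0 ≤ C := (norm_nonneg _).trans (hC 0)
  have hlz : ∀ x, lastC (x - x0) = lastC x := fun x => by rw [lastC_sub, hz, sub_zero]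
  set I := ∫⁻ x in ball 0 R, ENNReal.ofReal (Kc (frontC x0) x * ‖Gv x‖)
  let V : ℝ := volume.real (ball (0 : Euc (n + 1)) 1)
  have hmain : ∀ r : ℝ, 0 < r → r ≤ 1 → ENNReal.ofReal (t * c1 n) ≤
      ENNReal.ofReal (C * 3 ^ (n + 1) * V * ⨍ y in ball x0 (3 * r), |v y - c| ∂volume) + I := by
    intro r hr hr1
    have hri := inv_pos.2 hr
    let φ : Euc (n + 1) → ℝ := fun x => Ff r (x - x0)
    have hts : tsupport φ ⊆ closedBall x0 2 := by
      refine closure_minimal (fun y hy => ?_) isClosed_closedBall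
      have := Ff_tsupp hr hr1 (subset_tsupport _ hy)
      rw [mem_closedBall_zero_iff] at this
      rw [mem_closedBall, dist_eq_norm]; exact this
    have hφ : ContDiff ℝ (⊤ : ℕ∞) φ := (Ff_smooth hr hr1).comp (contDiff_id.sub contDiff_const)
    have hcs : HasCompactSupport φ := HasCompactSupport.of_support_subset_isCompact (isCompact_closedBall x0 2) ((subset_tsupport _).trans hts)
    have hsub : tsupport φ ⊆ ball 0 R := (hts.trans (closedBall_subset_closedBall (by norm_num))).trans hB
    have hid := h.div_id hφ hcs hsub x0
    let m : Euc (n + 1) → ℝ := fun x => (r⁻¹) ^ (n + 1) * Mf (r⁻¹ • (x - x0))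
    have e1 : ∀ x, ((n + 1 : ℕ) : ℝ) * φ x + fderiv ℝ φ x (x - x0) = Mf (x - x0) - m x := fun x => by
      simp only [φ]
      rw [fderiv_comp_sub, Ff_euler hr hr1]
    simp only [e1, mul_sub] at hid
    have mc : Continuous m := continuous_const.mul (Mf_cont.comp (by fun_prop))
    have Mc : Continuous fun x : Euc (n + 1) => Mf (x - x0) := Mf_cont.comp (by fun_prop)
    have mb : ∀ x, ‖m x‖ ≤ (r⁻¹) ^ (n + 1) * C := fun x => by
      simp only [m]; rw [norm_mul, Real.norm_of_nonneg (by positivity)]; gcongr; exact hC _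
    have m0 : ∀ x, m x ≠ 0 → x ∈ ball x0 (3 * r) := fun x hx => by
      have := Mf_norm (right_ne_zero_of_mul hx)
      rw [norm_smul, norm_inv, Real.norm_of_nonneg hr.le, inv_mul_le_iff₀ hr] at this
      rw [mem_ball, dist_eq_norm]; linarith
    have hB3 : ball x0 (3 * r) ⊆ ball 0 R :=
      (ball_subset_closedBall.trans (closedBall_subset_closedBall (by linarith))).trans hB
    have i1 : IntegrableOn (fun x => v x * Mf (x - x0)) (ball 0 R) :=
      Integrable.mul_bdd (c := C) h.1 Mc.aestronglyMeasurable (ae_of_all _ fun x => hC _)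
    have i2 : IntegrableOn (fun x => v x * m x) (ball 0 R) :=
      Integrable.mul_bdd h.1 mc.aestronglyMeasurable (ae_of_all _ mb)
    have i3 : IntegrableOn (fun _ : Euc (n + 1) => c) (ball 0 R) := integrableOn_const (measure_ball_lt_top.ne)
    have i4 : IntegrableOn (fun x => c * m x) (ball 0 R) :=
      Integrable.mul_bdd i3 mc.aestronglyMeasurable (ae_of_all _ mb)
    rw [integral_sub i1 i2] at hid
    have f1 : ∫ x in ball 0 R, v x * Mf (x - x0) = -(t * c1 n) := by
      have a : ∀ x ∈ ball (0 : Euc (n + 1)) R, v x * Mf (x - x0) = t * (SignType.sign (lastC (x - x0)) * Mf (x - x0)) := by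
        intro x hx
        by_cases h0 : Mf (x - x0) = 0
        · simp [h0]
        · have := (Mf_supp h0).2.2
          rw [hlz] at this
          rw [hv x hx this, hlz]; ring
      rw [setIntegral_congr_fun measurableSet_ball a, integral_const_mul,
        setIntegral_eq_integral_of_forall_compl_eq_zero, integral_sub_right_eq_self (fun x : Euc (n + 1) => (SignType.sign (lastC x) : ℝ) * Mf x)]
      · unfold c1; rw [integral_neg]; ring
      · intro x hx
        have : Mf (x - x0) = 0 := by
          by_contra h0
          refine hx (hB ?_)
          rw [mem_closedBall, dist_eq_norm]; linarith [Mf_norm h0]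
        rw [this, mul_zero]
    have f2 : ∫ x in ball 0 R, c * m x = 0 := by
      rw [setIntegral_eq_integral_of_forall_compl_eq_zero]
      · simp only [m]
        rw [integral_const_mul, integral_const_mul, integral_sub_right_eq_self (fun x : Euc (n + 1) => Mf (r⁻¹ • x)),
          Measure.integral_comp_smul, Mf_int]; simp
      · intro x hx
        have : m x = 0 := by
          by_contra h0; exact hx (hB3 (m0 x h0))
        rw [this, mul_zero]
    have f3 : |∫ x in ball 0 R, v x * m x| ≤ C * 3 ^ (n + 1) * V * ⨍ y in ball x0 (3 * r), |v y - c| ∂volume := by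
      have a : ∫ x in ball 0 R, v x * m x = ∫ x in ball x0 (3 * r), (v x - c) * m x := by
        have b : ∫ x in ball 0 R, v x * m x = ∫ x in ball 0 R, (v x - c) * m x := by
          simp only [sub_mul]; rw [integral_sub i2 i4, f2, sub_zero]
        rw [b]
        refine setIntegral_eq_of_subset_of_forall_sdiff_eq_zero measurableSet_ball hB3 fun x hx => ?_
        have : m x = 0 := by
          by_contra h0; exact hx.2 (m0 x h0)
        rw [this, mul_zero]
      have i5 : IntegrableOn (fun x => |v x - c|) (ball x0 (3 * r)) := by
        have : IntegrableOn (fun x => |v x - c|) (ball 0 R) := (Integrable.sub h.1 i3).abs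
        exact this.mono_set hB3
      have vol : volume.real (ball x0 (3 * r)) = (3 * r) ^ (n + 1) * V := by
        unfold Measure.real
        rw [Measure.addHaar_ball volume x0 (by positivity), ENNReal.toReal_mul, ENNReal.toReal_ofReal (by positivity)]
        simp [V, Measure.real]
      have Vp : 0 < V := by
        refine ENNReal.toReal_pos (measure_ball_pos _ _ one_pos).ne' measure_ball_lt_top.ne
      rw [a, ← Real.norm_eq_abs]
      calc _ ≤ ∫ x in ball x0 (3 * r), |v x - c| * ((r⁻¹) ^ (n + 1) * C) := by
            refine norm_integral_le_of_norm_le (i5.mul_const _) (ae_of_all _ fun x => ?_)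
            rw [norm_mul, Real.norm_eq_abs]
            gcongr; exact mb x
        _ = _ := by
            rw [integral_mul_const, setAverage_eq, vol, smul_eq_mul]
            rw [mul_pow, inv_pow]
            field_simp
    have f4 : ENNReal.ofReal |∫ x in ball 0 R, φ x * Gv x (x - x0)| ≤ I := by
      rw [← Real.norm_eq_abs, ofReal_norm]
      refine (enorm_integral_le_lintegral_enorm _).trans (lintegral_mono fun x => ?_)
      rw [← ofReal_norm]
      refine ENNReal.ofReal_le_ofReal ?_
      by_cases h0 : φ x = 0
      · rw [h0, zero_mul, norm_zero]
        refine mul_nonneg ?_ (norm_nonneg _)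
        unfold Kc; split_ifs <;> positivity
      obtain ⟨s1, s2, s3⟩ := Ff_supp hr hr1 h0
      have s4 := norm_le_split (x - x0)
      rw [frontC_sub] at s1 s4
      rw [hlz] at s1 s2 s3 s4
      have s5 := Ff_abs (r := r) (x - x0)
      rw [hlz] at s5
      unfold Kc
      rw [if_pos s1, norm_mul]
      calc ‖φ x‖ * ‖Gv x (x - x0)‖ ≤ (|lastC x|⁻¹) ^ (n + 1) * (‖Gv x‖ * (2 * |lastC x|)) := by
            gcongr
            · exact s5
            · refine (ContinuousLinearMap.le_opNorm _ _).trans ?_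
              gcongr; linarith
        _ = _ := by rw [pow_succ]; field_simp
    rw [f1] at hid
    have : t * c1 n ≤ |∫ x in ball 0 R, v x * m x| + |∫ x in ball 0 R, φ x * Gv x (x - x0)| := by
      have a1 := neg_abs_le (∫ x in ball 0 R, v x * m x)
      have a2 := le_abs_self (∫ x in ball 0 R, φ x * Gv x (x - x0))
      linarith
    refine (ENNReal.ofReal_le_ofReal this).trans ?_
    rw [ENNReal.ofReal_add (abs_nonneg _) (abs_nonneg _)]
    exact add_le_add (ENNReal.ofReal_le_ofReal f3) f4
  have hlim : Tendsto (fun r : ℝ => ENNReal.ofReal (C * 3 ^ (n + 1) * V * ⨍ y in ball x0 (3 * r), |v y - c| ∂volume) + I) (𝓝[>] 0) (𝓝 (ENNReal.ofReal 0 + I)) := by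
    refine Tendsto.add (ENNReal.tendsto_ofReal ?_) tendsto_const_nhds
    have h3 : Tendsto (fun r : ℝ => 3 * r) (𝓝[>] 0) (𝓝[>] 0) := by
      refine tendsto_nhdsWithin_iff.2 ⟨?_, ?_⟩
      · have : Tendsto (fun r : ℝ => 3 * r) (𝓝 0) (𝓝 (3 * 0)) := (continuous_const.mul continuous_id).tendsto 0
        rw [mul_zero] at this
        exact this.mono_left nhdsWithin_le_nhds
      · filter_upwards [self_mem_nhdsWithin] with r hr
        have : (0:ℝ) < r := hr
        simpa using this
    have := (hc.comp h3).const_mul (C * 3 ^ (n + 1) * V)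
    rw [mul_zero] at this
    exact this
  rw [ENNReal.ofReal_zero, zero_add] at hlim
  refine ge_of_tendsto hlim ?_
  filter_upwards [self_mem_nhdsWithin, nhdsWithin_le_nhds (Iic_mem_nhds (show (0:ℝ) < 1 by norm_num))] with r hr hr1
  exact hmain r hr hr1
end

noncomputable section
variable {n : ℕ}

def Cset (n : ℕ) : Set (Euc (n + 1) × Euc n) := {w | ‖frontC w.1 - w.2‖ ≤ |lastC w.1| / 32}
lemma Cset_closed : IsClosed (Cset n) := by
  have := frontC_cont (n := n); have := lastC_cont (n := n)
  exact isClosed_le (by fun_prop) (by fun_prop)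

lemma frac_bound (hn : 1 ≤ n) {s0 s α' q : ℝ} {ν : Measure (Euc n)} {S : Set (Euc n)} (hF : FracData n s0 ν S)
    (hs : 0 < s) (hs0 : s < s0) (hq : 1 < q) (hα' : 0 ≤ α') (hexp : n - s + α' < q - 1) :
    ∃ C : ℝ≥0∞, C ≠ ⊤ ∧ ∀ (a : Euc (n + 1) → ℝ) (G : Euc (n + 1) → Euc (n + 1) →L[ℝ] ℝ),
      Continuous a → (∀ x, 0 ≤ a x) →
      (∀ x, |lastC x| ≤ 1 → infDist (frontC x) S ≤ |lastC x| / 32 → (|lastC x| / 4) ^ α' ≤ a x) →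
      AEStronglyMeasurable G (volume.restrict (Box (n + 1))) →
      ∫⁻ xb, (∫⁻ x in Box (n + 1), ENNReal.ofReal (Kc xb x * ‖G x‖)) ∂ν ≤
        C * (∫⁻ x in Box (n + 1), ENNReal.ofReal (a x * ‖G x‖ ^ q)) ^ (1 / q) := by
  have := hF.prob
  obtain ⟨K, hK⟩ := hF.frost s hs hs0
  have hq0 : 0 < q := by linarith
  set q' := q / (q - 1) with hq'
  have hqq : q.HolderConjugate q' := Real.HolderConjugate.conjExponent hq
  have hq'0 : 0 < q' := hqq.symm.pos
  set b := s / q - n - α' / q with hb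
  set Cg : ℝ := 2 * 4 ^ (α' / q) with hCg
  have hCg0 : 0 ≤ Cg := by positivity
  let g : Euc (n + 1) × Euc n → ℝ≥0∞ := (Cset n).indicator fun w => ENNReal.ofReal (Cg * |lastC w.1| ^ b)
  have hlm := (lastC_cont (n := n)).measurable
  have hfm := (frontC_cont (n := n)).measurable
  have hgm : Measurable g := by
    refine Measurable.indicator ?_ Cset_closed.measurableSet
    fun_prop
  -- second factor
  have hB : ∫⁻ w, g w ^ q' ∂((volume.restrict (Box (n + 1))).prod ν) < ⊤ := by
    rw [lintegral_prod_symm _ (hgm.pow_const q').aemeasurable]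
    have he : -1 < b * q' + n := by
      have h1 : 0 < q - 1 := by linarith
      have : b * q' + n = (s - n - α') / (q - 1) := by rw [hb, hq']; field_simp; ring
      rw [this, lt_div_iff₀ h1]; linarith
    let V := volume (ball (0 : Euc n) 1)
    set Cc : ℝ := Cg ^ q'
    have key : ∀ xb : Euc n, ∫⁻ x in Box (n + 1), g (x, xb) ^ q' ≤
        ENNReal.ofReal (Cc * (1/32) ^ n) * V * ∫⁻ z in Icc (-1:ℝ) 1, ENNReal.ofReal (|z| ^ (b * q' + n)) := by
      intro xb
      let A : Set (Euc n × ℝ) := {w | ‖w.1 - xb‖ ≤ |w.2| / 32 ∧ |w.2| ≤ 1}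
      have c1 : IsClosed {w : Euc n × ℝ | ‖w.1 - xb‖ ≤ |w.2| / 32} := isClosed_le (by fun_prop) (by fun_prop)
      have c2 : IsClosed {w : Euc n × ℝ | |w.2| ≤ 1} := isClosed_le (by fun_prop) (by fun_prop)
      have hA : MeasurableSet A := (c1.inter c2).measurableSet
      let F : Euc n × ℝ → ℝ≥0∞ := A.indicator fun w => ENNReal.ofReal (Cc * |w.2| ^ (b * q'))
      have hF : Measurable F := by
        refine Measurable.indicator ?_ hA
        fun_prop
      have h1 : ∫⁻ x in Box (n + 1), g (x, xb) ^ q' ≤ ∫⁻ x, F (frontC x, lastC x) := by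
        refine (setLIntegral_mono' box_open.measurableSet fun x hx => ?_).trans (setLIntegral_le_lintegral _ _)
        by_cases hc : (x, xb) ∈ Cset n
        · have : (frontC x, lastC x) ∈ A := ⟨hc, (hx (Fin.last n)).le⟩
          simp only [F, g]
          rw [indicator_of_mem hc, indicator_of_mem this, ENNReal.ofReal_rpow_of_nonneg (by positivity) hq'0.le,
            Real.mul_rpow hCg0 (by positivity), ← Real.rpow_mul (abs_nonneg _)]
        · simp only [g]; rw [indicator_of_notMem hc, ENNReal.zero_rpow_of_pos hq'0]; exact zero_le
      refine h1.trans ?_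
      rw [lint_split hF, lintegral_lintegral_swap (f := fun y z => F (y, z)) hF.aemeasurable]
      rw [← lintegral_const_mul' _ _ (ENNReal.mul_ne_top ENNReal.ofReal_ne_top measure_ball_lt_top.ne), ← lintegral_indicator measurableSet_Icc]
      refine lintegral_mono_ae ?_
      have hz0 : ∀ᵐ z : ℝ, z ≠ 0 := by simp [ae_iff, measure_singleton]
      filter_upwards [hz0] with z hz0
      by_cases hz : |z| ≤ 1
      · rw [indicator_of_mem (show z ∈ Icc (-1:ℝ) 1 from abs_le.1 hz)]
        have : ∀ y, F (y, z) = (closedBall xb (|z| / 32)).indicator (fun _ => ENNReal.ofReal (Cc * |z| ^ (b * q'))) y := by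
          intro y
          by_cases hy : y ∈ closedBall xb (|z| / 32)
          · rw [indicator_of_mem hy]
            rw [mem_closedBall, dist_eq_norm] at hy
            simp only [F]
            rw [indicator_of_mem (show (y, z) ∈ A from ⟨hy, hz⟩)]
          · rw [indicator_of_notMem hy]
            rw [mem_closedBall, dist_eq_norm] at hy
            simp only [F]
            rw [indicator_of_notMem (fun h : (y, z) ∈ A => hy h.1)]
        simp only [this]
        rw [lintegral_indicator_const measurableSet_closedBall, Measure.addHaar_closedBall _ _ (by positivity),
          finrank_euclideanSpace_fin]
        have az := abs_pos.2 hz0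
        have e1 : ENNReal.ofReal (Cc * |z| ^ (b * q')) * (ENNReal.ofReal ((|z| / 32) ^ n)) = ENNReal.ofReal (Cc * (1/32) ^ n) * ENNReal.ofReal (|z| ^ (b * q' + n)) := by
          rw [← ENNReal.ofReal_mul (by positivity), ← ENNReal.ofReal_mul (by positivity), Real.rpow_add az, Real.rpow_natCast]
          congr 1; rw [div_pow, div_pow, one_pow]; ring
        rw [← mul_assoc, e1]; apply le_of_eq; ring
      · have : ∀ y, F (y, z) = 0 := fun y => indicator_of_notMem (fun h : (y, z) ∈ A => hz h.2) _
        simp only [this, lintegral_zero]; exact zero_le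
    refine (lintegral_mono key).trans_lt ?_
    rw [lintegral_const, measure_univ, mul_one]
    exact ENNReal.mul_lt_top (ENNReal.mul_lt_top ENNReal.ofReal_lt_top measure_ball_lt_top) (pow_lint_fin he (by norm_num))
  refine ⟨(K : ℝ≥0∞) ^ (1 / q) * (∫⁻ w, g w ^ q' ∂((volume.restrict (Box (n + 1))).prod ν)) ^ (1 / q'), ?_, ?_⟩
  · exact ENNReal.mul_ne_top (ENNReal.rpow_ne_top_of_nonneg (by positivity) ENNReal.coe_ne_top) (ENNReal.rpow_ne_top_of_nonneg (by positivity) hB.ne)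
  intro a G hac ha hal hG
  have ham := hac.measurable
  let f0 : Euc (n + 1) → ℝ≥0∞ := fun x => ENNReal.ofReal (a x ^ (1/q) * ‖G x‖ * |lastC x| ^ (-s/q))
  have hf0 : AEMeasurable f0 (volume.restrict (Box (n + 1))) := by
    have := hG.norm.aemeasurable
    have m1 : Measurable fun x : Euc (n + 1) => a x ^ (1/q) := by fun_prop
    have m2 : Measurable fun x : Euc (n + 1) => |lastC x| ^ (-s/q) := by fun_prop
    exact ((m1.aemeasurable.mul this).mul m2.aemeasurable).ennreal_ofReal
  let f : Euc (n + 1) × Euc n → ℝ≥0∞ := (Cset n).indicator fun w => f0 w.1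
  have hfme : AEMeasurable f ((volume.restrict (Box (n + 1))).prod ν) :=
    AEMeasurable.indicator (hf0.comp_quasiMeasurePreserving Measure.quasiMeasurePreserving_fst) Cset_closed.measurableSet
  have hpt : ∀ xb ∈ S, ∀ x ∈ Box (n + 1), ENNReal.ofReal (Kc xb x * ‖G x‖) ≤ f (x, xb) * g (x, xb) := by
    intro xb hxb x hx
    unfold Kc
    split_ifs with hc
    · have hc' : (x, xb) ∈ Cset n := hc
      simp only [f, g, f0]
      rw [indicator_of_mem hc', indicator_of_mem hc', ← ENNReal.ofReal_mul (mul_nonneg (mul_nonneg (Real.rpow_nonneg (ha x) _) (norm_nonneg _)) (by positivity))]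
      by_cases hz : lastC x = 0
      · rw [hz, abs_zero, _root_.inv_zero, zero_pow (by omega)]; simp
      have az := abs_pos.2 hz
      refine ENNReal.ofReal_le_ofReal ?_
      have hd : infDist (frontC x) S ≤ |lastC x| / 32 :=
        (infDist_le_dist_of_mem hxb).trans (by rw [dist_eq_norm]; exact hc)
      have h1 := hal x (hx (Fin.last n)).le hd
      have h2 : (|lastC x| / 4) ^ (α' / q) ≤ a x ^ (1 / q) := by
        have := Real.rpow_le_rpow (by positivity) h1 (show 0 ≤ 1/q by positivity)
        rwa [← Real.rpow_mul (by positivity), mul_one_div] at this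
      have e2 : (|lastC x|⁻¹) ^ n = (|lastC x| / 4) ^ (α' / q) * |lastC x| ^ (-s/q) * (4 ^ (α' / q) * |lastC x| ^ b) := by
        rw [Real.div_rpow az.le (by norm_num)]
        have : |lastC x| ^ (α' / q) * |lastC x| ^ (-s/q) * |lastC x| ^ b = (|lastC x|⁻¹) ^ n := by
          rw [← Real.rpow_add az, ← Real.rpow_add az, inv_pow, ← Real.rpow_natCast, ← Real.rpow_neg az.le]
          congr 1; rw [hb]; ring
        rw [← this]
        have : (4:ℝ) ^ (α' / q) ≠ 0 := by positivity
        field_simp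
      rw [e2, hCg]
      calc _ = (|lastC x| / 4) ^ (α' / q) * (‖G x‖ * |lastC x| ^ (-s/q) * (2 * 4 ^ (α' / q) * |lastC x| ^ b)) := by ring
        _ ≤ a x ^ (1 / q) * (‖G x‖ * |lastC x| ^ (-s/q) * (2 * 4 ^ (α' / q) * |lastC x| ^ b)) := by gcongr
        _ = _ := by ring
    · simp
  have hf1 : ∫⁻ w, f w ^ q ∂((volume.restrict (Box (n + 1))).prod ν) ≤ K * ∫⁻ x in Box (n + 1), ENNReal.ofReal (a x * ‖G x‖ ^ q) := by
    rw [lintegral_prod _ (hfme.pow_const q), ← lintegral_const_mul' _ _ ENNReal.coe_ne_top]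
    refine lintegral_mono fun x => ?_
    have : ∀ xb, f (x, xb) ^ q = (closedBall (frontC x) (|lastC x| / 32)).indicator (fun _ => f0 x ^ q) xb := by
      intro xb
      by_cases hc : (x, xb) ∈ Cset n
      · simp only [f]
        rw [indicator_of_mem hc, indicator_of_mem]
        rw [mem_closedBall, dist_comm, dist_eq_norm]; exact hc
      · simp only [f]
        rw [indicator_of_notMem hc, indicator_of_notMem, ENNReal.zero_rpow_of_pos hq0]
        rw [mem_closedBall, dist_comm, dist_eq_norm]; exact hc
    simp only [this]
    rw [lintegral_indicator_const measurableSet_closedBall]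
    have ha' := ha x
    simp only [f0]
    rw [ENNReal.ofReal_rpow_of_nonneg (by positivity) hq0.le, Real.mul_rpow (by positivity) (by positivity),
      Real.mul_rpow (by positivity) (by positivity), ← Real.rpow_mul ha', ← Real.rpow_mul (abs_nonneg _),
      one_div_mul_cancel hq0.ne', Real.rpow_one, div_mul_cancel₀ _ hq0.ne']
    by_cases hz : lastC x = 0
    · rw [hz, abs_zero, Real.zero_rpow (by linarith)]; simp
    have az := abs_pos.2 hz
    calc _ ≤ ENNReal.ofReal (a x * ‖G x‖ ^ q * |lastC x| ^ (-s)) * (K * ENNReal.ofReal ((|lastC x|) ^ s)) := by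
          gcongr
          refine (hK _ _ (by positivity)).trans ?_
          gcongr; linarith
      _ = _ := by
          rw [mul_left_comm, ← ENNReal.ofReal_mul (by positivity), mul_assoc, ← Real.rpow_add az]; simp
  calc _ ≤ ∫⁻ xb, (∫⁻ x in Box (n + 1), f (x, xb) * g (x, xb)) ∂ν := by
        refine lintegral_mono_ae ?_
        have : ∀ᵐ xb ∂ν, xb ∈ S := hF.conc
        filter_upwards [this] with xb hxb
        exact setLIntegral_mono' box_open.measurableSet (hpt xb hxb)
    _ = ∫⁻ w, (f * g) w ∂((volume.restrict (Box (n + 1))).prod ν) := by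
        rw [lintegral_prod_symm _ (hfme.mul hgm.aemeasurable)]; rfl
    _ ≤ (∫⁻ w, f w ^ q ∂((volume.restrict (Box (n + 1))).prod ν)) ^ (1/q) * (∫⁻ w, g w ^ q' ∂((volume.restrict (Box (n + 1))).prod ν)) ^ (1/q') :=
        ENNReal.lintegral_mul_le_Lp_mul_Lq _ hqq hfme hgm.aemeasurable
    _ ≤ (K * ∫⁻ x in Box (n + 1), ENNReal.ofReal (a x * ‖G x‖ ^ q)) ^ (1/q) * (∫⁻ w, g w ^ q' ∂((volume.restrict (Box (n + 1))).prod ν)) ^ (1/q') := by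
        gcongr
    _ = _ := by
        rw [ENNReal.mul_rpow_of_nonneg _ _ (by positivity)]; ring
end

noncomputable section
variable {n : ℕ}

lemma adm_curl {d : ℕ} {Ω : Set (Euc d)} {w : Euc d → ℝ} {H : Euc d → Euc d →L[ℝ] ℝ} (hw : Adm Ω w H)
    {ψ : Euc d → ℝ} (h1 : ContDiff ℝ (⊤ : ℕ∞) ψ) (h2 : HasCompactSupport ψ) (e f : Euc d) :
    ∫ x, fderiv ℝ ψ x e * H x f = ∫ x, fderiv ℝ ψ x f * H x e := by
  have hs : ∀ v : Euc d, ContDiff ℝ (⊤ : ℕ∞) (fun x => fderiv ℝ ψ x v) := fun v =>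
    (h1.fderiv_right (m := (⊤ : ℕ∞)) (by simp)).clm_apply contDiff_const
  have hc : ∀ v : Euc d, HasCompactSupport (fun x => fderiv ℝ ψ x v) := fun v => h2.fderiv_apply ℝ v
  have a := hw.1.pair (hs e) (hc e) (subset_univ _) f
  have b := hw.1.pair (hs f) (hc f) (subset_univ _) e
  have hsym : ∀ x, fderiv ℝ (fun x => fderiv ℝ ψ x e) x f = fderiv ℝ (fun x => fderiv ℝ ψ x f) x e := by
    intro x
    have hd : DifferentiableAt ℝ (fderiv ℝ ψ) x := (h1.fderiv_right (m := (⊤ : ℕ∞)) (by simp)).differentiable (by simp) x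
    have ap : ∀ v u : Euc d, fderiv ℝ (fun x => fderiv ℝ ψ x v) x u = fderiv ℝ (fderiv ℝ ψ) x u v := fun v u => by
      rw [fderiv_clm_apply hd (differentiableAt_const v)]; simp
    rw [ap, ap]
    exact (h1.contDiffAt.isSymmSndFDerivAt (by rw [minSmoothness_of_isRCLikeNormedField]; exact WithTop.coe_le_coe.2 (le_top : (2 : ℕ∞) ≤ ⊤))) f e
  simp only [hsym, setIntegral_univ] at a b
  rw [b] at a
  linarith

lemma tsum_integrable {α E : Type*} [MeasurableSpace α] {μ : Measure α} [NormedAddCommGroup E] {F : ℕ → α → E}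
    (hF : ∀ i, Integrable (F i) μ) (hs : Summable fun i => ∫ a, ‖F i a‖ ∂μ) (hx : ∀ x, ∃ k, ∀ i ≠ k, F i x = 0) :
    Integrable (fun x => ∑' i, F i x) μ := by
  have h1 : ∀ x, HasSum (fun i => F i x) (∑' i, F i x) := fun x => by
    obtain ⟨k, hk⟩ := hx x
    exact (hasSum_single k hk).summable.hasSum
  refine ⟨aestronglyMeasurable_of_tendsto_ae atTop (f := fun N x => ∑ i ∈ Finset.range N, F i x)
    (fun N => Finset.aestronglyMeasurable_fun_sum _ fun i _ => (hF i).1) (ae_of_all _ fun x => (h1 x).tendsto_sum_nat), ?_⟩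
  unfold HasFiniteIntegral
  calc _ ≤ ∫⁻ x, ∑' i, ‖F i x‖ₑ ∂μ := by
        refine lintegral_mono fun x => ?_
        obtain ⟨k, hk⟩ := hx x
        simp only []
        rw [tsum_eq_single k hk]
        exact ENNReal.le_tsum k
    _ = ∑' i, ENNReal.ofReal (∫ a, ‖F i a‖ ∂μ) := by
        rw [lintegral_tsum fun i => (hF i).1.enorm]
        exact tsum_congr fun i => (ofReal_integral_norm_eq_lintegral_enorm (hF i)).symm
    _ < ⊤ := hs.tsum_ofReal_lt_top

def rh (k : ℕ) : ℝ := (1/2) ^ (k + 2)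
def lm (k : ℕ) : ℝ := 16 / rh k
lemma rh_pos (k : ℕ) : 0 < rh k := by unfold rh; positivity
lemma rh_le (k : ℕ) : rh k ≤ 1/4 := by
  unfold rh; rw [pow_add]
  have : ((1:ℝ)/2) ^ k ≤ 1 := pow_le_one₀ (by norm_num) (by norm_num)
  nlinarith
lemma lm_pos (k : ℕ) : 0 < lm k := div_pos (by norm_num) (rh_pos k)
lemma lm_ge (k : ℕ) : 1 ≤ lm k := by unfold lm; rw [le_div_iff₀ (rh_pos k)]; linarith [rh_le k]
lemma rh_half {j k : ℕ} (h : j < k) : rh k ≤ rh j / 2 := by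
  unfold rh
  have : ((1:ℝ)/2) ^ (k + 2) ≤ (1/2) ^ (j + 2 + 1) := pow_le_pow_of_le_one (by norm_num) (by norm_num) (by omega)
  rw [pow_succ _ (j + 2)] at this; linarith
def xk (n k : ℕ) : Euc (n + 1) := EuclideanSpace.single 0 (-1/2 - rh k) + EuclideanSpace.single (Fin.last n) 1
def Sk (k : ℕ) (x : Euc (n + 1)) : Euc (n + 1) := lm k • (x - xk n k)
lemma xk_zero (hn : 1 ≤ n) (k : ℕ) : (xk n k) 0 = -1/2 - rh k := by
  have : (0 : Fin (n + 1)) ≠ Fin.last n := by rw [Ne, Fin.ext_iff]; simp; omega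
  simp [xk, this]
lemma xk_last (hn : 1 ≤ n) (k : ℕ) : (xk n k) (Fin.last n) = 1 := by
  have : (Fin.last n) ≠ (0 : Fin (n + 1)) := by rw [Ne, Fin.ext_iff]; simp; omega
  simp [xk, this]
lemma Sk_le {k : ℕ} {x : Euc (n + 1)} {c : ℝ} : ‖Sk k x‖ ≤ c ↔ ‖x - xk n k‖ ≤ c * rh k / 16 := by
  have := rh_pos k
  unfold Sk
  rw [norm_smul, Real.norm_of_nonneg (lm_pos k).le, lm, div_mul_eq_mul_div, div_le_iff₀ this, le_div_iff₀ (by norm_num)]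
  constructor <;> intro h <;> linarith
lemma Sk_coord {k : ℕ} {x : Euc (n + 1)} (h : ‖Sk k x‖ ≤ 3) (i : Fin (n + 1)) : |x i - xk n k i| ≤ 3 * rh k / 16 := by
  have := (PiLp.norm_apply_le (x - xk n k) i).trans (Sk_le.1 h)
  simpa using this
lemma Sk_region (hn : 1 ≤ n) {k : ℕ} {x : Euc (n + 1)} (h : ‖Sk k x‖ ≤ 3) : x 0 < -1/2 ∧ 1/2 < lastC x := by
  have h0 := Sk_coord h 0
  have h1 := Sk_coord h (Fin.last n)
  rw [xk_zero hn] at h0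
  rw [xk_last hn] at h1
  have := rh_le k; have := rh_pos k
  rw [abs_le] at h0 h1
  unfold lastC
  constructor <;> linarith
lemma Sk_disj (hn : 1 ≤ n) {j k : ℕ} {x : Euc (n + 1)} (h : ‖Sk j x‖ ≤ 3) (h' : ‖Sk k x‖ ≤ 3) : j = k := by
  have h0 := Sk_coord h 0
  have h1 := Sk_coord h' 0
  rw [xk_zero hn] at h0 h1
  rw [abs_le] at h0 h1
  have := rh_pos k; have := rh_pos j
  rcases lt_trichotomy j k with h | h | h
  · have := rh_half h; linarith
  · exact h
  · have := rh_half h; linarith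
lemma Sk_box (hn : 1 ≤ n) {k : ℕ} {x : Euc (n + 1)} (h : ‖Sk k x‖ ≤ 3) : x ∈ Box (n + 1) ↔ lastC (Sk k x) < 0 := by
  have e : lastC (Sk k x) = lm k * (lastC x - 1) := by
    unfold Sk; rw [lastC_smul, lastC_sub]; congr 2; exact xk_last hn k
  rw [e, mul_neg_iff]
  have hl := lm_pos k
  have := rh_le k; have := rh_pos k
  constructor
  · intro hx
    have := hx (Fin.last n)
    rw [abs_lt] at this
    exact Or.inl ⟨hl, by unfold lastC; linarith⟩
  · rintro (⟨_, h2⟩ | ⟨h2, _⟩)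
    · intro i
      have hi := Sk_coord h i
      rw [abs_le] at hi
      rw [abs_lt]
      by_cases i0 : i = 0
      · subst i0; rw [xk_zero hn] at hi; constructor <;> linarith
      by_cases il : i = Fin.last n
      · subst il; rw [xk_last hn] at hi; unfold lastC at h2; constructor <;> linarith
      · have : xk n k i = 0 := by simp [xk, i0, il]
        rw [this] at hi; constructor <;> linarith
    · linarith

def chi (y : Euc (n + 1)) : ℝ := psb n (frontC y) * Tf (lastC y)
def cutb (n : ℕ) : ContDiffBump (0 : Euc (n + 1)) := ⟨2, 3, by norm_num, by norm_num⟩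
def psi (y : Euc (n + 1)) : ℝ := y 0 * cutb n y
lemma chi_smooth : ContDiff ℝ (⊤ : ℕ∞) (chi (n := n)) := by
  have h1 : ContDiff ℝ (⊤ : ℕ∞) (lastC (n := n)) := by unfold lastC; fun_prop
  have h2 : ContDiff ℝ (⊤ : ℕ∞) (frontC (n := n)) := by
    rw [contDiff_euclidean]; intro i; simp only [frontC]; fun_prop
  exact ((psb n).contDiff.comp h2).mul (Tf_smooth.comp h1)
lemma chi_tsupp : tsupport (chi (n := n)) ⊆ closedBall 0 (25/16) := by
  refine closure_minimal (fun y hy => ?_) isClosed_closedBall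
  have h1 : frontC y ∈ Function.support (psb n) := left_ne_zero_of_mul hy
  have h2 : Tf (lastC y) ≠ 0 := right_ne_zero_of_mul hy
  rw [(psb n).support_eq, mem_ball_zero_iff] at h1
  have h1 : ‖frontC y‖ < 1/32 := h1
  have h3 : |lastC y| ≤ 3/2 := by
    by_contra! h2'
    exact h2 (Tf_zero (by rw [← sq_abs]; nlinarith))
  rw [mem_closedBall_zero_iff]
  exact (norm_le_split y).trans (by linarith)
lemma chi_cs : HasCompactSupport (chi (n := n)) :=
  HasCompactSupport.of_support_subset_isCompact (isCompact_closedBall 0 (25/16)) ((subset_tsupport _).trans chi_tsupp)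
lemma psi_smooth : ContDiff ℝ (⊤ : ℕ∞) (psi (n := n)) := by
  unfold psi
  exact ContDiff.mul (by fun_prop) (cutb n).contDiff
lemma psi_tsupp : tsupport (psi (n := n)) ⊆ closedBall 0 3 := by
  refine closure_minimal (fun y hy => ?_) isClosed_closedBall
  have h1 : y ∈ Function.support (cutb n) := right_ne_zero_of_mul hy
  rw [(cutb n).support_eq] at h1
  exact ball_subset_closedBall h1
lemma psi_fd {y : Euc (n + 1)} (h : ‖y‖ < 2) (v : Euc (n + 1)) : fderiv ℝ psi y v = v 0 := by
  have : psi =ᶠ[𝓝 y] (EuclideanSpace.proj 0 : Euc (n + 1) →L[ℝ] ℝ) := by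
    filter_upwards [isOpen_ball.mem_nhds (mem_ball_zero_iff.2 h)] with x hx
    have : cutb n x = 1 := (cutb n).one_of_mem_closedBall (ball_subset_closedBall hx)
    simp [psi, this]
  rw [this.fderiv_eq, ContinuousLinearMap.fderiv]; rfl
lemma psi_cs : HasCompactSupport (psi (n := n)) :=
  HasCompactSupport.of_support_subset_isCompact (isCompact_closedBall 0 3) ((subset_tsupport _).trans psi_tsupp)

def kap (n : ℕ) : ℝ := ∫ y : Euc (n + 1), ({y | lastC y < 0} : Set (Euc (n + 1))).indicator (fun y => fderiv ℝ chi y (EuclideanSpace.single (Fin.last n) 1)) y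
lemma chi_fd (y : Euc (n + 1)) : fderiv ℝ chi y (EuclideanSpace.single (Fin.last n) 1) = psb n (frontC y) * deriv Tf (lastC y) := by
  set e : Euc (n + 1) := EuclideanSpace.single (Fin.last n) 1
  have hl : lastC e = 1 := by simp [e, lastC]
  have hf : frontC e = 0 := by ext i; simp [e, frontC]
  have h1 : HasDerivAt (fun s : ℝ => chi (y + s • e)) (fderiv ℝ chi y e) 0 := by
    have c : HasDerivAt (fun s : ℝ => y + s • e) e 0 := by simpa using ((hasDerivAt_id (0:ℝ)).smul_const e).const_add y
    have d := ((chi_smooth (n := n)).differentiable (by simp) (y + (0:ℝ) • e)).hasFDerivAt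
    have := d.comp_hasDerivAt (0:ℝ) c
    rw [zero_smul, add_zero] at this
    exact this
  have h2 : HasDerivAt (fun s : ℝ => psb n (frontC y) * Tf (lastC y + s)) (psb n (frontC y) * deriv Tf (lastC y)) 0 := by
    have a : HasDerivAt Tf (deriv Tf (lastC y)) (lastC y + 0) := by
      rw [add_zero]; exact (Tf_smooth.differentiable (by simp) _).hasDerivAt
    have := (a.comp_const_add (lastC y) 0).const_mul (psb n (frontC y))
    exact this
  have h3 : (fun s : ℝ => chi (y + s • e)) = fun s : ℝ => psb n (frontC y) * Tf (lastC y + s) := by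
    funext s
    unfold chi
    rw [frontC_add, lastC_add, frontC_smul, lastC_smul, hl, hf, smul_zero, add_zero, mul_one]
  rw [h3] at h1
  exact h1.unique h2
lemma kap_pos : 0 < kap n := by
  have he : ∀ y : Euc (n + 1), ({y | lastC y < 0} : Set (Euc (n + 1))).indicator (fun y => fderiv ℝ chi y (EuclideanSpace.single (Fin.last n) 1)) y =
      psb n (frontC y) * max (deriv Tf (lastC y)) 0 := by
    intro y
    have := Tf'_sign (lastC y)
    by_cases hz : lastC y < 0
    · rw [indicator_of_mem (show y ∈ {y : Euc (n + 1) | lastC y < 0} from hz), chi_fd, max_eq_left]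
      by_contra! h; nlinarith
    · rw [indicator_of_notMem (show y ∉ {y : Euc (n + 1) | lastC y < 0} from hz), max_eq_right, mul_zero]
      by_contra! h
      rcases (not_lt.1 hz).eq_or_lt with h0 | h0
      · rw [← h0, Tf'_zero1 (by simp)] at h; exact lt_irrefl _ h
      · nlinarith
  unfold kap
  simp only [he]
  obtain ⟨z, hz, hz2⟩ := exists_deriv_eq_slope Tf (show (-2:ℝ) < -1 by norm_num)
    Tf_smooth.continuous.continuousOn (Tf_smooth.differentiable (by simp)).differentiableOn
  rw [Tf_one (z := -1) (by simp), Tf_zero (z := -2) (by norm_num)] at hz2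
  refine Continuous.integral_pos_of_hasCompactSupport_nonneg_nonzero (x := snocC 0 z) ?_ ?_ ?_ ?_
  · exact ((psb n).continuous.comp frontC_cont).mul ((Tf'_cont.comp lastC_cont).max continuous_const)
  · refine HasCompactSupport.of_support_subset_isCompact (isCompact_closedBall 0 2) fun y hy => ?_
    have h1 : frontC y ∈ Function.support (psb n) := left_ne_zero_of_mul hy
    have h2 : max (deriv Tf (lastC y)) 0 ≠ 0 := right_ne_zero_of_mul hy
    rw [(psb n).support_eq, mem_ball_zero_iff] at h1
    have h1 : ‖frontC y‖ < 1/32 := h1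
    have h3 : |lastC y| ≤ 3/2 := by
      by_contra! h2'
      exact h2 (by rw [Tf'_zero2 (by rw [← sq_abs]; nlinarith), max_self])
    rw [mem_closedBall_zero_iff]
    exact (norm_le_split y).trans (by linarith)
  · exact fun y => mul_nonneg (psb n).nonneg (le_max_right _ _)
  · rw [lastC_snoc, frontC_snoc, hz2, (psb n).one_of_mem_closedBall (mem_closedBall_self (psb n).rIn_pos.le)]
    norm_num
end

noncomputable section
variable {n : ℕ}

def ck (n : ℕ) (p : ℝ) (k : ℕ) : ℝ := lm k ^ ((n + 1) / p - 1) * (((k : ℝ) + 1) ^ 2)⁻¹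
def uk (p : ℝ) (k : ℕ) (x : Euc (n + 1)) : ℝ := ck n p k * chi (Sk k x)
def Gk (p : ℝ) (k : ℕ) (x : Euc (n + 1)) : Euc (n + 1) →L[ℝ] ℝ := (ck n p k * lm k) • fderiv ℝ chi (Sk k x)
def Ub (p : ℝ) (x : Euc (n + 1)) : ℝ := ∑' k, uk p k x
def Gb (p : ℝ) (x : Euc (n + 1)) : Euc (n + 1) →L[ℝ] ℝ := ∑' k, Gk p k x

lemma Sk_smooth (k : ℕ) : ContDiff ℝ (⊤ : ℕ∞) (Sk (n := n) k) := by
  unfold Sk; fun_prop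
lemma comp_Sk_fderiv {f : Euc (n + 1) → ℝ} (hf : Differentiable ℝ f) (k : ℕ) (x : Euc (n + 1)) :
    fderiv ℝ (fun x => f (Sk k x)) x = lm k • fderiv ℝ f (Sk k x) := by
  have h1 : HasFDerivAt (Sk (n := n) k) (lm k • ContinuousLinearMap.id ℝ (Euc (n + 1))) x :=
    ((hasFDerivAt_id x).sub_const (xk n k)).const_smul (lm k)
  have := (hf (Sk k x)).hasFDerivAt.comp x h1
  rw [show (fun x => f (Sk k x)) = f ∘ Sk k from rfl, this.fderiv]
  ext v; simp
lemma comp_Sk_cs {E : Type*} [Zero E] {f : Euc (n + 1) → E} {r : ℝ} (hf : Function.support f ⊆ closedBall 0 r) (k : ℕ) :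
    HasCompactSupport (fun x => f (Sk k x)) := by
  refine HasCompactSupport.of_support_subset_isCompact (isCompact_closedBall (xk n k) (r * rh k / 16)) fun x hx => ?_
  rw [mem_closedBall, dist_eq_norm, ← Sk_le]
  exact mem_closedBall_zero_iff.1 (hf hx)
lemma uk_supp {p : ℝ} {k : ℕ} {x : Euc (n + 1)} (h : uk p k x ≠ 0) : ‖Sk k x‖ < 2 := by
  have := mem_closedBall_zero_iff.1 (chi_tsupp (subset_tsupport _ (right_ne_zero_of_mul h : chi (Sk k x) ≠ 0)))
  linarith
lemma dchi_supp {y : Euc (n + 1)} (h : fderiv ℝ chi y ≠ 0) : ‖y‖ < 2 := by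
  have := mem_closedBall_zero_iff.1 (chi_tsupp (support_fderiv_subset ℝ h)); linarith
lemma Gk_supp {p : ℝ} {k : ℕ} {x : Euc (n + 1)} (h : Gk p k x ≠ 0) : ‖Sk k x‖ < 2 :=
  dchi_supp fun h0 => h (by rw [Gk, h0]; exact smul_zero _)
lemma ck_nn (p : ℝ) (k : ℕ) : 0 ≤ ck n p k := mul_nonneg (Real.rpow_nonneg (lm_pos k).le _) (by positivity)

lemma Gk_w11 (p : ℝ) (k : ℕ) (Ω : Set (Euc (n + 1))) (hΩ : volume Ω ≠ ⊤) : W11On Ω (uk p k) (Gk p k) := by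
  have h1 : ContDiff ℝ (⊤ : ℕ∞) (uk (n := n) p k) := contDiff_const.mul (chi_smooth.comp (Sk_smooth k))
  have h2 : HasCompactSupport (uk (n := n) p k) := (comp_Sk_cs ((subset_tsupport _).trans chi_tsupp) k).mul_left
  obtain ⟨K, hK⟩ := ContDiff.lipschitzWith_of_hasCompactSupport h2 h1 (by simp)
  have := w11_of_lip hΩ hK (h1.continuous.integrable_of_hasCompactSupport h2).integrableOn
  have e : fderiv ℝ (uk p k) = Gk (n := n) p k := by
    funext x
    have hd : Differentiable ℝ (chi (n := n)) := chi_smooth.differentiable (by simp)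
    have : fderiv ℝ (fun x => ck n p k * chi (Sk k x)) x = ck n p k • fderiv ℝ (fun x => chi (Sk k x)) x :=
      fderiv_const_mul (hd.comp ((Sk_smooth k).differentiable (by simp)) x) _
    rw [show uk p k = fun x => ck n p k * chi (Sk k x) from rfl, this, comp_Sk_fderiv hd, smul_smul]; rfl
  rwa [e] at this

/-- integral bound for functions concentrated on a small ball -/
lemma small_lint {g : Euc (n + 1) → ℝ≥0∞} {M : ℝ≥0∞} (k : ℕ) (hg : ∀ x, g x ≤ M) (h0 : ∀ x, g x ≠ 0 → ‖Sk k x‖ ≤ 3) :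
    ∫⁻ x, g x ≤ M * (ENNReal.ofReal ((3 * (lm k)⁻¹) ^ (n + 1)) * volume (ball (0 : Euc (n + 1)) 1)) := by
  have e : (3 * (lm k)⁻¹) = 3 * rh k / 16 := by unfold lm; rw [inv_div]; ring
  have hr := rh_pos k
  calc _ ≤ ∫⁻ x, (closedBall (xk n k) (3 * rh k / 16)).indicator (fun _ => M) x := by
        refine lintegral_mono fun x => ?_
        by_cases hx : g x = 0
        · rw [hx]; exact zero_le
        · rw [indicator_of_mem]
          · exact hg x
          · rw [mem_closedBall, dist_eq_norm, ← Sk_le]; exact h0 x hx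
    _ = _ := by
        rw [lintegral_indicator_const measurableSet_closedBall, Measure.addHaar_closedBall _ _ (by positivity), finrank_euclideanSpace_fin, e]

lemma sq_summable : Summable fun k : ℕ => (((k : ℝ) + 1) ^ 2)⁻¹ := by
  have := (_root_.summable_nat_add_iff 1).2 (Real.summable_nat_pow_inv (p := 2) |>.2 (by norm_num))
  refine this.congr fun k => by push_cast; rfl

lemma uk_int (p : ℝ) (k : ℕ) : Integrable (uk (n := n) p k) :=
  (continuous_const.mul (chi_smooth.continuous.comp (Sk_smooth k).continuous)).integrable_of_hasCompactSupport
    (comp_Sk_cs ((subset_tsupport _).trans chi_tsupp) k).mul_left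
lemma Gk_int (p : ℝ) (k : ℕ) : Integrable (Gk (n := n) p k) := by
  have h : Continuous fun x : Euc (n + 1) => fderiv ℝ chi (Sk k x) := (chi_smooth.continuous_fderiv (by simp)).comp (Sk_smooth k).continuous
  refine (h.const_smul (ck n p k * lm k) : Continuous (Gk (n := n) p k)).integrable_of_hasCompactSupport ?_
  exact (comp_Sk_cs (f := fderiv ℝ chi) ((support_fderiv_subset ℝ).trans chi_tsupp) k).smul_left (f := fun _ => ck n p k * lm k)

lemma uk_sum {p : ℝ} (hp : 1 < p) : (Summable fun k => ∫ x, ‖uk (n := n) p k x‖) ∧ (Summable fun k => ∫ x, ‖Gk (n := n) p k x‖) ∧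
    ∑' k, ∫⁻ x, ENNReal.ofReal (‖Gk (n := n) p k x‖ ^ p) < ⊤ := by
  obtain ⟨A, hA⟩ := (chi_cs (n := n)).exists_bound_of_continuous chi_smooth.continuous
  obtain ⟨B, hB⟩ := ((chi_cs (n := n)).fderiv ℝ).exists_bound_of_continuous (chi_smooth.continuous_fderiv (by simp))
  have hA0 : 0 ≤ A := (norm_nonneg _).trans (hA 0)
  have hB0 : 0 ≤ B := (norm_nonneg _).trans (hB 0)
  set V := volume (ball (0 : Euc (n + 1)) 1)
  have hV : V ≠ ⊤ := measure_ball_lt_top.ne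
  have hnp : ((n:ℝ) + 1) / p ≤ n + 1 := div_le_self (by positivity) hp.le
  have key : ∀ {E : Type} [NormedAddCommGroup E] (F : ℕ → Euc (n + 1) → E) (D e : ℝ), 0 ≤ D → e ≤ 0 → (∀ k, Integrable (F k)) →
      (∀ k x, ‖F k x‖ ≤ D * ck n p k * lm k ^ (e + 1)) → (∀ k x, F k x ≠ 0 → ‖Sk k x‖ ≤ 3) → Summable fun k => ∫ x, ‖F k x‖ := by
    intro E _ F D e hD he hi hb h0
    refine Summable.of_nonneg_of_le (fun k => integral_nonneg fun x => norm_nonneg _) (fun k => ?_) (sq_summable.mul_left (D * 3 ^ (n + 1) * V.toReal))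
    have h1 := small_lint (g := fun x => ‖F k x‖ₑ) (M := ENNReal.ofReal (D * ck n p k * lm k ^ (e + 1))) k
      (fun x => by rw [← ofReal_norm]; exact ENNReal.ofReal_le_ofReal (hb k x)) (fun x hx => h0 k x (by simpa using hx))
    have hl := lm_pos k
    have hcc := ck_nn (n := n) p k
    rw [integral_norm_eq_lintegral_enorm (hi k).1]
    refine (ENNReal.toReal_mono (ENNReal.mul_ne_top ENNReal.ofReal_ne_top (ENNReal.mul_ne_top ENNReal.ofReal_ne_top hV)) h1).trans ?_
    rw [ENNReal.toReal_mul, ENNReal.toReal_mul, ENNReal.toReal_ofReal (by positivity), ENNReal.toReal_ofReal (by positivity)]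
    have h2 : lm k ^ (((n:ℝ) + 1) / p - 1) * lm k ^ (e + 1) * ((lm k)⁻¹) ^ (n + 1) ≤ 1 := by
      rw [inv_pow, ← Real.rpow_natCast, ← Real.rpow_neg hl.le, ← Real.rpow_add hl, ← Real.rpow_add hl]
      refine Real.rpow_le_one_of_one_le_of_nonpos (lm_ge k) ?_
      push_cast; linarith
    unfold ck
    calc _ = D * 3 ^ (n + 1) * V.toReal * (((k:ℝ) + 1) ^ 2)⁻¹ * (lm k ^ (((n:ℝ) + 1) / p - 1) * lm k ^ (e + 1) * ((lm k)⁻¹) ^ (n + 1)) := by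
          rw [mul_pow]; ring
      _ ≤ D * 3 ^ (n + 1) * V.toReal * (((k:ℝ) + 1) ^ 2)⁻¹ * 1 := by gcongr
      _ = _ := by ring
  have iu := uk_int (n := n) p
  have iG := Gk_int (n := n) p
  have bG : ∀ k x, ‖Gk (n := n) p k x‖ ≤ B * ck n p k * lm k := fun k x => by
    have hl := lm_pos k
    have hcc := ck_nn (n := n) p k
    unfold Gk
    rw [norm_smul, Real.norm_of_nonneg (by positivity)]
    calc _ ≤ ck n p k * lm k * B := by gcongr; exact hB _
      _ = _ := by ring
  refine ⟨key _ A (-1) hA0 (by norm_num) iu (fun k x => ?_) (fun k x hx => by linarith [uk_supp hx]),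
    key _ B 0 hB0 le_rfl iG (fun k x => ?_) (fun k x hx => by linarith [Gk_supp hx]), ?_⟩
  · have hcc := ck_nn (n := n) p k
    unfold uk
    rw [norm_mul, Real.norm_of_nonneg hcc, neg_add_cancel, Real.rpow_zero, mul_one, mul_comm A]
    gcongr; exact hA _
  · rw [zero_add, Real.rpow_one]; exact bG k x
  · have hp0 : 0 < p := by linarith
    have hle : ∀ k, ∫⁻ x, ENNReal.ofReal (‖Gk (n := n) p k x‖ ^ p) ≤ ENNReal.ofReal (B ^ p * 3 ^ (n + 1) * V.toReal * (((k:ℝ) + 1) ^ 2)⁻¹) := by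
      intro k
      have hl := lm_pos k
      have hcc := ck_nn (n := n) p k
      have h1 := small_lint (g := fun x => ENNReal.ofReal (‖Gk (n := n) p k x‖ ^ p)) (M := ENNReal.ofReal ((B * ck n p k * lm k) ^ p)) k
        (fun x => by gcongr; exact bG k x) (fun x hx => by
          have : Gk p k x ≠ 0 := fun h => hx (by rw [h, norm_zero, Real.zero_rpow hp0.ne', ENNReal.ofReal_zero])
          linarith [Gk_supp this])
      refine h1.trans ?_
      rw [show volume (ball (0 : Euc (n + 1)) 1) = ENNReal.ofReal V.toReal from (ENNReal.ofReal_toReal hV).symm, ← ENNReal.ofReal_mul (by positivity), ← ENNReal.ofReal_mul (by positivity)]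
      refine ENNReal.ofReal_le_ofReal ?_
      have h2 : ck n p k * lm k = lm k ^ (((n:ℝ) + 1) / p) * (((k:ℝ) + 1) ^ 2)⁻¹ := by
        unfold ck; rw [Real.rpow_sub_one hl.ne']; field_simp
      have h3 : (lm k ^ (((n:ℝ) + 1) / p)) ^ p * ((lm k)⁻¹) ^ (n + 1) = 1 := by
        rw [← Real.rpow_mul hl.le, div_mul_cancel₀ _ hp0.ne', inv_pow, ← Real.rpow_natCast]
        push_cast
        exact mul_inv_cancel₀ (Real.rpow_pos_of_pos hl _).ne'
      have h4 : ((((k:ℝ) + 1) ^ 2)⁻¹) ^ p ≤ (((k:ℝ) + 1) ^ 2)⁻¹ := by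
        have : (((k:ℝ) + 1) ^ 2)⁻¹ ≤ 1 := inv_le_one_of_one_le₀ (one_le_pow₀ (by linarith [k.cast_nonneg (α := ℝ)]))
        exact Real.rpow_le_self_of_le_one (by positivity) this hp.le
      rw [mul_assoc B, h2, Real.mul_rpow hB0 (by positivity), Real.mul_rpow (by positivity) (by positivity), mul_pow]
      calc _ = B ^ p * 3 ^ (n + 1) * V.toReal * ((((k:ℝ) + 1) ^ 2)⁻¹) ^ p * ((lm k ^ (((n:ℝ) + 1) / p)) ^ p * ((lm k)⁻¹) ^ (n + 1)) := by ring
        _ ≤ _ := by rw [h3, mul_one]; gcongr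
    exact (ENNReal.tsum_le_tsum hle).trans_lt (sq_summable.mul_left _).tsum_ofReal_lt_top
end

noncomputable section
variable {n : ℕ}

lemma bump_one (hn : 1 ≤ n) (p : ℝ) (x : Euc (n + 1)) : ∃ k, (∀ i ≠ k, uk p i x = 0) ∧ ∀ i ≠ k, Gk p i x = 0 := by
  by_cases h : ∃ k, ‖Sk k x‖ ≤ 3
  · obtain ⟨k, hk⟩ := h
    refine ⟨k, fun i hi => ?_, fun i hi => ?_⟩ <;> by_contra h0
    · exact hi (Sk_disj hn (by linarith [uk_supp h0]) hk)
    · exact hi (Sk_disj hn (by linarith [Gk_supp h0]) hk)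
  · push Not at h
    refine ⟨0, fun i hi => ?_, fun i hi => ?_⟩ <;> by_contra h0
    · linarith [uk_supp h0, h i]
    · linarith [Gk_supp h0, h i]
lemma Gb_eq (hn : 1 ≤ n) (p : ℝ) {k : ℕ} {x : Euc (n + 1)} (h : ‖Sk k x‖ ≤ 3) : Gb p x = Gk p k x :=
  tsum_eq_single k fun i hi => by
    by_contra h0
    exact hi (Sk_disj hn (by linarith [Gk_supp h0]) h)
lemma Ub_region (hn : 1 ≤ n) {p : ℝ} {x : Euc (n + 1)} (h : ¬(x 0 < -1/2 ∧ 1/2 < lastC x)) : Ub p x = 0 ∧ Gb p x = 0 := by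
  have e : ∀ k, 3 < ‖Sk k x‖ := fun k => by
    by_contra! hk; exact h (Sk_region hn hk)
  constructor
  · have : ∀ k, uk p k x = 0 := fun k => by by_contra h0; linarith [uk_supp h0, e k]
    simp [Ub, this]
  · have : ∀ k, Gk p k x = 0 := fun k => by by_contra h0; linarith [Gk_supp h0, e k]
    simp [Gb, this]

lemma tsum_weak {α E E' : Type*} [MeasurableSpace α] {μ : Measure α} [NormedAddCommGroup E] [NormedAddCommGroup E'] [NormedSpace ℝ E']
    {F : ℕ → α → E} {P : ℕ → α → E'} (C : ℝ) (hF : ∀ i, Integrable (F i) μ)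
    (hP : ∀ i, Integrable (P i) μ) (hs : Summable fun i => ∫ a, ‖F i a‖ ∂μ) (hb : ∀ i x, ‖P i x‖ ≤ C * ‖F i x‖) :
    ∑' i, ∫ x, P i x ∂μ = ∫ x, ∑' i, P i x ∂μ := by
  refine integral_tsum_of_summable_integral_norm hP (Summable.of_nonneg_of_le (fun i => integral_nonneg fun _ => norm_nonneg _) (fun i => ?_) (hs.mul_left C))
  rw [← integral_const_mul]
  exact integral_mono (hP i).norm ((hF i).norm.const_mul C) (hb i)

lemma box_ball : Box (n + 1) ⊆ ball 0 (n + 10) := fun x hx => by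
  have := euc_norm_le x zero_le_one fun i => (hx i).le
  rw [mem_ball_zero_iff]; push_cast at this; linarith
lemma box_fin : volume (Box (n + 1)) ≠ ⊤ := ((measure_mono box_ball).trans_lt measure_ball_lt_top).ne

lemma bump_w11 (hn : 1 ≤ n) {p : ℝ} (hp : 1 < p) : W11On (Box (n + 1)) (Ub p) (Gb p) := by
  obtain ⟨s1, s2, -⟩ := uk_sum (n := n) hp
  have hB : volume (Box (n + 1)) ≠ ⊤ := box_fin
  refine ⟨(tsum_integrable (uk_int p) s1 fun x => ?_).integrableOn, (tsum_integrable (Gk_int p) s2 fun x => ?_).integrableOn, fun φ h1 h2 h3 => ?_⟩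
  · obtain ⟨k, hk, _⟩ := bump_one hn p x; exact ⟨k, hk⟩
  · obtain ⟨k, _, hk⟩ := bump_one hn p x; exact ⟨k, hk⟩
  obtain ⟨A, hA⟩ := h2.exists_bound_of_continuous h1.continuous
  obtain ⟨B, hB'⟩ := (h2.fderiv ℝ).exists_bound_of_continuous (h1.continuous_fderiv (by simp))
  have r1 : Summable fun k => ∫ x in Box (n + 1), ‖uk (n := n) p k x‖ :=
    Summable.of_nonneg_of_le (fun i => integral_nonneg fun _ => norm_nonneg _) (fun i => setIntegral_le_integral (uk_int p i).norm (ae_of_all _ fun _ => norm_nonneg _)) s1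
  have r2 : Summable fun k => ∫ x in Box (n + 1), ‖Gk (n := n) p k x‖ :=
    Summable.of_nonneg_of_le (fun i => integral_nonneg fun _ => norm_nonneg _) (fun i => setIntegral_le_integral (Gk_int p i).norm (ae_of_all _ fun _ => norm_nonneg _)) s2
  have e1 := tsum_weak (μ := volume.restrict (Box (n + 1))) (F := fun k => uk p k) (P := fun k x => uk p k x • fderiv ℝ φ x) B
    (fun i => (uk_int p i).integrableOn) (fun i => (uk_int p i).integrableOn.smul_bdd B (h1.continuous_fderiv (by simp)).aestronglyMeasurable (ae_of_all _ hB')) r1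
    (fun i x => by rw [norm_smul, mul_comm]; gcongr; exact hB' x)
  have e2 := tsum_weak (μ := volume.restrict (Box (n + 1))) (F := fun k => Gk p k) (P := fun k x => φ x • Gk p k x) A
    (fun i => (Gk_int p i).integrableOn) (fun i => (Gk_int p i).integrableOn.bdd_smul A h1.continuous.aestronglyMeasurable (ae_of_all _ hA)) r2
    (fun i x => by rw [norm_smul]; gcongr; exact hA x)
  have f1 : ∀ x, ∑' k, uk p k x • fderiv ℝ φ x = Ub p x • fderiv ℝ φ x := fun x => by
    obtain ⟨k, hk, _⟩ := bump_one hn p x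
    rw [Ub, tsum_eq_single k hk, tsum_eq_single k fun i hi => by rw [hk i hi, zero_smul]]
  have f2 : ∀ x, ∑' k, φ x • Gk p k x = φ x • Gb p x := fun x => by
    obtain ⟨k, _, hk⟩ := bump_one hn p x
    rw [Gb, tsum_eq_single k hk, tsum_eq_single k fun i hi => by rw [hk i hi, smul_zero]]
  simp only [f1, f2] at e1 e2
  rw [← e1, ← e2, ← tsum_neg]
  exact tsum_congr fun k => (Gk_w11 p k _ hB).2.2 φ h1 h2 h3

lemma bump_energy (hn : 1 ≤ n) {p : ℝ} (hp : 1 < p) : ∫⁻ x : Euc (n + 1), ENNReal.ofReal (‖Gb p x‖ ^ p) < ⊤ := by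
  refine lt_of_le_of_lt ?_ (uk_sum (n := n) hp).2.2
  rw [← lintegral_tsum fun i => (by
    have := (Gk_int (n := n) p i).1.norm.aemeasurable
    exact (this.pow_const p).ennreal_ofReal)]
  refine lintegral_mono fun x => ?_
  obtain ⟨k, _, hk⟩ := bump_one hn p x
  simp only [Gb]
  rw [tsum_eq_single k hk]
  exact ENNReal.le_tsum k
end

noncomputable section
variable {n : ℕ}

lemma split_T {s T t : ℝ} (hs : 1 < s) (hT : 0 < T) (ht : 0 ≤ t) : t ≤ T + T ^ (1 - s) * t ^ s := by
  rcases le_total t T with h | h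
  · have : 0 ≤ T ^ (1 - s) * t ^ s := by positivity
    linarith
  · have ht' : 0 < t := hT.trans_le h
    have h1 : t ^ (1 - s) ≤ T ^ (1 - s) := Real.rpow_le_rpow_of_nonpos hT h (by linarith)
    have h2 : t = t ^ (1 - s) * t ^ s := by rw [← Real.rpow_add ht']; simp
    have : t ^ (1 - s) * t ^ s ≤ T ^ (1 - s) * t ^ s := by gcongr
    linarith

lemma Sk_int (f : Euc (n + 1) → ℝ) (k : ℕ) : ∫ x, f (Sk k x) = (lm k ^ (n + 1))⁻¹ * ∫ x, f x := by
  have h1 := integral_sub_right_eq_self (μ := volume) (fun x => f (lm k • x)) (xk n k)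
  have h2 := Measure.integral_comp_smul (volume : Measure (Euc (n + 1))) f (lm k)
  rw [finrank_euclideanSpace_fin, abs_of_pos (by have := lm_pos k; positivity), smul_eq_mul] at h2
  rw [← h2, ← h1]; rfl

def Bk (k : ℕ) (x : Euc (n + 1)) (L : Euc (n + 1) →L[ℝ] ℝ) : ℝ :=
  fderiv ℝ (fun x => psi (Sk k x)) x (EuclideanSpace.single 0 1) * L (EuclideanSpace.single (Fin.last n) 1)
    - fderiv ℝ (fun x => psi (Sk k x)) x (EuclideanSpace.single (Fin.last n) 1) * L (EuclideanSpace.single 0 1)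

lemma Bk_zero {k : ℕ} {x : Euc (n + 1)} (h : 3 < ‖Sk k x‖) (L) : Bk k x L = 0 := by
  have : fderiv ℝ (fun x : Euc (n + 1) => psi (Sk k x)) x = 0 := by
    rw [comp_Sk_fderiv (psi_smooth.differentiable (by simp))]
    have : fderiv ℝ psi (Sk k x) = 0 := by
      by_contra h0
      have := mem_closedBall_zero_iff.1 (psi_tsupp (support_fderiv_subset ℝ h0)); linarith
    rw [this, smul_zero]
  simp [Bk, this]
lemma Bk_add (k : ℕ) (x : Euc (n + 1)) (L M) : Bk k x (L + M) = Bk k x L + Bk k x M := by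
  simp only [Bk, add_apply]; ring

lemma Bk_bound : ∃ C : ℝ, 0 ≤ C ∧ ∀ k (x : Euc (n + 1)) L, |Bk k x L| ≤ C * lm k * ‖L‖ := by
  obtain ⟨C, hC⟩ := ((psi_cs (n := n)).fderiv ℝ).exists_bound_of_continuous (psi_smooth.continuous_fderiv (by simp))
  have hC0 : 0 ≤ C := (norm_nonneg _).trans (hC 0)
  refine ⟨2 * C, by positivity, fun k x L => ?_⟩
  have hl := lm_pos k
  have b : ∀ i j : Fin (n + 1), |fderiv ℝ (fun x => psi (Sk k x)) x (EuclideanSpace.single i 1) * L (EuclideanSpace.single j 1)| ≤ C * lm k * ‖L‖ := by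
    intro i j
    rw [comp_Sk_fderiv (psi_smooth.differentiable (by simp)), ← Real.norm_eq_abs, norm_mul]
    gcongr
    · refine (ContinuousLinearMap.le_opNorm _ _).trans ?_
      rw [norm_smul, Real.norm_of_nonneg hl.le, EuclideanSpace.norm_single, norm_one, mul_one, mul_comm C]
      gcongr; exact hC _
    · refine (ContinuousLinearMap.le_opNorm _ _).trans ?_
      rw [EuclideanSpace.norm_single, norm_one, mul_one]
  unfold Bk
  refine (abs_sub _ _).trans ?_
  linarith [b 0 (Fin.last n), b (Fin.last n) 0]

lemma Bk_H {w : Euc (n + 1) → ℝ} {H} (hw : Adm (Box (n + 1)) w H) (k : ℕ) :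
    Integrable (fun x => Bk k x (H x)) ∧ ∫ x in Box (n + 1), Bk k x (H x) = 0 := by
  have h1 : ContDiff ℝ (⊤ : ℕ∞) (fun x : Euc (n + 1) => psi (Sk k x)) := psi_smooth.comp (Sk_smooth k)
  have h2 : HasCompactSupport (fun x : Euc (n + 1) => psi (Sk k x)) := comp_Sk_cs ((subset_tsupport _).trans psi_tsupp) k
  have hi : ∀ e f : Euc (n + 1), Integrable fun x => fderiv ℝ (fun x : Euc (n + 1) => psi (Sk k x)) x e * H x f := fun e f => by
    have hH : Integrable H := integrableOn_univ.1 hw.1.2.1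
    exact test_int2 (hH.apply_continuousLinearMap f) ((h1.continuous_fderiv (by simp)).clm_apply continuous_const) (h2.fderiv_apply ℝ e)
  refine ⟨(hi _ _).sub (hi _ _), ?_⟩
  rw [setIntegral_eq_integral_of_forall_compl_eq_zero (fun x hx => by rw [hw.2.2 x hx]; simp [Bk])]
  unfold Bk
  rw [integral_sub (hi _ _) (hi _ _), adm_curl hw h1 h2, sub_self]

lemma Bk_Gk (hn : 1 ≤ n) (p : ℝ) (k : ℕ) : (Integrable fun x : Euc (n + 1) => Bk k x (Gk p k x)) ∧
    ∫ x in Box (n + 1), Bk k x (Gk p k x) = ck n p k * lm k ^ 2 * (lm k ^ (n + 1))⁻¹ * kap n := by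
  have hne : (0 : Fin (n + 1)) ≠ Fin.last n := by rw [Ne, Fin.ext_iff]; simp; omega
  have e1 : ∀ x : Euc (n + 1), Bk k x (Gk p k x) = lm k * (Gk p k x (EuclideanSpace.single (Fin.last n) 1)) := fun x => by
    by_cases h : Gk p k x = 0
    · rw [h]; simp [Bk]
    · have h2 := Gk_supp h
      unfold Bk
      rw [comp_Sk_fderiv (psi_smooth.differentiable (by simp)), smul_apply, smul_apply, psi_fd h2, psi_fd h2]
      simp [hne]
  have hi : Integrable fun x : Euc (n + 1) => Bk k x (Gk p k x) := by
    simp only [e1]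
    exact ((Gk_int p k).apply_continuousLinearMap _).const_mul _
  refine ⟨hi, ?_⟩
  rw [← integral_indicator box_open.measurableSet, kap, mul_assoc, ← Sk_int, ← integral_const_mul]
  congr 1; funext x
  by_cases h : ‖Sk k x‖ ≤ 3
  · have hb := Sk_box hn h
    by_cases hx : x ∈ Box (n + 1)
    · rw [indicator_of_mem hx, indicator_of_mem (show Sk k x ∈ {y | lastC y < 0} from hb.1 hx), e1]
      simp only [Gk, smul_apply, smul_eq_mul]; ring
    · rw [indicator_of_notMem hx, indicator_of_notMem (show Sk k x ∉ {y | lastC y < 0} from fun h => hx (hb.2 h)), mul_zero]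
  · push Not at h
    have h0 : fderiv ℝ chi (Sk k x) = 0 := by
      by_contra h0; linarith [dchi_supp h0]
    have h1 : Bk k x (Gk p k x) = 0 := Bk_zero h _
    simp [indicator, h0, h1]

lemma bump_unb (hn : 1 ≤ n) {p s : ℝ} (hp : 1 < p) (hs : p < s) {w : Euc (n + 1) → ℝ} {H} {G' : Euc (n + 1) → Euc (n + 1) →L[ℝ] ℝ}
    (hw : Adm (Box (n + 1)) w H) (hG' : ∀ x, x 0 < -1/2 → 1/2 < lastC x → G' x = 0) :
    ¬ MemLp (fun x => ‖G' x + Gb p x + H x‖) (ENNReal.ofReal s) (volume.restrict (Box (n + 1))) := by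
  intro hM
  have hs1 : 1 < s := hp.trans hs
  have hp0 : 0 < p := by linarith
  have hs0 : 0 < s := by linarith
  set G := fun x => G' x + Gb p x + H x with hG
  set J := ∫⁻ x in Box (n + 1), ENNReal.ofReal (‖G x‖ ^ s) with hJ
  have hJf : J ≠ ⊤ := by
    have := hM.eLpNorm_lt_top
    rw [eLpNorm_lt_top_iff_lintegral_rpow_enorm_lt_top (by simpa using hs0) ENNReal.ofReal_ne_top, ENNReal.toReal_ofReal hs0.le] at this
    refine ne_of_eq_of_ne (lintegral_congr fun x => ?_) this.ne
    rw [← ENNReal.ofReal_rpow_of_nonneg (norm_nonneg _) hs0.le, ofReal_norm, enorm_norm]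
  obtain ⟨C, hC0, hC⟩ := Bk_bound (n := n)
  set V := volume (ball (0 : Euc (n + 1)) 1)
  have hV : V ≠ ⊤ := measure_ball_lt_top.ne
  set δ : ℝ := (n + 1) / p - (n + 1) / s with hδ
  have hδ0 : 0 < δ := sub_pos.2 (div_lt_div_of_pos_left (by positivity) hp0 hs)
  have main : ∀ k : ℕ, kap n * lm k ^ δ ≤ C * (3 ^ (n + 1) * V.toReal + J.toReal) * ((k:ℝ) + 1) ^ 2 := by
    intro k
    have hl := lm_pos k
    have e : ∀ x, Bk k x (G x) = Bk k x (Gk p k x) + Bk k x (H x) := fun x => by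
      rcases le_or_gt ‖Sk k x‖ 3 with h | h
      · obtain ⟨h1, h2⟩ := Sk_region hn h
        simp only [hG]
        rw [hG' x h1 h2, zero_add, Bk_add, Gb_eq hn p h]
      · simp [Bk_zero h]
    have lower : ∫ x in Box (n + 1), Bk k x (G x) = ck n p k * lm k ^ 2 * (lm k ^ (n + 1))⁻¹ * kap n := by
      simp only [e]
      rw [integral_add (Bk_Gk hn p k).1.integrableOn (Bk_H hw k).1.integrableOn, (Bk_H hw k).2, add_zero, (Bk_Gk hn p k).2]
    set T := lm k ^ (((n:ℝ) + 1) / s) with hT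
    have hT0 : 0 < T := Real.rpow_pos_of_pos hl _
    have upper : ENNReal.ofReal (∫ x in Box (n + 1), Bk k x (G x)) ≤
        ENNReal.ofReal (C * lm k) * (ENNReal.ofReal T * (ENNReal.ofReal ((3 * (lm k)⁻¹) ^ (n + 1)) * V) + ENNReal.ofReal (T ^ (1 - s)) * J) := by
      have h1 := small_lint (n := n) (g := fun x => if ‖Sk k x‖ ≤ 3 then ENNReal.ofReal T else 0) (M := ENNReal.ofReal T) k
        (fun x => by split_ifs; exacts [le_rfl, zero_le]) (fun x hx => by by_contra h; exact hx (if_neg h))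
      calc _ ≤ ‖∫ x in Box (n + 1), Bk k x (G x)‖ₑ := by
            rw [← ofReal_norm]; exact ENNReal.ofReal_le_ofReal (le_abs_self _)
        _ ≤ ∫⁻ x in Box (n + 1), ‖Bk k x (G x)‖ₑ := enorm_integral_le_lintegral_enorm _
        _ ≤ ∫⁻ x in Box (n + 1), ENNReal.ofReal (C * lm k) * ((if ‖Sk k x‖ ≤ 3 then ENNReal.ofReal T else 0) + ENNReal.ofReal (T ^ (1 - s)) * ENNReal.ofReal (‖G x‖ ^ s)) := by
            refine lintegral_mono fun x => ?_
            simp only []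
            split_ifs with h
            · rw [← ENNReal.ofReal_mul (by positivity), ← ENNReal.ofReal_add (by positivity) (by positivity), ← ENNReal.ofReal_mul (by positivity), ← ofReal_norm]
              refine ENNReal.ofReal_le_ofReal ((hC k x (G x)).trans ?_)
              gcongr; exact split_T hs1 hT0 (norm_nonneg _)
            · rw [Bk_zero (not_le.1 h)]; simp
        _ ≤ _ := by
            rw [lintegral_const_mul' _ _ ENNReal.ofReal_ne_top, lintegral_add_left, lintegral_const_mul' _ _ ENNReal.ofReal_ne_top]
            · gcongr
              exact (setLIntegral_le_lintegral _ _).trans h1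
            · exact Measurable.ite (measurableSet_le (Sk_smooth k).continuous.norm.measurable measurable_const) measurable_const measurable_const
    rw [lower, show V = ENNReal.ofReal V.toReal from (ENNReal.ofReal_toReal hV).symm, show J = ENNReal.ofReal J.toReal from (ENNReal.ofReal_toReal hJf).symm,
      ← ENNReal.ofReal_mul (by positivity), ← ENNReal.ofReal_mul (by positivity), ← ENNReal.ofReal_mul (by positivity), ← ENNReal.ofReal_add (by positivity) (by positivity),
      ← ENNReal.ofReal_mul (by positivity), ENNReal.ofReal_le_ofReal_iff (by positivity)] at upper
    have t1 : T * ((lm k)⁻¹) ^ (n + 1) = T * (lm k ^ (n + 1))⁻¹ := by rw [inv_pow]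
    have t2 : T ^ (1 - s) = T * (lm k ^ (n + 1))⁻¹ := by
      rw [Real.rpow_sub hT0, Real.rpow_one, div_eq_mul_inv]
      congr 2
      rw [hT, ← Real.rpow_mul hl.le, div_mul_cancel₀ _ hs0.ne', ← Real.rpow_natCast]; push_cast; rfl
    have t3 : lm k ^ δ * T = lm k ^ (((n:ℝ) + 1) / p) := by
      rw [hT, ← Real.rpow_add hl]; congr 1; rw [hδ]; ring
    have t4 : ck n p k * lm k ^ 2 = lm k ^ δ * T * lm k * (((k:ℝ) + 1) ^ 2)⁻¹ := by
      rw [t3]; unfold ck; rw [Real.rpow_sub_one hl.ne']; field_simp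
    have hQ : 0 < (lm k ^ (n + 1))⁻¹ := by positivity
    rw [t4, t2, mul_pow] at upper
    have hP : 0 < T * lm k * (lm k ^ (n + 1))⁻¹ := by positivity
    have hk : 0 < ((k:ℝ) + 1) ^ 2 := by positivity
    have u2 : kap n * lm k ^ δ * (((k:ℝ) + 1) ^ 2)⁻¹ ≤ C * (3 ^ (n + 1) * V.toReal + J.toReal) := by
      refine le_of_mul_le_mul_right ?_ hP
      rw [inv_pow] at upper
      calc _ = _ := by ring
        _ ≤ _ := upper
        _ = _ := by ring
    rwa [← div_eq_mul_inv, div_le_iff₀ hk] at u2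
  set M := C * (3 ^ (n + 1) * V.toReal + J.toReal)
  have hr : 1 < (2:ℝ) ^ δ := Real.one_lt_rpow (by norm_num) hδ0
  have hlm : ∀ k, (2:ℝ) ^ (k + 1) ≤ lm k := fun k => by
    unfold lm rh
    rw [le_div_iff₀ (by positivity), one_div, inv_pow, ← div_eq_mul_inv, div_le_iff₀ (by positivity), pow_succ _ (k + 1)]
    have : (0:ℝ) < 2 ^ (k + 1) := by positivity
    linarith
  have hlim := (tendsto_pow_const_div_const_pow_of_one_lt 2 hr).const_mul M
  rw [mul_zero] at hlim
  obtain ⟨N, hN⟩ := ((hlim.eventually (gt_mem_nhds (kap_pos (n := n)))).and (eventually_ge_atTop 1)).exists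
  obtain ⟨k, rfl⟩ : ∃ k, N = k + 1 := ⟨N - 1, by omega⟩
  have h1 := main k
  have h2 : ((2:ℝ) ^ δ) ^ (k + 1) ≤ lm k ^ δ := by
    rw [← Real.rpow_natCast, ← Real.rpow_mul (by norm_num), mul_comm, Real.rpow_mul (by norm_num), Real.rpow_natCast]
    exact Real.rpow_le_rpow (by positivity) (hlm k) hδ0.le
  have h3 := hN.1
  rw [mul_div_assoc', div_lt_iff₀ (by positivity)] at h3
  push_cast at h3
  have := mul_le_mul_of_nonneg_left h2 (kap_pos (n := n)).le
  linarith
end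

noncomputable section
variable {n : ℕ}

lemma FracData.dim {s0 : ℝ} {ν : Measure (Euc n)} {S A : Set (Euc n)} (h : FracData n s0 ν S) (h0 : 0 < s0) (hA : A ⊆ S) (hν : ν A ≠ 0) :
    dimH A = ENNReal.ofReal s0 := by
  refine le_antisymm ((dimH_mono hA).trans ?_) ?_
  · refine dimH_le_of_hausdorffMeasure_ne_top (d := s0.toNNReal) ?_
    rw [Real.coe_toNNReal _ h0.le]
    choose F hF1 hF2 using h.cover
    have hr : Tendsto (fun k : ℕ => ENNReal.ofReal (2 * (n * (1/2) ^ k))) atTop (𝓝 0) := by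
      rw [← ENNReal.ofReal_zero]
      refine ENNReal.tendsto_ofReal ?_
      have := ((_root_.tendsto_pow_atTop_nhds_zero_of_lt_one (r := (1:ℝ)/2) (by norm_num) (by norm_num)).const_mul (n:ℝ)).const_mul 2
      simpa using this
    have hd : ∀ (k : ℕ) (y : Euc n), ediam (closedBall y (n * (1/2) ^ k)) ≤ ENNReal.ofReal (2 * (n * (1/2) ^ k)) := fun k y => by
      refine ediam_le fun a ha b hb => ?_
      rw [edist_dist]
      refine ENNReal.ofReal_le_ofReal ((dist_triangle_right a b y).trans ?_)
      rw [mem_closedBall] at ha hb; linarith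
    have := Measure.hausdorffMeasure_le_liminf_sum s0 S (l := atTop) _ hr (ι := fun k => F k) (fun k y => closedBall (y : Euc n) (n * (1/2) ^ k))
      (Eventually.of_forall fun k y => hd k y) (Eventually.of_forall fun k => by
        refine (hF2 k).trans (iUnion₂_subset fun y hy => ?_)
        exact subset_iUnion_of_subset (⟨y, hy⟩ : F k) subset_rfl)
    refine (this.trans_lt (lt_of_le_of_lt (liminf_le_of_le (f := atTop) (by isBoundedDefault) (a := ENNReal.ofReal ((2 * n) ^ s0)) fun b hb => ?_) ENNReal.ofReal_lt_top)).ne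
    obtain ⟨k, hk⟩ := hb.exists
    refine hk.trans ?_
    calc _ ≤ ∑ i : F k, ENNReal.ofReal (2 * (n * (1/2) ^ k)) ^ s0 := Finset.sum_le_sum fun i _ => ENNReal.rpow_le_rpow (hd k i) h0.le
      _ = ENNReal.ofReal (((F k).card : ℝ) * (2 * (n * (1/2) ^ k)) ^ s0) := by
        rw [Finset.sum_const, nsmul_eq_mul, ENNReal.ofReal_mul (Nat.cast_nonneg _), ENNReal.ofReal_rpow_of_nonneg (by positivity) h0.le, ENNReal.ofReal_natCast]
        simp
      _ ≤ _ := by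
        refine ENNReal.ofReal_le_ofReal ?_
        rw [half_pow, ← mul_assoc 2, Real.mul_rpow (by positivity) (by positivity), ← Real.rpow_mul (by norm_num)]
        have h1 : (2:ℝ) ^ (s0 * ((k:ℝ) - √k)) * 2 ^ (-(k:ℝ) * s0) ≤ 1 := by
          rw [← Real.rpow_add (by norm_num)]
          refine Real.rpow_le_one_of_one_le_of_nonpos (by norm_num) ?_
          have : 0 ≤ s0 * √k := by positivity
          linarith
        calc _ = ((F k).card : ℝ) * 2 ^ (-(k:ℝ) * s0) * (2 * n) ^ s0 := by ring
          _ ≤ (2 ^ (s0 * ((k:ℝ) - √k)) * 2 ^ (-(k:ℝ) * s0)) * (2 * n) ^ s0 := by gcongr; exact hF1 k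
          _ ≤ 1 * (2 * n) ^ s0 := by gcongr
          _ = _ := one_mul _
  · refine ENNReal.le_of_forall_nnreal_lt fun s hs => ?_
    rcases eq_or_lt_of_le (zero_le : 0 ≤ s) with rfl | hs0
    · exact zero_le
    have hs' : (s:ℝ) < s0 := by
      rw [ENNReal.ofReal, ENNReal.coe_lt_coe] at hs
      exact (Real.lt_toNNReal_iff_coe_lt).1 hs
    obtain ⟨K, hK⟩ := h.frost s hs0 hs'
    refine le_dimH_of_hausdorffMeasure_ne_zero fun hz => hν ?_
    have hle : (K + 1 : ℝ≥0)⁻¹ • ν ≤ μH[(s:ℝ)] := by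
      refine Measure.le_hausdorffMeasure _ _ 1 one_pos fun t ht => ?_
      rcases t.eq_empty_or_nonempty with rfl | ⟨x, hx⟩
      · simp
      have hf : ediam t ≠ ⊤ := (ht.trans_lt one_lt_top).ne
      set D := (ediam t).toReal with hD
      have h1 : ∀ r, D < r → ν t ≤ K * ENNReal.ofReal (r ^ (s:ℝ)) := fun r hr => by
        refine (measure_mono fun y hy => ?_).trans (hK x r (toReal_nonneg.trans_lt hr))
        have := ENNReal.toReal_mono hf (edist_le_ediam_of_mem hy hx)
        rw [← dist_edist] at this
        exact mem_closedBall.2 (this.trans hr.le)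
      have h2 : ν t ≤ K * ENNReal.ofReal (D ^ (s:ℝ)) := by
        have hc : Tendsto (fun r : ℝ => (K:ℝ≥0∞) * ENNReal.ofReal (r ^ (s:ℝ))) (𝓝[>] D) (𝓝 (K * ENNReal.ofReal (D ^ (s:ℝ)))) :=
          ENNReal.Tendsto.const_mul (ENNReal.tendsto_ofReal (((Real.continuous_rpow_const s.coe_nonneg).tendsto D).mono_left nhdsWithin_le_nhds)) (Or.inr coe_ne_top)
        exact ge_of_tendsto hc (eventually_mem_nhdsWithin.mono fun r hr => h1 r hr)
      rw [hD, ← ENNReal.ofReal_rpow_of_nonneg toReal_nonneg s.coe_nonneg, ENNReal.ofReal_toReal hf] at h2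
      rw [Measure.smul_apply, ENNReal.smul_def, smul_eq_mul, ENNReal.coe_inv (by positivity)]
      rw [mul_comm, ← div_eq_mul_inv]
      refine ENNReal.div_le_of_le_mul (h2.trans ?_)
      rw [mul_comm]; gcongr; exact le_self_add
    have := (hle A).trans_eq hz
    rw [Measure.smul_apply, ENNReal.smul_def, smul_eq_mul] at this
    rcases mul_eq_zero.1 (le_antisymm this zero_le) with h | h
    · exact absurd h (by simp)
    · exact h

lemma snoc_iso : Isometry (fun x : Euc n => snocC x 0) := by
  refine Isometry.of_dist_eq fun x y => ?_
  have h : snocC x 0 - snocC y 0 = (snocC (x - y) 0 : Euc (n + 1)) := by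
    rw [← snoc_eta (snocC x 0 - snocC y 0), frontC_sub, lastC_sub, frontC_snoc, frontC_snoc, lastC_snoc, lastC_snoc, sub_zero]
  rw [dist_eq_norm, dist_eq_norm, h]
  have h1 := norm_front_le (snocC (x - y) 0)
  have h2 := norm_le_split (snocC (x - y) 0)
  rw [frontC_snoc] at h1 h2
  rw [lastC_snoc, abs_zero] at h2
  linarith
end

noncomputable section
variable {n : ℕ}

lemma core (hn : 1 ≤ n) {p q : ℝ} (hp : 1 < p) (hq : 1 < q) {a : Euc (n + 1) → ℝ} (hac : Continuous a) (ha : ∀ x, 0 ≤ a x)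
    (hab : ∀ x, x 0 < -1/2 → 1/2 < lastC x → a x = 0) {U0 : Euc (n + 1) → ℝ} {G0 : Euc (n + 1) → Euc (n + 1) →L[ℝ] ℝ}
    (hW : W11On (Box (n + 1)) U0 G0) (hE : ∫⁻ x in Box (n + 1), ENNReal.ofReal (‖G0 x‖ ^ p) < ⊤)
    (hz : ∀ x, a x ≠ 0 → G0 x = 0) (hG0 : ∀ x, x 0 < -1/2 → 1/2 < lastC x → G0 x = 0) :
    ∃ w H, Adm (Box (n + 1)) w H ∧ IsLocalMinimizer (Box (n + 1)) (dpf p q a) (fun x => U0 x + Ub p x + w x) (fun x => G0 x + Gb p x + H x) ∧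
      MemLp (fun x => ‖G0 x + Gb p x + H x‖) (ENNReal.ofReal p) (volume.restrict (Box (n + 1))) ∧
      (∀ s : ℝ, p < s → ¬ MemLp (fun x => ‖G0 x + Gb p x + H x‖) (ENNReal.ofReal s) (volume.restrict (Box (n + 1)))) ∧
      ∫⁻ x in Box (n + 1), ENNReal.ofReal (a x * ‖G0 x + Gb p x + H x‖ ^ q) ≤
        ENNReal.ofReal q * ((∫⁻ x in Box (n + 1), ENNReal.ofReal (‖G0 x‖ ^ p)) + ∫⁻ x : Euc (n + 1), ENNReal.ofReal (‖Gb p x‖ ^ p)) := by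
  have hp0 : 0 < p := by linarith
  have hq0 : 0 < q := by linarith
  have hW' : W11On (Box (n + 1)) (fun x => U0 x + Ub p x) (fun x => G0 x + Gb p x) := by
    have := hW.lin (bump_w11 hn hp) 1 1
    simpa only [one_mul, one_smul] using this
  have hEn : energyOf (Box (n + 1)) (dpf p q a) (fun x => ‖G0 x + Gb p x‖) ≤
      (∫⁻ x in Box (n + 1), ENNReal.ofReal (‖G0 x‖ ^ p)) + ∫⁻ x : Euc (n + 1), ENNReal.ofReal (‖Gb p x‖ ^ p) := by
    have hm : AEMeasurable (fun x => ENNReal.ofReal (‖G0 x‖ ^ p)) (volume.restrict (Box (n + 1))) :=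
      (hW.2.1.1.norm.aemeasurable.pow_const p).ennreal_ofReal
    refine le_trans ?_ (add_le_add le_rfl (setLIntegral_le_lintegral (Box (n + 1)) _))
    rw [← lintegral_add_left' hm]
    refine lintegral_mono fun x => ?_
    rw [← ENNReal.ofReal_add (by positivity) (by positivity)]
    refine ENNReal.ofReal_le_ofReal ?_
    have hd : ∀ y : ℝ, 0 ≤ y → y / p ≤ y := fun y hy => div_le_self hy hp.le
    show ‖G0 x + Gb p x‖ ^ p / p + a x * ‖G0 x + Gb p x‖ ^ q / q ≤ ‖G0 x‖ ^ p + ‖Gb p x‖ ^ p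
    by_cases h : x 0 < -1/2 ∧ 1/2 < lastC x
    · rw [hG0 x h.1 h.2, hab x h.1 h.2]
      simp only [zero_add, norm_zero, zero_mul, zero_div, add_zero, Real.zero_rpow hp0.ne']
      exact hd _ (by positivity)
    · rw [(Ub_region hn h).2, add_zero]
      have : a x * ‖G0 x‖ ^ q / q = 0 := by
        by_cases h0 : a x = 0
        · rw [h0]; simp
        · rw [hz x h0]; simp [Real.zero_rpow hq0.ne']
      rw [this, norm_zero, Real.zero_rpow hp0.ne', add_zero, add_zero]
      exact hd _ (by positivity)
  obtain ⟨w, H, hw, hmin, hle⟩ := direct_method (by omega) box_open (isBounded_ball.subset box_ball) hp hq hac.measurable ha hac hW'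
    (hEn.trans_lt (ENNReal.add_lt_top.2 ⟨hE, bump_energy hn hp⟩))
  refine ⟨w, H, hw, hmin, ⟨hmin.1.2.1.1.norm, ?_⟩, fun s hs => bump_unb hn hp hs hw hG0, ?_⟩
  · rw [eLpNorm_lt_top_iff_lintegral_rpow_enorm_lt_top (by simpa using hp0) ENNReal.ofReal_ne_top, ENNReal.toReal_ofReal hp0.le]
    refine lt_of_le_of_lt ?_ (ENNReal.mul_lt_top (ENNReal.ofReal_lt_top (r := p)) hmin.2.1)
    unfold energyOf
    rw [← lintegral_const_mul' _ _ ENNReal.ofReal_ne_top]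
    refine lintegral_mono fun x => ?_
    rw [enorm_norm, ← ofReal_norm, ENNReal.ofReal_rpow_of_nonneg (norm_nonneg _) hp0.le, ← ENNReal.ofReal_mul hp0.le]
    exact ENNReal.ofReal_le_ofReal (pow_le_dpf hp hq ha x (norm_nonneg _))
  · refine le_trans ?_ (mul_le_mul_right (hle.trans hEn) _)
    unfold energyOf
    rw [← lintegral_const_mul' _ _ ENNReal.ofReal_ne_top]
    refine lintegral_mono fun x => ?_
    rw [← ENNReal.ofReal_mul hq0.le]
    refine ENNReal.ofReal_le_ofReal ?_
    unfold dpf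
    have h1 : 0 ≤ ‖G0 x + Gb p x + H x‖ ^ p / p := by positivity
    rw [mul_add, mul_div_cancel₀ _ hq0.ne']
    have := mul_nonneg hq0.le h1
    linarith

lemma front_zero (hn : 1 ≤ n) (x : Euc (n + 1)) : x 0 = frontC x ⟨0, hn⟩ := rfl

lemma Kc_meas {G : Euc (n + 1) → Euc (n + 1) →L[ℝ] ℝ} (hG : AEStronglyMeasurable G (volume.restrict (Box (n + 1)))) :
    Measurable fun xb : Euc n => ∫⁻ x in Box (n + 1), ENNReal.ofReal (Kc xb x * ‖G x‖) := by
  obtain ⟨g, hg, hgG⟩ := hG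
  have e : ∀ xb : Euc n, ∫⁻ x in Box (n + 1), ENNReal.ofReal (Kc xb x * ‖G x‖) = ∫⁻ x in Box (n + 1), ENNReal.ofReal (Kc xb x * ‖g x‖) := fun xb =>
    lintegral_congr_ae (hgG.mono fun x hx => by simp only [hx])
  simp only [e]
  have hl : Measurable fun w : Euc n × Euc (n + 1) => lastC w.2 := lastC_cont.measurable.comp measurable_snd
  have hv : Measurable fun w : Euc n × Euc (n + 1) => 2 * (|lastC w.2|⁻¹) ^ n :=
    ((hl.norm.inv).pow_const n).const_mul 2
  have hS : MeasurableSet {w : Euc n × Euc (n + 1) | ‖frontC w.2 - w.1‖ ≤ |lastC w.2| / 32} :=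
    (isClosed_le ((frontC_cont.comp continuous_snd).sub continuous_fst).norm
      ((lastC_cont.comp continuous_snd).abs.div_const 32)).measurableSet
  have hK : Measurable fun w : Euc n × Euc (n + 1) => Kc w.1 w.2 := by
    have := hv.indicator hS
    convert this using 1
    funext w
    by_cases h : ‖frontC w.2 - w.1‖ ≤ |lastC w.2| / 32
    · rw [indicator_of_mem (by exact h)]; unfold Kc; rw [if_pos h]
    · rw [indicator_of_notMem (by exact h)]; unfold Kc; rw [if_neg h]
  have h3 : Measurable fun w : Euc n × Euc (n + 1) => ‖g w.2‖ := hg.norm.measurable.comp measurable_snd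
  have h4 : Measurable fun w : Euc n × Euc (n + 1) => ENNReal.ofReal (Kc w.1 w.2 * ‖g w.2‖) :=
    (hK.mul h3).ennreal_ofReal
  exact Measurable.lintegral_prod_right' (ν := volume.restrict (Box (n + 1))) (f := fun w : Euc n × Euc (n + 1) => ENNReal.ofReal (Kc w.1 w.2 * ‖g w.2‖)) h4

lemma nonleb_congr {d : ℕ} {u v : Euc d → ℝ} {x : Euc d} {r0 : ℝ} (hr : 0 < r0) (h : ∀ y ∈ ball x r0, u y = v y)
    (hv : IsNonLebesguePoint v x) : IsNonLebesguePoint u x := by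
  rintro ⟨c, hc⟩
  refine hv ⟨c, hc.congr' ?_⟩
  filter_upwards [Ioo_mem_nhdsGT hr] with r hr
  rw [setAverage_eq, setAverage_eq]
  congr 1
  exact setIntegral_congr_fun measurableSet_ball fun y hy => by simp only [h y (ball_subset_ball hr.2.le hy)]

lemma case_small (hn : 1 ≤ n) {p α q : ℝ} (hp : 1 < p) (hα : 0 ≤ α) (hq : p + α < q) (hpn : p < n + 1) :
    ∃ (a : Euc (n + 1) → ℝ) (u : Euc (n + 1) → ℝ) (G : Euc (n + 1) → Euc (n + 1) →L[ℝ] ℝ),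
      (∀ x, 0 ≤ a x) ∧ InHolderCls α (closure (Box (n + 1))) a ∧
      MemLp (fun x => ‖G x‖) (ENNReal.ofReal p) (volume.restrict (Box (n + 1))) ∧
      IsLocalMinimizer (Box (n + 1)) (dpf p q a) u G ∧
      (∀ s : ℝ, p < s → ¬ MemLp (fun x => ‖G x‖) (ENNReal.ofReal s) (volume.restrict (Box (n + 1)))) ∧
      ∃ Sig : Set (Euc (n + 1)), IsClosed Sig ∧ Sig ⊆ Box (n + 1) ∧
        (∀ x ∈ Sig, IsNonLebesguePoint u x) ∧ dimH Sig = ENNReal.ofReal ((n : ℝ) + 1 - p) := by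
  have hp0 : 0 < p := by linarith
  have hq1 : 1 < q := by linarith
  have hq0 : 0 < q := by linarith
  obtain ⟨ν, S, hF⟩ := exists_frac hn (s0 := (n:ℝ) + 1 - p) (by linarith) (by linarith)
  have hν := hF.prob
  have hSc : IsClosed S := hF.comp.isClosed
  have hne := hF.ne
  obtain ⟨α', h1, h2⟩ := exists_between (show α < q - p by linarith)
  obtain ⟨s, h3, h4⟩ := exists_between (show max 0 ((n:ℝ) + 1 - q + α') < n + 1 - p from max_lt (by linarith) (by linarith))
  obtain ⟨a, hac, ha, hah, haz, hal⟩ := exists_weight hne hα h1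
  obtain ⟨C, hC, hCb⟩ := frac_bound hn hF ((le_max_left _ _).trans_lt h3) h4 hq1 (hα.trans h1.le) (by
    linarith [(le_max_right 0 ((n:ℝ) + 1 - q + α')).trans_lt h3])
  set E0 := ∫⁻ x in Box (n + 1), ENNReal.ofReal (‖GUf S x‖ ^ p) with hE0
  set E1 := ∫⁻ x : Euc (n + 1), ENNReal.ofReal (‖Gb p x‖ ^ p) with hE1
  have hE0f : E0 < ⊤ := (lintegral_mono_set box_ball).trans_lt (hF.GUf_energy hp hpn _)
  have hE1f : E1 < ⊤ := bump_energy hn hp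
  set M := C * (ENNReal.ofReal q * (E0 + E1)) ^ (1 / q) with hM
  have hMf : M ≠ ⊤ := ENNReal.mul_ne_top hC (ENNReal.rpow_ne_top_of_nonneg (by positivity) (ENNReal.mul_ne_top ENNReal.ofReal_ne_top (ENNReal.add_lt_top.2 ⟨hE0f, hE1f⟩).ne))
  obtain ⟨t, ht, ht1⟩ : ∃ t : ℝ, M.toReal * t ^ (p / q) < t * c1 n ∧ 1 ≤ t := by
    have he : 0 < 1 - p / q := sub_pos.2 ((div_lt_one hq0).2 (by linarith))
    obtain ⟨t, h, h'⟩ := (((_root_.tendsto_rpow_atTop he).eventually_gt_atTop (M.toReal / c1 n)).and (eventually_ge_atTop 1)).exists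
    refine ⟨t, ?_, h'⟩
    have ht0 : 0 < t := by linarith
    rw [div_lt_iff₀ c1_pos] at h
    calc _ < t ^ (1 - p / q) * c1 n * t ^ (p / q) := by gcongr
      _ = (t ^ (1 - p / q) * t ^ (p / q)) * c1 n := by ring
      _ = _ := by rw [← Real.rpow_add ht0, sub_add_cancel, Real.rpow_one]
  have ht0 : 0 < t := by linarith
  have x0S : ∀ y ∈ S, ∀ x : Euc (n + 1), -‖frontC x - y‖ ≤ x 0 := fun y hy x => by
    have h1 := (hF.bd y hy ⟨0, hn⟩).1
    have h2 := PiLp.norm_apply_le (frontC x - y) ⟨0, hn⟩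
    rw [PiLp.sub_apply, ← front_zero hn, Real.norm_eq_abs] at h2
    linarith [neg_abs_le (x 0 - y ⟨0, hn⟩)]
  have hdz : ∀ x, infDist (frontC x) S < |lastC x| → GUf S x = 0 := fun x hx => GUf_zero hSc hne ((min_le_left _ _).trans_lt hx)
  have hUW := hF.Uf_w11 hp hpn (n + 10) (by positivity)
  have hW0 : W11On (Box (n + 1)) (fun x => t * Uf S x) (fun x => t • GUf S x) := by
    simpa only [zero_mul, zero_smul, add_zero] using (hUW.mono box_ball).lin (hUW.mono box_ball) t 0
  have hEt : ∫⁻ x in Box (n + 1), ENNReal.ofReal (‖t • GUf S x‖ ^ p) = ENNReal.ofReal (t ^ p) * E0 := by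
    rw [hE0, ← lintegral_const_mul' _ _ ENNReal.ofReal_ne_top]
    refine lintegral_congr fun x => ?_
    rw [norm_smul, Real.norm_of_nonneg ht0.le, Real.mul_rpow ht0.le (norm_nonneg _), ENNReal.ofReal_mul (by positivity)]
  obtain ⟨w, H, hw, hmin, hmem, hunb, hen⟩ := core hn hp hq1 hac ha (U0 := fun x => t * Uf S x) (G0 := fun x => t • GUf S x)
    (fun x hx _ => by
      by_contra h0
      obtain ⟨y, hy, hy'⟩ := hF.comp.exists_infDist_eq_dist hne (frontC x)
      have := (haz x h0).2
      rw [hy', dist_eq_norm] at this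
      linarith [x0S y hy x]) hW0
    (by rw [hEt]; exact ENNReal.mul_lt_top ENNReal.ofReal_lt_top hE0f)
    (fun x hx => by rw [hdz x (haz x hx).1, smul_zero])
    (fun x _ hx => by
      rw [GUf_zero hSc hne, smul_zero]
      have := dl_le S (frontC x)
      rw [abs_of_pos (by linarith)]; linarith)
  refine ⟨a, _, _, ha, hah, hmem, hmin, hunb, ?_⟩
  set G := fun x => t • GUf S x + Gb p x + H x with hG
  set I : Euc n → ℝ≥0∞ := fun xb => ∫⁻ x in Box (n + 1), ENNReal.ofReal (Kc xb x * ‖G x‖) with hI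
  have hIm : Measurable I := Kc_meas hmin.1.2.1.1
  have hIlt : ∫⁻ xb, I xb ∂ν < ENNReal.ofReal (t * c1 n) := by
    have hen2 : ∫⁻ x in Box (n + 1), ENNReal.ofReal (a x * ‖G x‖ ^ q) ≤ ENNReal.ofReal (t ^ p) * (ENNReal.ofReal q * (E0 + E1)) := by
      refine le_trans hen ?_
      rw [hEt, mul_left_comm, mul_add (ENNReal.ofReal (t ^ p))]
      gcongr
      refine le_mul_of_one_le_left' ?_
      rw [ENNReal.one_le_ofReal]
      exact Real.one_le_rpow ht1 hp0.le
    refine ((hCb a G hac ha hal hmin.1.2.1.1).trans (mul_le_mul_right (ENNReal.rpow_le_rpow hen2 (by positivity)) _)).trans_lt ?_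
    · rw [ENNReal.mul_rpow_of_nonneg _ _ (by positivity), mul_left_comm, ← hM, ENNReal.ofReal_rpow_of_nonneg (by positivity) (by positivity),
        ← Real.rpow_mul ht0.le, mul_one_div, ← ENNReal.ofReal_toReal hMf, ← ENNReal.ofReal_mul (by positivity), mul_comm]
      exact (ENNReal.ofReal_lt_ofReal_iff (mul_pos ht0 c1_pos)).2 ht
  have hset : ν ({xb | I xb < ENNReal.ofReal (t * c1 n)} ∩ S) ≠ 0 := by
    intro h0
    refine absurd hIlt (not_lt.2 ?_)
    calc ENNReal.ofReal (t * c1 n) = ∫⁻ _, ENNReal.ofReal (t * c1 n) ∂ν := by simp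
      _ ≤ _ := by
        refine lintegral_mono_ae ?_
        have h1 : ∀ᵐ x ∂ν, x ∉ {xb | I xb < ENNReal.ofReal (t * c1 n)} ∩ S := measure_eq_zero_iff_ae_notMem.1 h0
        have h2 : ∀ᵐ x ∂ν, x ∉ Sᶜ := measure_eq_zero_iff_ae_notMem.1 hF.conc
        filter_upwards [h1, h2] with x h1 h2
        by_contra! h3
        exact h1 ⟨h3, not_not.1 h2⟩
  obtain ⟨A, hAs, hAc, hA0⟩ := ((measurableSet_lt hIm measurable_const).inter hSc.measurableSet).exists_lt_isCompact_of_ne_top (measure_ne_top ν _) (pos_iff_ne_zero.2 hset)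
  refine ⟨(fun x => snocC x 0) '' A, (hAc.image snoc_iso.continuous).isClosed, ?_, ?_, ?_⟩
  · rintro _ ⟨x, hx, rfl⟩ i
    have hb := hF.bd x (hAs hx).2
    refine Fin.lastCases ?_ (fun i => ?_) i
    · have : (snocC x 0 : Euc (n + 1)) (Fin.last n) = 0 := lastC_snoc x 0
      simp only [this]; norm_num
    · have : (snocC x 0 : Euc (n + 1)) i.castSucc = x i := congrArg (fun y : Euc n => y i) (frontC_snoc x 0)
      simp only [this]; rw [abs_lt]; constructor <;> linarith [(hb i).1, (hb i).2]
  · rintro _ ⟨xb, hx, rfl⟩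
    have hxS := (hAs hx).2
    have hxI : I xb < ENNReal.ofReal (t * c1 n) := (hAs hx).1
    refine nonleb_congr (v := fun x => t * Uf S x + 1 * w x) (r0 := 1/2) (by norm_num) (fun y hy => ?_) ?_
    · have hz : |lastC y| < 1/2 := by
        have := abs_last_le (y - snocC xb 0)
        rw [lastC_sub, lastC_snoc, sub_zero] at this
        rw [mem_ball, dist_eq_norm] at hy
        linarith
      rw [(Ub_region hn fun h => by linarith [h.2, le_abs_self (lastC y)]).1]; ring
    · by_contra hL
      have hnx : ‖snocC xb 0‖ ≤ n := by
        have h1 := norm_le_split (snocC xb 0)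
        rw [frontC_snoc, lastC_snoc, abs_zero] at h1
        have h2 := euc_norm_le xb zero_le_one fun i => by
          rw [abs_le]; constructor <;> linarith [(hF.bd xb hxS i).1, (hF.bd xb hxS i).2]
        linarith
      have := cone_est (R := n + 10) (t := t) (hUW.lin (hw.1.mono (subset_univ _)) t 1) (fun y hy => by
        rw [mem_closedBall, dist_eq_norm] at hy
        rw [mem_ball_zero_iff]
        have := norm_add_le (y - snocC xb 0) (snocC xb 0)
        rw [sub_add_cancel] at this
        linarith) (lastC_snoc xb 0) (fun x _ hx => by
          have hxB : x ∉ Box (n + 1) := fun h => absurd (h (Fin.last n)) (not_lt.2 hx)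
          rw [hw.2.1 x hxB, Uf_sign hSc hne (by linarith [dl_le S (frontC x)])]; ring) hL
      refine absurd (this.trans ?_) (not_le.2 hxI)
      rw [frontC_snoc, hI]
      simp only
      rw [← lintegral_indicator box_open.measurableSet]
      refine (setLIntegral_le_lintegral _ _).trans (lintegral_mono fun x => ?_)
      by_cases hc : ‖frontC x - xb‖ ≤ |lastC x| / 32 ∧ lastC x ≠ 0
      · have hz0 : 0 < |lastC x| := abs_pos.2 hc.2
        have hg : GUf S x = 0 := hdz x (by
          have := infDist_le_dist_of_mem (x := frontC x) hxS
          rw [dist_eq_norm] at this; linarith [hc.1])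
        rw [hg, smul_zero, zero_add, one_smul]
        by_cases hB : x ∈ Box (n + 1)
        · rw [indicator_of_mem hB]
          have hz1 : |lastC x| < 1 := hB (Fin.last n)
          have hb : Gb p x = 0 := (Ub_region hn fun h => by linarith [h.1, x0S xb hxS x, hc.1]).2
          simp only [hG]
          rw [hg, hb, smul_zero, zero_add, zero_add]
        · rw [hw.2.2 x hB]; simp
      · have : Kc xb x = 0 := by
          unfold Kc
          split_ifs with h
          · have : lastC x = 0 := by by_contra h'; exact hc ⟨h, h'⟩
            rw [this, abs_zero, _root_.inv_zero, zero_pow (by omega), mul_zero]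
          · rfl
        rw [this, zero_mul, ENNReal.ofReal_zero]; exact zero_le
  · rw [snoc_iso.dimH_image]
    exact hF.dim (by linarith) (hAs.trans inter_subset_right) hA0.ne'

lemma zero_holder {d : ℕ} (α : ℝ) (s : Set (Euc d)) : InHolderCls α s (fun _ => 0) := by
  refine ⟨contDiffOn_const, 0, fun x _ y _ => ?_⟩
  have : ∀ z, iteratedFDerivWithin ℝ ⌊α⌋₊ (fun _ : Euc d => (0:ℝ)) s z = 0 := fun z => by
    have := iteratedFDerivWithin_fun_zero (𝕜 := ℝ) (E := Euc d) (F := ℝ) (s := s) (i := ⌊α⌋₊)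
    exact congrFun this z
  simp [this]

lemma case_big (hn : 1 ≤ n) {p q : ℝ} (α : ℝ) (hp : 1 < p) (hq : 1 < q) :
    ∃ (a : Euc (n + 1) → ℝ) (u : Euc (n + 1) → ℝ) (G : Euc (n + 1) → Euc (n + 1) →L[ℝ] ℝ),
      (∀ x, 0 ≤ a x) ∧ InHolderCls α (closure (Box (n + 1))) a ∧
      MemLp (fun x => ‖G x‖) (ENNReal.ofReal p) (volume.restrict (Box (n + 1))) ∧
      IsLocalMinimizer (Box (n + 1)) (dpf p q a) u G ∧
      (∀ s : ℝ, p < s → ¬ MemLp (fun x => ‖G x‖) (ENNReal.ofReal s) (volume.restrict (Box (n + 1)))) := by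
  obtain ⟨w, H, hw, hmin, hmem, hunb, -⟩ := core hn hp hq (a := fun _ => 0) continuous_const (fun _ => le_rfl) (fun _ _ _ => rfl)
    (U0 := fun _ => 0) (G0 := fun _ => 0) ⟨int_zero, int_zero, fun φ _ _ _ => by simp⟩
    (by simp [Real.zero_rpow (by linarith : p ≠ 0)]) (fun _ _ => rfl) (fun _ _ _ => rfl)
  exact ⟨_, _, _, fun _ => le_rfl, zero_holder α _, hmem, hmin, hunb⟩
end

/-- **Theorem 1, double phase.** For `p > 1`, `α ≥ 0` and
`q > p + α max{1, (p−1)/(d−1)}` there are a nonnegative weight `a ∈ C^α(Ω̄)` and a local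
minimizer `u ∈ W^{1,p}(Ω)` of the double phase functional such that `∇u ∉ L^s(Ω)` for every
`s > p`; if moreover `p < d`, there is a closed set `Σ ⊆ Ω` of non-Lebesgue points of `u`
with Hausdorff dimension `d − p`. -/
theorem double_phase_singular_minimizer
    {d : ℕ} (hd : 2 ≤ d) (p α q : ℝ) (hp : 1 < p) (hα : 0 ≤ α)
    (hq : p + α * max 1 ((p - 1) / ((d : ℝ) - 1)) < q) :
    ∃ (a : Euc d → ℝ) (u : Euc d → ℝ) (G : Euc d → Euc d →L[ℝ] ℝ),
      (∀ x, 0 ≤ a x) ∧ InHolderCls α (closure (Box d)) a ∧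
      W11On (Box d) u G ∧
      MemLp (fun x => ‖G x‖) (ENNReal.ofReal p) (volume.restrict (Box d)) ∧
      IsLocalMinimizer (Box d) (fun x t => t ^ p / p + a x * t ^ q / q) u G ∧
      (∀ s : ℝ, p < s →
        ¬ MemLp (fun x => ‖G x‖) (ENNReal.ofReal s) (volume.restrict (Box d))) ∧
      (p < (d : ℝ) → ∃ Sig : Set (Euc d), IsClosed Sig ∧ Sig ⊆ Box d ∧
        (∀ x ∈ Sig, IsNonLebesguePoint u x) ∧
        dimH Sig = ENNReal.ofReal ((d : ℝ) - p)) := by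
  obtain ⟨n, rfl⟩ : ∃ n, d = n + 1 := ⟨d - 1, by omega⟩
  have hn : 1 ≤ n := by omega
  have hq' : p + α < q := by
    have := mul_le_mul_of_nonneg_left (le_max_left 1 ((p - 1) / (((n + 1 : ℕ) : ℝ) - 1))) hα
    linarith
  by_cases hpd : p < n + 1
  · obtain ⟨a, u, G, h1, h2, h3, h4, h5, h6⟩ := case_small hn hp hα hq' hpd
    exact ⟨a, u, G, h1, h2, h4.1, h3, h4, h5, fun _ => by push_cast; exact h6⟩
  · obtain ⟨a, u, G, h1, h2, h3, h4, h5⟩ := case_big hn α hp (by linarith : 1 < q)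
    exact ⟨a, u, G, h1, h2, h4.1, h3, h4, h5, fun h => absurd (by push_cast at h; exact h) hpd⟩
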